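/- Let q ≥ 2 be an integer, let f_1, …, f_r be M_q-functions, and let α be an algebraic number with 0 < |α| < 1 which is not a pole of any of the f_i. For every homogeneous polynomial P ∈ ℚ̄[X_1,…,X_r] with P(f_1(α),…,f_r(α)) = 0, there exist integers m_1,…,m_r ≥ 1 and a polynomial Q ∈ ℚ̄[z, (X_{i,j})_{1≤i≤r, 0≤j<m_i}], homogeneous in the variables X_{i,j}, such that Q(z, (f_i(z^{q^j}))_{1≤i≤r, 0≤j<m_i}) = 0 identically and Q(α, (X_{i,j})) = P(X_{1,0},…,X_{r,0}). In particular, every homogeneous algebraic relation over ℚ̄ among f_1(α),…,f_r(α) that is not banal is obtained by degeneration at α of a homogeneous σ_q-algebraic relation among f_1,…,f_r. -/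

import Mathlib

noncomputable section

/-- The derivative `d/dz` of a formal power series over `ℂ`. -/
def psD (f : PowerSeries ℂ) : PowerSeries ℂ :=
  PowerSeries.mk fun n => ((n : ℂ) + 1) * PowerSeries.coeff (n + 1) f

/-- The Mahler operator `σ_q : f(z) ↦ f(z^q)` on formal power series over `ℂ`. -/
def psSigma (q : ℕ) (f : PowerSeries ℂ) : PowerSeries ℂ :=
  PowerSeries.mk fun n => if q ∣ n then PowerSeries.coeff (n / q) f else 0

/-- The canonical embedding of polynomials into power series. -/
def polyPS : Polynomial ℂ →+* PowerSeries ℂ := Polynomial.coeToPowerSeries.ringHom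

/-- The power series `∑ (a n / n!) zⁿ` attached to a sequence `a` of coefficients. -/
def ePS (a : ℕ → ℂ) : PowerSeries ℂ := PowerSeries.mk fun n => a n / (n.factorial : ℂ)

/-- `IsE a` : the power series `∑ (a n / n!) zⁿ` is an E-function: its coefficients are
algebraic, it satisfies a nonzero linear differential equation over `ℚ̄[z]`, and the size of
the conjugates of the `a n` as well as their common denominators grow at most geometrically. -/
def IsE (a : ℕ → ℂ) : Prop :=
  (∀ n, IsAlgebraic ℚ (a n)) ∧
  (∃ (m : ℕ) (p : ℕ → Polynomial ℂ),
      (∀ i k, IsAlgebraic ℚ ((p i).coeff k)) ∧ (∃ i, i ≤ m ∧ p i ≠ 0) ∧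
      ∑ i ∈ Finset.range (m + 1), polyPS (p i) * psD^[i] (ePS a) = 0) ∧
  (∃ C : ℝ, 0 < C ∧ ∃ d : ℕ → ℕ, ∀ n : ℕ, 1 ≤ n →
      1 ≤ d n ∧ (d n : ℝ) ≤ C ^ n ∧
      (∀ σ : (integralClosure ℚ ℂ) →+* ℂ, ∀ h : a n ∈ integralClosure ℚ ℂ,
        ‖σ ⟨a n, h⟩‖ ≤ C ^ n) ∧
      (∀ i, 1 ≤ i → i ≤ n → IsIntegral ℤ ((d n : ℂ) * a i)))

/-- The value at `α` of the E-function with coefficient sequence `a`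
(E-functions are entire, so this series converges for all `α`). -/
def evalE (a : ℕ → ℂ) (α : ℂ) : ℂ := ∑' n : ℕ, a n / (n.factorial : ℂ) * α ^ n

/-- `IsM q f` : the formal power series `f` is an M_q-function, i.e. it has algebraic
coefficients and satisfies a linear `σ_q`-difference equation over `ℚ̄[z]` with
not-all-zero polynomial coefficients. -/
def IsM (q : ℕ) (f : PowerSeries ℂ) : Prop :=
  (∀ n, IsAlgebraic ℚ (PowerSeries.coeff n f)) ∧
  ∃ (m : ℕ) (p : ℕ → Polynomial ℂ),
    (∀ i k, IsAlgebraic ℚ ((p i).coeff k)) ∧ (∃ i, i ≤ m ∧ p i ≠ 0) ∧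
    ∑ i ∈ Finset.range (m + 1), polyPS (p i) * (psSigma q)^[i] f = 0

/-- `MahlerValue f α v` : the meromorphic extension of (the sum of) the power series `f`
to the open unit disk has no pole at `α` and takes the value `v` there. -/
def MahlerValue (f : PowerSeries ℂ) (α v : ℂ) : Prop :=
  ∃ F : ℂ → ℂ, MeromorphicOn F (Metric.ball (0 : ℂ) 1) ∧
    (∀ᶠ z in nhds (0 : ℂ), HasSum (fun n => PowerSeries.coeff n f * z ^ n) (F z)) ∧
    AnalyticAt ℂ F α ∧ F α = v

/-- The power series `f` converges (hence defines an analytic function) on the open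
disk `D(0,R)`. -/
def AnOnBall (f : PowerSeries ℂ) (R : ℝ) : Prop :=
  ∀ z : ℂ, ‖z‖ < R → Summable fun n => PowerSeries.coeff n f * z ^ n

/-- The value at `z` of (the sum of) the power series `f`. -/
def psEval (f : PowerSeries ℂ) (z : ℂ) : ℂ := ∑' n : ℕ, PowerSeries.coeff n f * z ^ n

/-- `Banal fv α P` : the homogeneous algebraic relation `P` among the values at `α` of the
power series `fv 1, …, fv r` is banal: it is the specialization at `z = α` of some
`Q ∈ ℚ̄[z, X₁, …, X_r]`, homogeneous in `X₁, …, X_r`, with `Q(z, fv 1, …, fv r) = 0`. -/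
def Banal {r : ℕ} (fv : Fin r → PowerSeries ℂ) (α : ℂ) (P : MvPolynomial (Fin r) ℂ) : Prop :=
  ∃ Q : MvPolynomial (Fin r) (Polynomial ℂ),
    (∀ v k, IsAlgebraic ℚ ((MvPolynomial.coeff v Q).coeff k)) ∧
    (∃ e, Q.IsHomogeneous e) ∧
    MvPolynomial.eval₂ polyPS fv Q = 0 ∧
    MvPolynomial.map (Polynomial.evalRingHom α) Q = P

/-- `Eset S` : the set of values at `z = 1` of all E-functions with coefficients in `S`. -/
def Eset (S : Set ℂ) : Set ℂ :=
  {x | ∃ a : ℕ → ℂ, IsE a ∧ (∀ n, a n ∈ S) ∧ x = evalE a 1}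

/-- `Mset q α S` : the set of values at `α` of all M_q-functions with coefficients in `S`
having no pole at `α`. -/
def Mset (q : ℕ) (α : ℂ) (S : Set ℂ) : Set ℂ :=
  {x | ∃ f : PowerSeries ℂ, IsM q f ∧ (∀ n, PowerSeries.coeff n f ∈ S) ∧ MahlerValue f α x}

open scoped Pointwise

/-- An algebra over `k[X]` which is a field of characteristic zero and faithful over `k[X]`
is formally smooth over `k[X]`. -/
theorem formallySmooth_polynomial_of_faithful {k C : Type*} [Field k] [Field C] [CharZero C]
    [Algebra (Polynomial k) C] [FaithfulSMul (Polynomial k) C] :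
    Algebra.FormallySmooth (Polynomial k) C := by
  let F := FractionRing (Polynomial k)
  let _ : Algebra F C := FractionRing.liftAlgebra (Polynomial k) C
  have : IsScalarTower (Polynomial k) F C := FractionRing.isScalarTower_liftAlgebra _ _
  have : CharZero F := by
    refine ⟨fun a b h => ?_⟩
    have := congrArg (algebraMap F C) h
    rwa [map_natCast, map_natCast, Nat.cast_inj] at this
  obtain ⟨s, hs⟩ := exists_isTranscendenceBasis F C
  have : Algebra.IsAlgebraic (IntermediateField.adjoin F (Set.range ((↑) : s → C))) C :=
    hs.isAlgebraic_field
  have h1 : Algebra.FormallySmooth F C :=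
    Algebra.FormallySmooth.of_algebraicIndependent_of_isSeparable hs.1
  have h2 : Algebra.FormallySmooth (Polynomial k) F :=
    .of_isLocalization (nonZeroDivisors (Polynomial k))
  exact .comp _ F _

/-- In characteristic zero, an element transcendental over a subfield is detected by a
derivation. -/
theorem exists_derivation_ne_zero {k C : Type*} [Field k] [Field C] [CharZero C] [Algebra k C]
    {t : C} (ht : Transcendental k t) : ∃ D : Derivation k C C, D t ≠ 0 := by
  let _ : Algebra (Polynomial k) C := (Polynomial.aeval t).toRingHom.toAlgebra
  have hmap : ∀ p : Polynomial k, algebraMap (Polynomial k) C p = Polynomial.aeval t p :=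
    fun _ => rfl
  have : IsScalarTower k (Polynomial k) C := IsScalarTower.of_algebraMap_eq fun x => by
    rw [hmap]; simp
  have : FaithfulSMul (Polynomial k) C := (faithfulSMul_iff_algebraMap_injective _ _).2
    (transcendental_iff_injective.1 ht)
  have := formallySmooth_polynomial_of_faithful (k := k) (C := C)
  have hsub : Subsingleton (Algebra.H1Cotangent (Polynomial k) C) :=
    Algebra.FormallySmooth.subsingleton_h1Cotangent
  have hex := Algebra.H1Cotangent.exact_δ_mapBaseChange k (Polynomial k) C
  have hinj : Function.Injective (KaehlerDifferential.mapBaseChange k (Polynomial k) C) := by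
    rw [injective_iff_map_eq_zero]
    intro x hx
    obtain ⟨y, rfl⟩ := (hex x).1 hx
    rw [Subsingleton.elim y 0, map_zero]
  have hne : KaehlerDifferential.D k C t ≠ 0 := by
    intro h0
    have h1 : KaehlerDifferential.mapBaseChange k (Polynomial k) C
        (1 ⊗ₜ KaehlerDifferential.D k (Polynomial k) Polynomial.X) = 0 := by
      rw [KaehlerDifferential.mapBaseChange_tmul, KaehlerDifferential.map_D, hmap]
      simp [h0]
    have h2 := hinj (h1.trans (map_zero _).symm)
    have h3 := congrArg (TensorProduct.rid (Polynomial k) C)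
      (congrArg (LinearMap.lTensor C
        (KaehlerDifferential.polynomialEquiv k).toLinearMap) h2)
    simp at h3
  obtain ⟨φ, hφ⟩ := Module.Projective.exists_dual_ne_zero C hne
  exact ⟨φ.compDer (KaehlerDifferential.D k C), hφ⟩

/-- The exponential `c ↦ ∑ Dⁱ(c)/i! εⁱ` of a derivation, as a power series. -/
noncomputable def derivExpFun {k C : Type*} [Field k] [Field C] [Algebra k C]
    (D : Derivation k C C) (c : C) : PowerSeries C :=
  PowerSeries.mk fun i => (D^[i] c) / (i.factorial : C)

section DerivExp

variable {k C : Type*} [Field k] [Field C] [Algebra k C] (D : Derivation k C C)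

theorem derivExpFun_add (a b : C) : derivExpFun D (a + b) = derivExpFun D a + derivExpFun D b := by
  ext i
  simp [derivExpFun, iterate_map_add, add_div]

variable [CharZero C]

theorem succ_mul_coeff_derivExpFun (c : C) (i : ℕ) :
    PowerSeries.coeff (i + 1) (derivExpFun D c) * ((i : C) + 1)
      = PowerSeries.coeff i (derivExpFun D (D c)) := by
  have h1 : ((i : C) + 1) ≠ 0 := by exact_mod_cast Nat.succ_ne_zero i
  have h2 : ((i.factorial : ℕ) : C) ≠ 0 := by exact_mod_cast i.factorial_ne_zero
  simp only [derivExpFun, PowerSeries.coeff_mk, Function.iterate_succ, Function.comp_apply,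
    Nat.factorial_succ, Nat.cast_mul, Nat.cast_succ]
  field_simp

theorem derivExpFun_mul (a b : C) : derivExpFun D (a * b) = derivExpFun D a * derivExpFun D b := by
  ext n
  induction n generalizing a b with
  | zero => simp [derivExpFun]
  | succ n ih =>
    have h1 : ((n : C) + 1) ≠ 0 := by exact_mod_cast Nat.succ_ne_zero n
    apply mul_right_cancel₀ h1
    have key : ∀ c, PowerSeries.derivative C (derivExpFun D c) = derivExpFun D (D c) := by
      intro c
      ext i
      rw [PowerSeries.coeff_derivative, succ_mul_coeff_derivExpFun]
    rw [succ_mul_coeff_derivExpFun, ← PowerSeries.coeff_derivative, Derivation.leibniz,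
      Derivation.leibniz, key, key, derivExpFun_add, map_add, smul_eq_mul, smul_eq_mul, ih, ih,
      smul_eq_mul, smul_eq_mul, map_add]

/-- The exponential of a derivation as a ring homomorphism. -/
noncomputable def derivExp : C →+* PowerSeries C where
  toFun := derivExpFun D
  map_one' := by
    ext i
    rcases i with _ | i
    · simp [derivExpFun]
    · have : D^[i + 1] (1 : C) = 0 := by
        rw [Function.iterate_succ_apply, Derivation.map_one_eq_zero, iterate_map_zero]
      simp [derivExpFun, PowerSeries.coeff_one, this]
  map_mul' := derivExpFun_mul D
  map_zero' := by
    ext i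
    simp [derivExpFun, iterate_map_zero]
  map_add' := derivExpFun_add D

theorem derivExp_algebraMap (a : k) :
    derivExp D (algebraMap k C a) = PowerSeries.C (algebraMap k C a) := by
  ext i
  rcases i with _ | i
  · simp [derivExp, derivExpFun]
  · have : D^[i + 1] (algebraMap k C a) = 0 := by
      rw [Function.iterate_succ_apply, Derivation.map_algebraMap, iterate_map_zero]
    simp [derivExp, derivExpFun, this]

theorem coeff_zero_derivExp (c : C) : PowerSeries.coeff 0 (derivExp D c) = c := by
  simp [derivExp, derivExpFun]

theorem coeff_one_derivExp (c : C) : PowerSeries.coeff 1 (derivExp D c) = D c := by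
  simp [derivExp, derivExpFun]

end DerivExp

/-- The dimension of the powers of a subspace `U` of a domain containing a nonzero element killed
by `π` dominates the partial sums of the dimensions of the powers of `π U`. -/
theorem sum_finrank_map_pow_le {C R Ω : Type*} [Field C] [CommRing R] [IsDomain R] [Algebra C R]
    [CommRing Ω] [Nontrivial Ω] [Algebra C Ω] (π : R →ₐ[C] Ω) (U : Submodule C R) (hU : U.FG)
    {x : R} (hxU : x ∈ U) (hx0 : x ≠ 0) (hπ : π x = 0) (d : ℕ) :
    ∑ i ∈ Finset.range (d + 1), Module.finrank C ↥((U.map π.toLinearMap) ^ i)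
      ≤ Module.finrank C ↥(U ^ d) := by
  induction d with
  | zero =>
    rw [zero_add, Finset.range_one, Finset.sum_singleton, pow_zero, pow_zero]
    have : (1 : Submodule C Ω) = (1 : Submodule C R).map π.toLinearMap :=
      (Submodule.map_one π).symm
    rw [this]
    have : Module.Finite C ↥(1 : Submodule C R) :=
      Module.Finite.iff_fg.2 (by simpa using hU.pow 0)
    exact Submodule.finrank_map_le _ _
  | succ d ih =>
    rw [Finset.sum_range_succ]
    have : Module.Finite C ↥(U ^ (d + 1)) := Module.Finite.iff_fg.2 (hU.pow _)
    let g : ↥(U ^ (d + 1)) →ₗ[C] Ω := π.toLinearMap.comp (U ^ (d + 1)).subtype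
    have hr : LinearMap.range g = (U.map π.toLinearMap) ^ (d + 1) := by
      rw [← Submodule.map_pow, LinearMap.range_comp, Submodule.range_subtype]
    have hk : Module.finrank C ↥(U ^ d) ≤ Module.finrank C ↥(LinearMap.ker g) := by
      have hmem : ∀ u ∈ U ^ d, x * u ∈ U ^ (d + 1) := fun u hu => by
        rw [pow_succ']; exact Submodule.mul_mem_mul hxU hu
      let m : ↥(U ^ d) →ₗ[C] ↥(U ^ (d + 1)) :=
        ((LinearMap.mulLeft C x).comp (U ^ d).subtype).codRestrict _ fun u => hmem u u.2
      have hm : ∀ u, m u ∈ LinearMap.ker g := fun u => by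
        change π (x * u) = 0
        rw [map_mul, hπ, zero_mul]
      refine LinearMap.finrank_le_finrank_of_injective (f := m.codRestrict _ hm) ?_
      intro a b hab
      have : x * (a : R) = x * b :=
        congrArg (fun z => ((z : ↥(U ^ (d + 1))) : R)) (congrArg Subtype.val hab)
      exact Subtype.ext (mul_left_cancel₀ hx0 this)
    have := g.finrank_range_add_finrank_ker
    rw [hr] at this
    omega

/-- Extending scalars along a `k`-linear map does not increase the dimension of a span. -/
theorem finrank_span_image_le {k C Ω R : Type*} [Field k] [Field C] [Algebra k C] [AddCommGroup Ω]
    [Module k Ω] [AddCommGroup R] [Module C R] [Module k R] [IsScalarTower k C R]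
    (φ : Ω →ₗ[k] R) {M : Set Ω} (hM : M.Finite) :
    Module.finrank C ↥(Submodule.span C (φ '' M)) ≤ Module.finrank k ↥(Submodule.span k M) := by
  obtain ⟨b, hbM, hspan, hli⟩ := exists_linearIndependent k M
  have hbf : b.Finite := hM.subset hbM
  have : Fintype b := hbf.fintype
  rw [← hspan, finrank_span_set_eq_card hli]
  have hle : Submodule.span C (φ '' M) ≤ Submodule.span C (φ '' b) := by
    rw [Submodule.span_le]
    rintro _ ⟨x, hx, rfl⟩
    have hx' : x ∈ Submodule.span k b := hspan ▸ Submodule.subset_span hx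
    have : φ x ∈ Submodule.span k (φ '' b) := by
      rw [← Submodule.map_span]; exact Submodule.mem_map_of_mem hx'
    exact Submodule.span_le_restrictScalars k C (φ '' b) this
  have hfin : (φ '' b).Finite := hbf.image _
  have : Module.Finite C ↥(Submodule.span C (φ '' b)) :=
    FiniteDimensional.span_of_finite C hfin
  refine (Submodule.finrank_mono hle).trans ?_
  have : Fintype ↥(φ '' b) := hfin.fintype
  refine (finrank_span_le_card (R := C) (φ '' b)).trans ?_
  rw [Set.toFinset_card, Set.toFinset_card]
  exact Fintype.card_le_of_surjective (fun x : b => (⟨φ x, x, x.2, rfl⟩ : ↥(φ '' b)))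
    (by rintro ⟨_, x, hx, rfl⟩; exact ⟨⟨x, hx⟩, rfl⟩)

theorem finite_set_pow {M : Type*} [Monoid M] {s : Set M} (hs : s.Finite) (d : ℕ) :
    (s ^ d).Finite := by
  induction d with
  | zero => rw [pow_zero]; exact Set.finite_one
  | succ d ih => rw [pow_succ]; exact ih.mul hs

/-- A `d`-fold product of elements of a finite family is a monomial with exponents at most `d`. -/
theorem exists_exponents_of_mem_range_pow {Ω : Type*} [CommRing Ω] {n : ℕ} (y : Fin n → Ω) (d : ℕ)
    {z : Ω} (hz : z ∈ (Set.range y) ^ d) :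
    ∃ a : Fin n → ℕ, (∑ i, a i = d) ∧ z = ∏ i, y i ^ a i := by
  induction d generalizing z with
  | zero =>
    refine ⟨0, by simp, ?_⟩
    simpa using hz
  | succ d ih =>
    rw [pow_succ] at hz
    obtain ⟨u, hu, _, ⟨j, rfl⟩, rfl⟩ := Set.mem_mul.1 hz
    obtain ⟨a, ha, rfl⟩ := ih hu
    refine ⟨a + Pi.single j 1, ?_, ?_⟩
    · simp [Finset.sum_add_distrib, ha]
    · simp only [Pi.add_apply, pow_add, Finset.prod_mul_distrib]
      simp [Pi.single_apply, pow_ite]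

theorem finrank_span_range_pow_le {C Ω : Type*} [Field C] [CommRing Ω] [Algebra C Ω] {n : ℕ}
    (y : Fin n → Ω) (d : ℕ) :
    Module.finrank C ↥(Submodule.span C ((Set.range y) ^ d)) ≤ (d + 1) ^ n := by
  classical
  let F : Finset Ω := Finset.univ.image fun a : Fin n → Fin (d + 1) => ∏ i, y i ^ (a i : ℕ)
  have hsub : (Set.range y) ^ d ⊆ (F : Set Ω) := by
    intro z hz
    obtain ⟨a, ha, rfl⟩ := exists_exponents_of_mem_range_pow y d hz
    have hle : ∀ i, a i < d + 1 := fun i =>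
      Nat.lt_succ_of_le (ha ▸ Finset.single_le_sum (fun _ _ => Nat.zero_le _) (Finset.mem_univ i))
    simp only [F, Finset.coe_image, Set.mem_image]
    exact ⟨fun i => ⟨a i, hle i⟩, by simp, rfl⟩
  have : Module.Finite C ↥(Submodule.span C (F : Set Ω)) :=
    FiniteDimensional.span_finset C F
  refine (Submodule.finrank_mono (Submodule.span_mono hsub)).trans
    ((finrank_span_finset_le_card F).trans (Finset.card_image_le.trans ?_))
  simp

/-- A sequence whose partial sums are dominated by a multiple of the sequence grows faster than any
polynomial. -/
theorem not_polynomial_growth_of_sum_le {h : ℕ → ℕ} {N n : ℕ} (h0 : 1 ≤ h 0)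
    (hs : ∀ d, ∑ i ∈ Finset.range (d + 1), h i ≤ N * h d) (hp : ∀ d, h d ≤ (d + 1) ^ n) :
    False := by
  have hN : 0 < N := by
    by_contra hN
    have := hs 0
    simp only [not_lt, Nat.le_zero] at hN
    simp [hN] at this
    omega
  have hNr : (0 : ℝ) < N := by exact_mod_cast hN
  set r : ℝ := 1 + 1 / N with hr
  have hr1 : 1 < r := by rw [hr]; linarith [one_div_pos.2 hNr]
  have hexp : ∀ d, r ^ d ≤ ((∑ i ∈ Finset.range (d + 1), h i : ℕ) : ℝ) := by
    intro d
    induction d with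
    | zero => simpa using h0
    | succ d ih =>
      set s := ∑ i ∈ Finset.range (d + 1), h i with hsd
      have h1 : s + h (d + 1) ≤ N * h (d + 1) := by
        have := hs (d + 1)
        rwa [Finset.sum_range_succ] at this
      have h2 : ((s : ℝ) + h (d + 1)) ≤ N * h (d + 1) := by exact_mod_cast h1
      have h3 : (s : ℝ) / N ≤ h (d + 1) := by
        rw [div_le_iff₀ hNr]
        have : (0 : ℝ) ≤ h (d + 1) := Nat.cast_nonneg _
        linarith
      rw [Finset.sum_range_succ, ← hsd, Nat.cast_add, pow_succ]
      calc r ^ d * r ≤ s * r := by gcongr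
        _ = s + s / N := by rw [hr]; ring
        _ ≤ _ := by linarith
  have hbound : ∀ d : ℕ, r ^ d ≤ N * ((d : ℝ) + 1) ^ n := fun d => by
    refine (hexp d).trans ?_
    calc ((∑ i ∈ Finset.range (d + 1), h i : ℕ) : ℝ) ≤ ((N * h d : ℕ) : ℝ) := by
          exact_mod_cast hs d
      _ = N * (h d : ℝ) := by push_cast; ring
      _ ≤ N * ((d : ℝ) + 1) ^ n := by
          gcongr
          exact_mod_cast hp d
  have ht := (tendsto_pow_const_div_const_pow_of_one_lt n hr1).comp
    (Filter.tendsto_add_atTop_nat 1)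
  have hev := ht.eventually (gt_mem_nhds (show (0 : ℝ) < 1 / (N * r) by positivity))
  obtain ⟨d, hd⟩ := hev.exists
  simp only [Function.comp_apply, Nat.cast_add, Nat.cast_one] at hd
  have hrp : 0 < r ^ (d + 1) := by positivity
  rw [div_lt_div_iff₀ hrp (by positivity), one_mul] at hd
  have := hbound d
  have : r ^ d * r ≤ N * ((d : ℝ) + 1) ^ n * r := by gcongr
  rw [pow_succ] at hd
  nlinarith

/-- A derivation `D` of `C` yields a second `C`-algebra structure on `Ω⟦ε⟧`, whose relations among
constants differentiate to relations over `Ω`. -/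
theorem exists_deformation.{u} {k C : Type*} {Ω : Type u} [Field k] [Field C] [CharZero C] [Field Ω]
    [Algebra k C] [Algebra C Ω] [Algebra k Ω] [IsScalarTower k C Ω] (D : Derivation k C C) :
    ∃ (R : Type u) (_ : CommRing R) (_ : IsDomain R) (_ : Algebra C R) (π : R →+* Ω) (φ : Ω →+* R),
      (∀ c, π (algebraMap C R c) = algebraMap C Ω c) ∧
      (∀ a, φ (algebraMap k Ω a) = algebraMap C R (algebraMap k C a)) ∧ (∀ x, π (φ x) = x) ∧
      ∀ (n : ℕ) (y : Fin n → Ω) (l : Fin n → C), ∑ i, l i • φ (y i) = 0 →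
        ∑ i, D (l i) • y i = 0 := by
  let E : C →+* PowerSeries Ω := (PowerSeries.map (algebraMap C Ω)).comp (derivExp D)
  refine ⟨PowerSeries Ω, inferInstance, inferInstance, E.toAlgebra, PowerSeries.constantCoeff,
    PowerSeries.C, fun c => ?_, fun a => ?_, PowerSeries.constantCoeff_C, fun n y l h => ?_⟩
  · change PowerSeries.constantCoeff (E c) = _
    rw [← PowerSeries.coeff_zero_eq_constantCoeff_apply]
    simp only [E, RingHom.comp_apply, PowerSeries.coeff_map, coeff_zero_derivExp]
  · change _ = E (algebraMap k C a)
    simp only [E, RingHom.comp_apply, derivExp_algebraMap, PowerSeries.map_C]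
    rw [← IsScalarTower.algebraMap_apply k C Ω]
  · change ∑ i, E (l i) * PowerSeries.C (y i) = 0 at h
    have h1 := congrArg (PowerSeries.coeff 1) h
    simp only [map_sum, E, RingHom.comp_apply, PowerSeries.coeff_mul_C, PowerSeries.coeff_map,
      coeff_one_derivExp, map_zero] at h1
    simpa only [Algebra.smul_def] using h1

/-- Under a uniform comparison between the `k`-dimensions and the `C`-dimensions of the spaces of
monomials in `y`, the `C`-linear relations among the `y i` lift along any `k`-algebra section. -/
theorem sum_smul_section_eq_zero {k C Ω R : Type*} [Field k] [Field C] [Field Ω]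
    [Algebra k C] [Algebra C Ω] [Algebra k Ω] [IsScalarTower k C Ω] [CommRing R] [IsDomain R]
    [Algebra C R] [Algebra k R] [IsScalarTower k C R] (π : R →ₐ[C] Ω) (φ : Ω →ₐ[k] R)
    (hπφ : ∀ x, π (φ x) = x) {n : ℕ} (y : Fin n → Ω)
    (N : ℕ) (hN : ∀ d, Module.finrank k ↥(Submodule.span k ((Set.range y) ^ d))
      ≤ N * Module.finrank C ↥(Submodule.span C ((Set.range y) ^ d)))
    (l : Fin n → C) (hl : ∑ i, l i • y i = 0) : ∑ i, l i • φ (y i) = 0 := by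
  by_contra hx0
  let U : Submodule C R := Submodule.span C (φ '' Set.range y)
  have hfin : Set.Finite (Set.range y) := Set.finite_range y
  have hUfg : U.FG := Submodule.fg_span (hfin.image _)
  have hxU : ∑ i, l i • φ (y i) ∈ U := Submodule.sum_mem _ fun i _ => Submodule.smul_mem _ _
    (Submodule.subset_span (Set.mem_image_of_mem φ (Set.mem_range_self i)))
  have hπx : π (∑ i, l i • φ (y i)) = 0 := by
    simpa only [map_sum, map_smul, hπφ] using hl
  have hmap : U.map π.toLinearMap = Submodule.span C (Set.range y) := by
    rw [Submodule.map_span, Set.image_image]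
    congr 1
    have : (fun x => π.toLinearMap (φ x)) = id := funext hπφ
    rw [this, Set.image_id]
  refine not_polynomial_growth_of_sum_le
    (h := fun d => Module.finrank C ↥(Submodule.span C ((Set.range y) ^ d))) (N := N) (n := n)
    ?_ (fun d => ?_) (finrank_span_range_pow_le y)
  · rw [pow_zero]
    change 1 ≤ Module.finrank C ↥(Submodule.span C ({1} : Set Ω))
    rw [finrank_span_singleton one_ne_zero]
  · refine le_trans ?_ (hN d)
    have h1 := sum_finrank_map_pow_le π U hUfg hxU hx0 hπx d
    rw [hmap] at h1
    have h3 : ∀ i, Module.finrank C ↥(Submodule.span C (Set.range y) ^ i)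
        = Module.finrank C ↥(Submodule.span C ((Set.range y) ^ i)) := fun i => by
      rw [Submodule.span_pow]
    simp only [h3] at h1
    refine h1.trans ?_
    have h2 : U ^ d = Submodule.span C (φ.toLinearMap '' ((Set.range y) ^ d)) := by
      have : φ.toLinearMap '' ((Set.range y) ^ d) = (φ '' Set.range y) ^ d :=
        Set.image_pow φ (Set.range y) d
      rw [this, ← Submodule.span_pow]
    rw [h2]
    exact finrank_span_image_le φ.toLinearMap (finite_set_pow hfin d)

/-- Under a uniform comparison between the `k`-dimensions and the `C`-dimensions of the spaces of
monomials in `y`, the space of `C`-linear relations among the `y i` is stable under every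
`k`-derivation of `C`. -/
theorem sum_derivation_smul_eq_zero {k C Ω : Type*} [Field k] [Field C] [CharZero C] [Field Ω]
    [Algebra k C] [Algebra C Ω] [Algebra k Ω] [IsScalarTower k C Ω] {n : ℕ} (y : Fin n → Ω)
    (N : ℕ) (hN : ∀ d, Module.finrank k ↥(Submodule.span k ((Set.range y) ^ d))
      ≤ N * Module.finrank C ↥(Submodule.span C ((Set.range y) ^ d)))
    (D : Derivation k C C) (l : Fin n → C) (hl : ∑ i, l i • y i = 0) :
    ∑ i, D (l i) • y i = 0 := by
  obtain ⟨R, _, _, _, π, φ, hπ, hφ, hπφ, hD⟩ := exists_deformation (Ω := Ω) D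
  let _ : Algebra k R := ((algebraMap C R).comp (algebraMap k C)).toAlgebra
  have : IsScalarTower k C R := IsScalarTower.of_algebraMap_eq fun _ => rfl
  exact hD n y l (sum_smul_section_eq_zero { π with commutes' := hπ } { φ with commutes' := hφ }
    hπφ y N hN l hl)

/-- A proper subspace of `Cⁿ` stable under all `k`-derivations of `C` is annihilated by a nonzero
vector with coordinates algebraic over `k`. -/
theorem exists_algebraic_annihilator {k C : Type*} [Field k] [Field C] [CharZero C] [Algebra k C]
    {n : ℕ} (J : Submodule C (Fin n → C)) (hJ : J ≠ ⊤)
    (hD : ∀ D : Derivation k C C, ∀ l ∈ J, (fun i => D (l i)) ∈ J) :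
    ∃ w : Fin n → C, w ≠ 0 ∧ (∀ i, IsAlgebraic k (w i)) ∧ ∀ l ∈ J, ∑ i, l i * w i = 0 := by
  classical
  let P : (Fin n → C) → Prop := fun w => w ≠ 0 ∧ ∀ l ∈ J, ∑ i, l i * w i = 0
  have hex : ∃ w, P w := by
    obtain ⟨φ, hφ, hle⟩ := Submodule.exists_le_ker_of_lt_top J (lt_top_iff_ne_top.2 hJ)
    have hφs : ∀ l : Fin n → C, φ l = ∑ i, l i * φ (Pi.single i 1) := fun l => by
      conv_lhs => rw [← Finset.univ_sum_single l, map_sum]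
      refine Finset.sum_congr rfl fun i _ => ?_
      rw [← smul_eq_mul, ← map_smul, ← Pi.single_smul, smul_eq_mul, mul_one]
    refine ⟨fun i => φ (Pi.single i 1), fun h0 => hφ ?_, fun l hl => ?_⟩
    · ext l
      simpa using congrFun h0 l
    · rw [← hφs]; exact hle hl
  let supp : (Fin n → C) → ℕ := fun w => (Finset.univ.filter fun i => w i ≠ 0).card
  obtain ⟨m, ⟨w, hw, hwm⟩, hmin⟩ : ∃ m, (∃ w, P w ∧ supp w = m) ∧
      ∀ m' < m, ¬ ∃ w, P w ∧ supp w = m' := by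
    have h : ∃ m, ∃ w, P w ∧ supp w = m := ⟨_, hex.choose, hex.choose_spec, rfl⟩
    exact ⟨Nat.find h, Nat.find_spec h, fun m' hm' => Nat.find_min h hm'⟩
  obtain ⟨i0, hi0⟩ : ∃ i, w i ≠ 0 := Function.ne_iff.1 hw.1
  have hann : ∀ l ∈ J, ∑ i, l i * (w i / w i0) = 0 := fun l hl => by
    have := hw.2 l hl
    simp only [← mul_div_assoc, ← Finset.sum_div, this, zero_div]
  refine ⟨fun i => w i / w i0, fun h0 => ?_, fun i => ?_, hann⟩
  · have := congrFun h0 i0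
    simp [hi0] at this
  · by_contra htr
    obtain ⟨D, hDi⟩ := exists_derivation_ne_zero htr
    have hP : P fun j => D (w j / w i0) := by
      refine ⟨fun h0 => hDi (congrFun h0 i), fun l hl => ?_⟩
      have h1 := congrArg D (hann l hl)
      simp only [map_sum, Derivation.leibniz, smul_eq_mul, map_zero,
        Finset.sum_add_distrib] at h1
      have h2 := hann _ (hD D l hl)
      simp only [mul_comm (D (l _)) _] at h2
      rw [h2, add_zero] at h1
      exact h1
    refine hmin (supp fun j => D (w j / w i0)) ?_ ⟨_, hP, rfl⟩
    rw [← hwm]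
    refine Finset.card_lt_card ⟨fun j hj => ?_, fun hsub => ?_⟩
    · simp only [Finset.mem_filter, Finset.mem_univ, true_and] at hj ⊢
      intro h0
      apply hj
      simp [h0]
    · have : i0 ∈ Finset.univ.filter fun j => D (w j / w i0) ≠ 0 :=
        hsub (by simp [hi0])
      simp [div_self hi0] at this

/-- If the `k`-dimensions of the spaces of monomials in a nonzero vector `y` are uniformly bounded
by a multiple of their `C`-dimensions, then every `C`-linear relation `f` of `y` satisfies a
nontrivial linear relation with coefficients algebraic over `k`. -/
theorem exists_algebraic_relation_of_finrank_le {k C Ω : Type*} [Field k] [Field C] [CharZero C]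
    [Field Ω] [Algebra k C] [Algebra C Ω] [Algebra k Ω] [IsScalarTower k C Ω] {n : ℕ}
    (y : Fin n → Ω) (hy : y ≠ 0)
    (N : ℕ) (hN : ∀ d, Module.finrank k ↥(Submodule.span k ((Set.range y) ^ d))
      ≤ N * Module.finrank C ↥(Submodule.span C ((Set.range y) ^ d)))
    (f : Fin n → C) (hf : ∑ i, f i • y i = 0) :
    ∃ w : Fin n → C, w ≠ 0 ∧ (∀ i, IsAlgebraic k (w i)) ∧ ∑ i, f i * w i = 0 := by
  classical
  let J : Submodule C (Fin n → C) := LinearMap.ker (Fintype.linearCombination C y)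
  have hJmem : ∀ l, l ∈ J ↔ ∑ i, l i • y i = 0 := fun l => by
    rw [LinearMap.mem_ker, Fintype.linearCombination_apply]
  have hJ : J ≠ ⊤ := by
    intro htop
    apply hy
    funext i
    have : Pi.single i (1 : C) ∈ J := htop ▸ Submodule.mem_top
    rw [hJmem] at this
    simpa [Pi.single_apply, ite_smul] using this
  obtain ⟨w, hw0, hwa, hw⟩ := exists_algebraic_annihilator (k := k) J hJ fun D l hl =>
    (hJmem _).2 (sum_derivation_smul_eq_zero y N hN D l ((hJmem l).1 hl))
  exact ⟨w, hw0, hwa, hw f ((hJmem f).2 hf)⟩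

theorem exists_intermediateField_stable {κ 𝓛 : Type*} [Field κ] [Field 𝓛] [Algebra κ 𝓛] {n : ℕ}
    (f : Fin n → 𝓛) (Γ : Set (𝓛 ≃+* 𝓛))
    (hκ : ∀ τ ∈ Γ, ∃ φ : κ ≃+* κ, ∀ a, τ (algebraMap κ 𝓛 a) = algebraMap κ 𝓛 (φ a))
    (hf : ∀ τ ∈ Γ, ∀ i, τ (f i) ∈ Submodule.span κ (Set.range f)) :
    ∃ L : IntermediateField κ 𝓛, FiniteDimensional κ L ∧ (∀ τ ∈ Γ, ∀ x ∈ L, τ x ∈ L) ∧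
      (L = ⊥ → LinearIndependent κ f →
        ∀ w : Fin n → 𝓛, (∀ i, IsAlgebraic κ (w i)) → ∑ i, w i * f i = 0 → w = 0) := by
  obtain ⟨ι, a, ha, hspan, hli⟩ := exists_linearIndependent' (algebraicClosure κ 𝓛) f
  have : Fintype ι := Fintype.ofInjective a ha
  classical
  rw [Fintype.linearIndependent_iff] at hli
  have hli' : ∀ g : ι → 𝓛, (∀ x, IsAlgebraic κ (g x)) → ∑ x, g x * f (a x) = 0 → ∀ x, g x = 0 := by
    intro g hg h0 x
    have := hli (fun x => ⟨g x, mem_algebraicClosure_iff.2 (hg x)⟩) h0 x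
    simpa using congrArg Subtype.val this
  have he : ∀ j, ∃ e : ι → 𝓛, (∀ x, IsAlgebraic κ (e x)) ∧ ∑ x, e x * f (a x) = f j := by
    intro j
    have : f j ∈ Submodule.span (algebraicClosure κ 𝓛) (Set.range (f ∘ a)) := by
      rw [hspan]; exact Submodule.subset_span ⟨j, rfl⟩
    obtain ⟨c, hc⟩ := (Submodule.mem_span_range_iff_exists_fun _).1 this
    exact ⟨fun x => c x, fun x => mem_algebraicClosure_iff.1 (c x).2, hc⟩
  choose e healg he using he
  let S : Set 𝓛 := Set.range fun p : Fin n × ι => e p.1 p.2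
  have hSL : ∀ j x, e j x ∈ IntermediateField.adjoin κ S := fun j x =>
    IntermediateField.subset_adjoin κ S ⟨(j, x), rfl⟩
  have hfin : FiniteDimensional κ (IntermediateField.adjoin κ S) := by
    have : Finite S := Set.finite_range _
    refine IntermediateField.finiteDimensional_adjoin ?_
    rintro _ ⟨p, rfl⟩
    exact (healg _ _).isIntegral
  have halgL : ∀ x ∈ IntermediateField.adjoin κ S, IsAlgebraic κ x := fun x hx =>
    IsAlgebraic.algebraMap (A := 𝓛)
      (Algebra.IsAlgebraic.isAlgebraic (R := κ) (⟨x, hx⟩ : IntermediateField.adjoin κ S))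
  refine ⟨IntermediateField.adjoin κ S, hfin, ?_, ?_⟩
  · intro τ hτ
    obtain ⟨φ, hφ⟩ := hκ τ hτ
    have hexp : ∀ j, ∃ D : ι → IntermediateField.adjoin κ S,
        τ (f j) = ∑ y, (D y : 𝓛) * f (a y) := by
      intro j
      obtain ⟨c, hc⟩ := (Submodule.mem_span_range_iff_exists_fun _).1 (hf τ hτ j)
      refine ⟨fun y => ∑ i, c i • ⟨e i y, hSL i y⟩, ?_⟩
      rw [← hc]
      simp only [AddSubmonoidClass.coe_finsetSum, IntermediateField.coe_smul, Finset.sum_mul]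
      rw [Finset.sum_comm]
      refine Finset.sum_congr rfl fun i _ => ?_
      simp [← he i, Finset.smul_sum]
    choose D hD using hexp
    have hτalg : ∀ x, IsAlgebraic κ x → IsAlgebraic κ (τ x) := fun x hx =>
      hx.ringHom_of_comp_eq (φ : κ →+* κ) (τ : 𝓛 →+* 𝓛) φ.injective
        (RingHom.ext fun z => (hφ z).symm)
    have hτalg' : ∀ x, IsAlgebraic κ x → IsAlgebraic κ (τ.symm x) := fun x hx =>
      hx.ringHom_of_comp_eq (φ.symm : κ →+* κ) (τ.symm : 𝓛 →+* 𝓛) φ.symm.injective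
        (RingHom.ext fun z => τ.injective (by simp [hφ]))
    let A : Matrix ι ι (IntermediateField.adjoin κ S) := fun x y => D (a x) y
    have hA : IsUnit A := by
      rw [← Matrix.linearIndependent_rows_iff_isUnit, Fintype.linearIndependent_iff]
      intro g hg
      have h0 : ∑ x, (g x : 𝓛) * τ (f (a x)) = 0 := by
        simp only [hD, Finset.mul_sum]
        rw [Finset.sum_comm]
        refine Finset.sum_eq_zero fun y _ => ?_
        have := congrArg Subtype.val (congrFun hg y)
        simp only [Finset.sum_apply, Pi.smul_apply, AddSubmonoidClass.coe_finsetSum] at this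
        simp only [← mul_assoc, ← Finset.sum_mul]
        rw [show ∑ x, (g x : 𝓛) * (D (a x) y : 𝓛) = 0 from this, zero_mul]
      have h1 := hli' (fun x => τ.symm (g x)) (fun x => hτalg' _ (halgL _ (g x).2)) (by
        apply τ.injective
        simpa using h0)
      intro x
      simpa using h1 x
    obtain ⟨B, hB⟩ := hA.exists_right_inv
    have key : ∀ j x, τ (e j x) ∈ IntermediateField.adjoin κ S := by
      intro j
      have h1 : ∀ y, ∑ x, τ (e j x) * (A x y : 𝓛) - D j y = 0 := by
        refine hli' _ (fun y => (?_ : IsAlgebraic κ _).sub (halgL _ (D j y).2)) ?_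
        · exact mem_algebraicClosure_iff.1 (sum_mem fun x _ => mem_algebraicClosure_iff.2
            ((hτalg _ (healg j x)).mul (halgL _ (A x y).2)))
        · simp only [sub_mul, Finset.sum_sub_distrib, ← hD, Finset.sum_mul]
          rw [Finset.sum_comm, sub_eq_zero]
          conv_rhs => rw [← he j, map_sum]
          refine Finset.sum_congr rfl fun x _ => ?_
          rw [map_mul, hD, Finset.mul_sum]
          exact Finset.sum_congr rfl fun y _ => mul_assoc _ _ _
      intro x
      have : τ (e j x) = ∑ y, (D j y : 𝓛) * (B y x : 𝓛) := by
        have hB' : ∀ x' , ∑ y, (A x' y : 𝓛) * (B y x : 𝓛) = if x' = x then 1 else 0 := by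
          intro x'
          have := congrArg Subtype.val (congrFun (congrFun hB x') x)
          simp only [Matrix.mul_apply, Matrix.one_apply, AddSubmonoidClass.coe_finsetSum] at this
          rw [show ∑ y, (A x' y : 𝓛) * (B y x : 𝓛) = _ from this]
          split_ifs <;> rfl
        simp only [← sub_eq_zero.1 (h1 _), Finset.sum_mul]
        rw [Finset.sum_comm]
        simp [mul_assoc, ← Finset.mul_sum, hB']
      rw [this]
      exact sum_mem fun y _ => mul_mem (D j y).2 (B y x).2
    intro x hx
    induction hx using IntermediateField.adjoin_induction with
    | mem x hx => obtain ⟨p, rfl⟩ := hx; exact key _ _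
    | algebraMap x => rw [hφ]; exact IntermediateField.algebraMap_mem _ _
    | add x y _ _ hx hy => rw [map_add]; exact add_mem hx hy
    | inv x _ hx => rw [map_inv₀]; exact inv_mem hx
    | mul x y _ _ hx hy => rw [map_mul]; exact mul_mem hx hy
  · intro hL hfli w hw h0
    have hsurj : Function.Surjective a := by
      intro j
      by_contra hj
      have h1 : f j ∈ Submodule.span κ (f '' (Set.range a)) := by
        rw [← he j]
        refine sum_mem fun x _ => ?_
        have : e j x ∈ (⊥ : IntermediateField κ 𝓛) := hL ▸ hSL j x
        obtain ⟨c, hc⟩ := IntermediateField.mem_bot.1 this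
        rw [← hc, ← Algebra.smul_def]
        exact Submodule.smul_mem _ _ (Submodule.subset_span ⟨_, ⟨x, rfl⟩, rfl⟩)
      exact hfli.notMem_span_image hj h1
    have h2 := hli' (fun x => w (a x)) (fun x => hw _) (by
      rw [← h0]
      exact Fintype.sum_bijective a ⟨ha, hsurj⟩ _ _ fun x => rfl)
    funext j
    obtain ⟨x, rfl⟩ := hsurj j
    exact h2 x

open scoped Classical in
/-- The subring of rational functions that are regular at infinity. -/
abbrev ratInftyIntegers : Subring (RatFunc ℂ) := (RatFunc.inftyValuation ℂ).integer

/-- The automorphism `f(z) ↦ f(ζ z)` of the ring of power series. -/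
def psRescale (ζ : ℂˣ) : PowerSeries ℂ ≃+* PowerSeries ℂ :=
  RingEquiv.ofRingHom (PowerSeries.rescale (ζ : ℂ)) (PowerSeries.rescale ((ζ⁻¹ : ℂˣ) : ℂ))
    (by ext; simp) (by ext; simp)

/-- The automorphism `p(z) ↦ p(ζ z)` of the polynomial ring. -/
def polyRescale (ζ : ℂˣ) : Polynomial ℂ ≃+* Polynomial ℂ :=
  RingEquiv.ofRingHom
    (Polynomial.compRingHom (Polynomial.C (ζ : ℂ) * Polynomial.X))
    (Polynomial.compRingHom (Polynomial.C ((ζ⁻¹ : ℂˣ) : ℂ) * Polynomial.X))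
    (by ext <;> simp [← mul_assoc, ← Polynomial.C_mul])
    (by ext <;> simp [← mul_assoc, ← Polynomial.C_mul])

theorem polyRescale_apply (ζ : ℂˣ) (p : Polynomial ℂ) :
    polyRescale ζ p = p.comp (Polynomial.C (ζ : ℂ) * Polynomial.X) := rfl

theorem psRescale_apply (ζ : ℂˣ) (u : PowerSeries ℂ) :
    psRescale ζ u = PowerSeries.rescale (ζ : ℂ) u := rfl

theorem natDegree_polyRescale (ζ : ℂˣ) (p : Polynomial ℂ) :
    (polyRescale ζ p).natDegree = p.natDegree := by
  rw [polyRescale_apply, Polynomial.natDegree_comp, Polynomial.natDegree_C_mul_X _ ζ.ne_zero,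
    mul_one]

theorem psRescale_coe (ζ : ℂˣ) (p : Polynomial ℂ) :
    psRescale ζ (p : PowerSeries ℂ) = (polyRescale ζ p : Polynomial ℂ) := by
  ext n
  rw [psRescale_apply, polyRescale_apply, PowerSeries.coeff_rescale, Polynomial.coeff_coe,
    Polynomial.coeff_coe, Polynomial.comp_C_mul_X_coeff, mul_comm]

/-- The automorphism `f(z) ↦ f(ζ z)` of the field of rational functions. -/
def ratRescale (ζ : ℂˣ) : RatFunc ℂ ≃+* RatFunc ℂ :=
  IsFractionRing.ringEquivOfRingEquiv (polyRescale ζ)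

theorem ratRescale_algebraMap (ζ : ℂˣ) (p : Polynomial ℂ) :
    ratRescale ζ (algebraMap _ _ p) = algebraMap _ _ (polyRescale ζ p) :=
  IsFractionRing.ringEquivOfRingEquiv_algebraMap _ _

open scoped Classical in
theorem inftyValuation_ratRescale (ζ : ℂˣ) (a : RatFunc ℂ) :
    RatFunc.inftyValuation ℂ (ratRescale ζ a) = RatFunc.inftyValuation ℂ a := by
  have hp : ∀ p : Polynomial ℂ, RatFunc.inftyValuation ℂ (ratRescale ζ (algebraMap _ _ p)) =
      RatFunc.inftyValuation ℂ (algebraMap _ _ p) := by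
    intro p
    rcases eq_or_ne p 0 with rfl | h
    · simp
    · rw [ratRescale_algebraMap, RatFunc.inftyValuation_apply, RatFunc.inftyValuation_apply,
        RatFunc.inftyValuation.polynomial _ h,
        RatFunc.inftyValuation.polynomial _ ((polyRescale ζ).map_ne_zero_iff.2 h),
        natDegree_polyRescale]
  obtain ⟨p, s, -, rfl⟩ := IsFractionRing.div_surjective (A := Polynomial ℂ) a
  rw [map_div₀, map_div₀, map_div₀, hp, hp]

open scoped Classical in
theorem exists_isIntegral_infty_X_inv_pow {𝓛 : Type*} [Field 𝓛] [Algebra (RatFunc ℂ) 𝓛] {y : 𝓛}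
    (hy : IsAlgebraic (RatFunc ℂ) y) :
    ∃ N : ℕ, IsIntegral ratInftyIntegers (((RatFunc.X : RatFunc ℂ)⁻¹ ^ N) • y) := by
  have h1 : IsAlgebraic ratInftyIntegers y :=
    (IsFractionRing.isAlgebraic_iff ratInftyIntegers (RatFunc ℂ) 𝓛).2 hy
  obtain ⟨a, ha, hay⟩ := h1.exists_integral_multiple
  have ha' : (a : RatFunc ℂ) ≠ 0 := fun h => ha (Subtype.ext h)
  obtain ⟨N, hN⟩ : ∃ N : ℕ, (-(a : RatFunc ℂ).intDegree) ≤ N := ⟨_, Int.self_le_toNat _⟩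
  refine ⟨N, ?_⟩
  have hmem : (RatFunc.X : RatFunc ℂ)⁻¹ ^ N / (a : RatFunc ℂ) ∈ ratInftyIntegers := by
    change RatFunc.inftyValuation ℂ _ ≤ 1
    rw [map_div₀, RatFunc.inftyValuation_apply (x := (a : RatFunc ℂ)),
      RatFunc.inftyValuation_of_nonzero _ ha', ← zpow_natCast, inv_zpow',
      RatFunc.inftyValuation.X_zpow, ← WithZero.exp_sub,
      ← WithZero.exp_zero, WithZero.exp_le_exp]
    lia
  have h2 : ((RatFunc.X : RatFunc ℂ)⁻¹ ^ N) • y =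
      (⟨_, hmem⟩ : ratInftyIntegers) • (a • y) := by
    rw [Subring.smul_def, Subring.smul_def, smul_smul, div_mul_cancel₀ _ ha']
  rw [h2]
  exact hay.smul _

theorem algebraMap_coe_polynomial {𝓛 : Type*} [Field 𝓛] [Algebra (PowerSeries ℂ) 𝓛]
    [Algebra (Polynomial ℂ) 𝓛] [IsScalarTower (Polynomial ℂ) (PowerSeries ℂ) 𝓛] (p : Polynomial ℂ) :
    algebraMap (PowerSeries ℂ) 𝓛 (p : PowerSeries ℂ) = algebraMap (Polynomial ℂ) 𝓛 p := by
  rw [IsScalarTower.algebraMap_apply (Polynomial ℂ) (PowerSeries ℂ) 𝓛]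
  congr 1

section LaurentRescale

variable {𝓛 : Type*} [Field 𝓛] [Algebra (PowerSeries ℂ) 𝓛] [IsFractionRing (PowerSeries ℂ) 𝓛]

variable (𝓛) in
/-- The automorphism `f(z) ↦ f(ζ z)` of the field of formal Laurent series. -/
def laurentRescale (ζ : ℂˣ) : 𝓛 ≃+* 𝓛 :=
  IsFractionRing.ringEquivOfRingEquiv (psRescale ζ)

theorem laurentRescale_algebraMap (ζ : ℂˣ) (u : PowerSeries ℂ) :
    laurentRescale 𝓛 ζ (algebraMap _ _ u) = algebraMap _ _ (psRescale ζ u) :=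
  IsFractionRing.ringEquivOfRingEquiv_algebraMap _ _

variable [Algebra (Polynomial ℂ) 𝓛] [IsScalarTower (Polynomial ℂ) (PowerSeries ℂ) 𝓛]

theorem laurentRescale_algebraMap_polynomial (ζ : ℂˣ) (p : Polynomial ℂ) :
    laurentRescale 𝓛 ζ (algebraMap _ _ p) = algebraMap _ _ (polyRescale ζ p) := by
  rw [← algebraMap_coe_polynomial, laurentRescale_algebraMap, psRescale_coe,
    algebraMap_coe_polynomial]

theorem isIntegral_polynomial_laurentRescale (ζ : ℂˣ) {x : 𝓛} (hx : IsIntegral (Polynomial ℂ) x) :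
    IsIntegral (Polynomial ℂ) (laurentRescale 𝓛 ζ x) :=
  hx.map_of_comp_eq (polyRescale ζ : Polynomial ℂ →+* Polynomial ℂ)
    (laurentRescale 𝓛 ζ : 𝓛 →+* 𝓛)
    (RingHom.ext fun p => (laurentRescale_algebraMap_polynomial ζ p).symm)

variable [Algebra (RatFunc ℂ) 𝓛] [IsScalarTower (Polynomial ℂ) (RatFunc ℂ) 𝓛]

theorem laurentRescale_algebraMap_ratFunc (ζ : ℂˣ) (a : RatFunc ℂ) :
    laurentRescale 𝓛 ζ (algebraMap _ _ a) = algebraMap _ _ (ratRescale ζ a) := by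
  obtain ⟨p, s, -, rfl⟩ := IsFractionRing.div_surjective (A := Polynomial ℂ) a
  simp only [map_div₀, ratRescale_algebraMap,
    ← IsScalarTower.algebraMap_apply (Polynomial ℂ) (RatFunc ℂ) 𝓛,
    laurentRescale_algebraMap_polynomial]

theorem isIntegral_infty_laurentRescale (ζ : ℂˣ) {x : 𝓛} (hx : IsIntegral ratInftyIntegers x) :
    IsIntegral ratInftyIntegers (laurentRescale 𝓛 ζ x) :=
  hx.map_of_comp_eq
    ((ratRescale ζ : RatFunc ℂ →+* RatFunc ℂ).restrict ratInftyIntegers ratInftyIntegers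
      fun a ha => (inftyValuation_ratRescale ζ a).trans_le ha)
    (laurentRescale 𝓛 ζ : 𝓛 →+* 𝓛)
    (RingHom.ext fun p => (laurentRescale_algebraMap_ratFunc ζ (p : RatFunc ℂ)).symm)

open scoped Classical in
theorem le_mul_finrank_of_isIntegral {N D n : ℕ} {x : PowerSeries ℂ} (hx0 : x ≠ 0)
    (hx : IsIntegral (Polynomial ℂ) (algebraMap _ 𝓛 x))
    (hx' : IsIntegral ratInftyIntegers (((RatFunc.X : RatFunc ℂ)⁻¹ ^ N) • algebraMap _ 𝓛 x))
    (hn : PowerSeries.X ^ n ∣ x) (hD : (minpoly (RatFunc ℂ) (algebraMap _ 𝓛 x)).natDegree ≤ D) :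
    n ≤ N * D := by
  have hxκ : IsIntegral (RatFunc ℂ) (algebraMap _ 𝓛 x) := hx.tower_top
  have hX : (RatFunc.X : RatFunc ℂ)⁻¹ ^ N ≠ 0 := pow_ne_zero _ (inv_ne_zero RatFunc.X_ne_zero)
  have hxL : algebraMap _ 𝓛 x ≠ 0 := by
    simpa using hx0
  have e1 := minpoly.isIntegrallyClosed_eq_field_fractions' (RatFunc ℂ) hx
  have e2 := minpoly.isIntegrallyClosed_eq_field_fractions' (RatFunc ℂ) hx'
  rw [IsIntegrallyClosed.minpoly_smul hX hxκ] at e2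
  set m := minpoly (Polynomial ℂ) (algebraMap _ 𝓛 x) with hm
  have hm0 : m.coeff 0 ≠ 0 := by
    intro h
    apply minpoly.coeff_zero_ne_zero hxκ hxL
    rw [e1, Polynomial.coeff_map, h, map_zero]
  -- order at the origin
  have hord : n ≤ (m.coeff 0).natDegree := by
    have h0 : Polynomial.eval₂ Polynomial.coeToPowerSeries.ringHom x m = 0 := by
      apply IsFractionRing.injective (PowerSeries ℂ) 𝓛
      rw [Polynomial.hom_eval₂, map_zero, ← minpoly.aeval (Polynomial ℂ) (algebraMap _ 𝓛 x),
        Polynomial.aeval_def]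
      congr 1
      exact RingHom.ext fun p => algebraMap_coe_polynomial p
    have h1 : x ∣ ((m.coeff 0 : Polynomial ℂ) : PowerSeries ℂ) := by
      rw [← Polynomial.divX_mul_X_add m, Polynomial.eval₂_add, Polynomial.eval₂_mul,
        Polynomial.eval₂_X, Polynomial.eval₂_C] at h0
      exact ⟨-m.divX.eval₂ Polynomial.coeToPowerSeries.ringHom x, by
        rw [mul_neg, mul_comm]; exact (neg_eq_of_add_eq_zero_right h0).symm⟩
    have h2 := (PowerSeries.X_pow_dvd_iff).1 (hn.trans h1)
    by_contra hlt
    apply hm0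
    rw [← Polynomial.leadingCoeff_eq_zero, Polynomial.leadingCoeff]
    simpa using h2 _ (not_le.1 hlt)
  -- degree
  have hdeg : (m.coeff 0).natDegree ≤ N * (minpoly (RatFunc ℂ) (algebraMap _ 𝓛 x)).natDegree := by
    have h3 := congrArg (fun p => Polynomial.coeff p 0) e2
    simp only [Polynomial.coeff_scaleRoots, Polynomial.coeff_map, Nat.sub_zero] at h3
    have h4 : RatFunc.inftyValuation ℂ ((minpoly (RatFunc ℂ) (algebraMap _ 𝓛 x)).coeff 0 *
        ((RatFunc.X : RatFunc ℂ)⁻¹ ^ N) ^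
          (minpoly (RatFunc ℂ) (algebraMap _ 𝓛 x)).natDegree) ≤ 1 := by
      rw [h3]
      exact ((minpoly ratInftyIntegers
        (((RatFunc.X : RatFunc ℂ)⁻¹ ^ N) • algebraMap _ 𝓛 x)).coeff 0).2
    rw [map_mul, ← pow_mul, ← zpow_natCast, inv_zpow', RatFunc.inftyValuation.X_zpow, e1,
      Polynomial.coeff_map, RatFunc.inftyValuation_apply, RatFunc.inftyValuation.polynomial _ hm0,
      ← WithZero.exp_add, ← WithZero.exp_zero, WithZero.exp_le_exp, ← e1] at h4
    zify
    push_cast at h4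
    linarith
  exact (hord.trans hdeg).trans (Nat.mul_le_mul_left _ hD)

open scoped Classical in
theorem intermediateField_eq_bot_of_laurentRescale_stable {q : ℕ} (hq : 2 ≤ q)
    (L : IntermediateField (RatFunc ℂ) 𝓛) [FiniteDimensional (RatFunc ℂ) L]
    (hL : ∀ (k : ℕ) (ζ : ℂˣ), ζ ^ q ^ k = 1 → ∀ x ∈ L, laurentRescale 𝓛 ζ x ∈ L) : L = ⊥ := by
  refine le_antisymm (fun x₀ hx₀ => ?_) bot_le
  have halg : ∀ x ∈ L, IsAlgebraic (RatFunc ℂ) x := fun x hx =>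
    IsAlgebraic.algebraMap (A := 𝓛)
      (Algebra.IsAlgebraic.isAlgebraic (R := RatFunc ℂ) (⟨x, hx⟩ : L))
  obtain ⟨a, ha, hy⟩ := ((IsFractionRing.isAlgebraic_iff (Polynomial ℂ) (RatFunc ℂ) 𝓛).2
    (halg x₀ hx₀)).exists_integral_multiple
  have hyL : a • x₀ ∈ L := by
    rw [← IsScalarTower.algebraMap_smul (RatFunc ℂ) a x₀]
    exact L.smul_mem hx₀
  obtain ⟨Y, hY⟩ := IsIntegrallyClosed.algebraMap_eq_of_integral (hy.tower_top (A := PowerSeries ℂ))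
  rw [← hY] at hyL hy
  obtain ⟨N, hN⟩ := exists_isIntegral_infty_X_inv_pow (halg _ hyL)
  set D := Module.finrank (RatFunc ℂ) L
  have hcoeff : ∀ n, N * D < n → PowerSeries.coeff n Y = 0 := by
    intro n hn
    by_contra hYn
    obtain ⟨k, hk⟩ : ∃ k, n < q ^ k := ⟨n, Nat.lt_pow_self hq⟩
    have hQ : q ^ k ≠ 0 := by lia
    have hω := Complex.isPrimitiveRoot_exp (q ^ k) hQ
    obtain ⟨ω, hω'⟩ := hω.isUnit hQ
    rw [← hω'] at hω
    have hωpow : ω ^ q ^ k = 1 := Units.ext (by simpa using hω.pow_eq_one)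
    let c : ℕ → ℂ := fun j => (((ω ^ j) ^ n)⁻¹ : ℂˣ)
    let x : PowerSeries ℂ := ∑ j ∈ Finset.range (q ^ k), PowerSeries.C (c j) * psRescale (ω ^ j) Y
    have hxL : algebraMap _ 𝓛 x =
        ∑ j ∈ Finset.range (q ^ k), algebraMap (Polynomial ℂ) 𝓛 (Polynomial.C (c j)) *
          laurentRescale 𝓛 (ω ^ j) (algebraMap _ 𝓛 Y) := by
      simp only [x, map_sum, map_mul, laurentRescale_algebraMap]
      refine Finset.sum_congr rfl fun j _ => ?_
      rw [← algebraMap_coe_polynomial, Polynomial.coe_C]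
    have hroot : ∀ j, (ω ^ j) ^ q ^ k = 1 := fun j => by rw [pow_right_comm, hωpow, one_pow]
    have hmem : algebraMap _ 𝓛 x ∈ L := by
      rw [hxL]
      refine sum_mem fun j _ => mul_mem ?_ (hL k _ (hroot j) _ hyL)
      rw [IsScalarTower.algebraMap_apply (Polynomial ℂ) (RatFunc ℂ) 𝓛]
      exact L.algebraMap_mem _
    have hint : IsIntegral (Polynomial ℂ) (algebraMap _ 𝓛 x) := by
      rw [hxL]
      exact IsIntegral.sum _ fun j _ =>
        isIntegral_algebraMap.mul (isIntegral_polynomial_laurentRescale _ hy)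
    have hcx : ∀ m, PowerSeries.coeff m x =
        (∑ j ∈ Finset.range (q ^ k), ((ω : ℂ) ^ m * ((ω : ℂ) ^ n)⁻¹) ^ j) *
          PowerSeries.coeff m Y := by
      intro m
      simp only [x, map_sum, PowerSeries.coeff_C_mul, psRescale_apply, PowerSeries.coeff_rescale,
        Finset.sum_mul, c]
      refine Finset.sum_congr rfl fun j _ => ?_
      push_cast
      rw [mul_pow, inv_pow, ← pow_mul, ← pow_mul, ← pow_mul, ← pow_mul, mul_comm j n, mul_comm j m]
      ring
    have hxn : x ≠ 0 := by
      intro h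
      have := hcx n
      rw [h, mul_inv_cancel₀ (pow_ne_zero _ ω.ne_zero)] at this
      simp [hYn] at this
      lia
    have hdvd : PowerSeries.X ^ n ∣ x := by
      rw [PowerSeries.X_pow_dvd_iff]
      intro m hm
      rw [hcx]
      have hne : (ω : ℂ) ^ m * ((ω : ℂ) ^ n)⁻¹ ≠ 1 := by
        intro h
        rw [mul_inv_eq_one₀ (pow_ne_zero _ ω.ne_zero)] at h
        exact hm.ne (hω.pow_inj (hm.trans hk) hk h)
      rw [geom_sum_eq hne, mul_pow, inv_pow, ← pow_mul, ← pow_mul, mul_comm m, mul_comm n,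
        pow_mul, pow_mul, hω.pow_eq_one]
      simp
    have hint' : IsIntegral ratInftyIntegers
        (((RatFunc.X : RatFunc ℂ)⁻¹ ^ N) • algebraMap _ 𝓛 x) := by
      rw [hxL, Finset.smul_sum]
      refine IsIntegral.sum _ fun j _ => ?_
      have hXr : ratRescale (ω ^ j) (RatFunc.X) =
          algebraMap _ _ (Polynomial.C (((ω ^ j : ℂˣ)) : ℂ)) * RatFunc.X := by
        rw [← RatFunc.algebraMap_X, ratRescale_algebraMap, polyRescale_apply, Polynomial.X_comp,
          map_mul]
      have hC : ∀ c : ℂ, IsIntegral ratInftyIntegers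
          (algebraMap (Polynomial ℂ) 𝓛 (Polynomial.C c)) := by
        intro c
        have hc : algebraMap (Polynomial ℂ) (RatFunc ℂ) (Polynomial.C c) ∈ ratInftyIntegers := by
          change RatFunc.inftyValuation ℂ _ ≤ 1
          rcases eq_or_ne c 0 with rfl | hc
          · simp
          · rw [RatFunc.algebraMap_C, RatFunc.inftyValuation.C _ hc]
        rw [IsScalarTower.algebraMap_apply (Polynomial ℂ) (RatFunc ℂ) 𝓛]
        exact isIntegral_algebraMap (x := (⟨_, hc⟩ : ratInftyIntegers))
      have h5 := isIntegral_infty_laurentRescale (ω ^ j) hN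
      rw [Algebra.smul_def, map_mul, laurentRescale_algebraMap_ratFunc, map_pow, map_inv₀, hXr,
        mul_inv, mul_pow, map_mul] at h5
      have h6 := ((hC (((ω ^ j : ℂˣ) : ℂ) ^ N)).mul (hC (c j))).mul h5
      convert h6 using 1
      have hne : algebraMap (RatFunc ℂ) 𝓛
          (algebraMap _ _ (Polynomial.C ((ω ^ j : ℂˣ) : ℂ))) ≠ 0 := by
        simp
      rw [Algebra.smul_def, Polynomial.C_pow, map_pow (algebraMap (Polynomial ℂ) 𝓛),
        IsScalarTower.algebraMap_apply (Polynomial ℂ) (RatFunc ℂ) 𝓛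
          (Polynomial.C ((ω ^ j : ℂˣ) : ℂ))]
      simp only [map_pow, map_inv₀, inv_pow]
      field_simp
    refine absurd (le_mul_finrank_of_isIntegral (D := D) hxn hint hint' hdvd ?_) (not_le.2 hn)
    have := minpoly.natDegree_le (A := RatFunc ℂ) (⟨_, hmem⟩ : L)
    rwa [← minpoly.algebraMap_eq (algebraMap L 𝓛).injective] at this
  have hYpoly : Y = (Y.trunc (N * D + 1) : Polynomial ℂ) := by
    ext n
    rw [Polynomial.coeff_coe, PowerSeries.coeff_trunc]
    split_ifs with h
    · rfl
    · exact hcoeff n (by lia)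
  rw [hYpoly, algebraMap_coe_polynomial] at hY
  rw [IntermediateField.mem_bot]
  refine ⟨algebraMap _ _ (Y.trunc (N * D + 1)) / algebraMap _ _ a, ?_⟩
  have ha' : algebraMap (Polynomial ℂ) 𝓛 a ≠ 0 := by
    rw [IsScalarTower.algebraMap_apply (Polynomial ℂ) (RatFunc ℂ) 𝓛]
    simpa using ha
  rw [map_div₀, ← IsScalarTower.algebraMap_apply, ← IsScalarTower.algebraMap_apply, hY,
    Algebra.smul_def, mul_div_cancel_left₀ _ ha']

end LaurentRescale

theorem mem_span_window_of_recurrence {F V : Type*} [Field F] [AddCommGroup V] [Module F V]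
    (v : ℕ → V) {n : ℕ} (a : ℕ → ℕ → F) (ha0 : ∀ m, a m 0 ≠ 0)
    (han : ∀ m, a m n ≠ 0) (hrel : ∀ m, ∑ j ∈ Finset.range (n + 1), a m j • v (m + j) = 0)
    (k m : ℕ) : v m ∈ Submodule.span F (v '' Set.Ico k (k + n)) := by
  have h1 : ∀ m, v m ∈ Submodule.span F (v '' Set.Ico (m + 1) (m + 1 + n)) := by
    intro m
    have h := hrel m
    rw [Finset.sum_range_succ', add_zero, add_eq_zero_iff_neg_eq] at h
    rw [← Submodule.smul_mem_iff _ (ha0 m), ← h]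
    refine neg_mem (sum_mem fun j hj => Submodule.smul_mem _ _ (Submodule.subset_span ⟨_, ?_, rfl⟩))
    rw [Finset.mem_range] at hj
    constructor <;> lia
  have h2 : ∀ m, v (m + n) ∈ Submodule.span F (v '' Set.Ico m (m + n)) := by
    intro m
    have h := hrel m
    rw [Finset.sum_range_succ, add_eq_zero_iff_neg_eq] at h
    rw [← Submodule.smul_mem_iff _ (han m), ← h]
    refine neg_mem (sum_mem fun j hj => Submodule.smul_mem _ _ (Submodule.subset_span ⟨_, ?_, rfl⟩))
    rw [Finset.mem_range] at hj
    constructor <;> lia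
  have hstep : ∀ k, Submodule.span F (v '' Set.Ico k (k + n)) =
      Submodule.span F (v '' Set.Ico (k + 1) (k + 1 + n)) := by
    intro k
    apply le_antisymm <;> rw [Submodule.span_le] <;> rintro _ ⟨i, ⟨hi, hi'⟩, rfl⟩
    · rcases eq_or_ne i k with rfl | h
      · exact h1 i
      · exact Submodule.subset_span ⟨i, ⟨by lia, by lia⟩, rfl⟩
    · rcases eq_or_ne i (k + n) with rfl | h
      · exact h2 k
      · exact Submodule.subset_span ⟨i, ⟨by lia, by lia⟩, rfl⟩
  have hall : ∀ k, Submodule.span F (v '' Set.Ico k (k + n)) =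
      Submodule.span F (v '' Set.Ico 0 (0 + n)) := by
    intro k
    induction k with
    | zero => rfl
    | succ k ih => rw [← hstep, ih]
  rw [hall, ← hall (m + 1)]
  exact h1 m

/-- The iterated Mahler operator `f(z) ↦ f(z ^ q ^ j)`. -/
def mahlerIter {R : Type*} [CommRing R] {q : ℕ} (hq : q ≠ 0) (j : ℕ) :
    PowerSeries R →ₐ[R] PowerSeries R :=
  PowerSeries.expand (q ^ j) (pow_ne_zero j hq)

section MahlerIter

variable {R : Type*} [CommRing R] {q : ℕ} (hq : q ≠ 0)

theorem coeff_mahlerIter (j n : ℕ) (u : PowerSeries R) :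
    PowerSeries.coeff n (mahlerIter hq j u) =
      if q ^ j ∣ n then PowerSeries.coeff (n / q ^ j) u else 0 :=
  PowerSeries.coeff_expand _ _ _

theorem mahlerIter_zero (u : PowerSeries R) : mahlerIter hq 0 u = u := by
  ext n
  simp [coeff_mahlerIter]

theorem mahlerIter_mahlerIter (i j : ℕ) (u : PowerSeries R) :
    mahlerIter hq i (mahlerIter hq j u) = mahlerIter hq (i + j) u := by
  rw [mahlerIter, mahlerIter, ← PowerSeries.expand_mul, mahlerIter]
  congr 1
  simp only [pow_add]

theorem map_mahlerIter {S : Type*} [CommRing S] (φ : R →+* S) (j : ℕ) (u : PowerSeries R) :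
    PowerSeries.map φ (mahlerIter hq j u) = mahlerIter hq j (PowerSeries.map φ u) :=
  PowerSeries.map_expand _ _ _ _

theorem mahlerIter_coe (j : ℕ) (p : Polynomial R) :
    mahlerIter hq j (p : PowerSeries R) = (Polynomial.expand R (q ^ j) p : Polynomial R) := by
  ext n
  rw [coeff_mahlerIter, Polynomial.coeff_coe, Polynomial.coeff_coe,
    Polynomial.coeff_expand (pow_pos (by lia) j)]

theorem psSigma_iterate (j : ℕ) (u : PowerSeries ℂ) : (psSigma q)^[j] u = mahlerIter hq j u := by
  induction j generalizing u with
  | zero => simp [mahlerIter_zero]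
  | succ j ih =>
    have h1 : psSigma q u = mahlerIter hq 1 u := by
      ext n
      simp [psSigma, coeff_mahlerIter]
    rw [Function.iterate_succ_apply, ih, h1, mahlerIter_mahlerIter]

theorem mahlerIter_relation {n : ℕ} {g : PowerSeries R} {p : ℕ → Polynomial R}
    (hrel : ∑ j ∈ Finset.range (n + 1), (p j : PowerSeries R) * mahlerIter hq j g = 0) (m : ℕ) :
    ∑ j ∈ Finset.range (n + 1), ((Polynomial.expand R (q ^ m) (p j) : Polynomial R) :
      PowerSeries R) * mahlerIter hq (m + j) g = 0 := by
  have := congrArg (mahlerIter hq m) hrel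
  simpa only [map_sum, map_mul, mahlerIter_coe, mahlerIter_mahlerIter, map_zero] using this

end MahlerIter

theorem psRescale_mahlerIter {q : ℕ} (hq : q ≠ 0) {k m : ℕ} (hkm : k ≤ m) {ζ : ℂˣ}
    (hζ : ζ ^ q ^ k = 1) (u : PowerSeries ℂ) :
    psRescale ζ (mahlerIter hq m u) = mahlerIter hq m u := by
  ext n
  rw [psRescale_apply, PowerSeries.coeff_rescale, coeff_mahlerIter]
  split_ifs with h
  · obtain ⟨c, rfl⟩ := (pow_dvd_pow q hkm).trans h
    have : (ζ : ℂ) ^ q ^ k = 1 := by simpa using congrArg Units.val hζ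
    rw [pow_mul, this, one_pow, one_mul]
  · simp

/-- A Mahler function all of whose conjugates `g(z ^ q ^ i)`, `i < n`, are linearly independent
over rational functions satisfies no linear relation of order `< n` with algebraic
coefficients. -/
theorem eq_zero_of_isAlgebraic_mahler_relation {𝓛 : Type*} [Field 𝓛] [Algebra (PowerSeries ℂ) 𝓛]
    [IsFractionRing (PowerSeries ℂ) 𝓛] [Algebra (Polynomial ℂ) 𝓛]
    [IsScalarTower (Polynomial ℂ) (PowerSeries ℂ) 𝓛] {q n : ℕ} (hq : 2 ≤ q) (hq0 : q ≠ 0)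
    {g : PowerSeries ℂ} {p : ℕ → Polynomial ℂ} (hp0 : p 0 ≠ 0) (hpn : p n ≠ 0)
    (hrel : ∑ j ∈ Finset.range (n + 1), (p j : PowerSeries ℂ) * mahlerIter hq0 j g = 0)
    (hind : ∀ c : Fin n → Polynomial ℂ,
      ∑ i, (c i : PowerSeries ℂ) * mahlerIter hq0 i g = 0 → c = 0)
    (w : Fin n → 𝓛) (hw : ∀ i, IsAlgebraic (Polynomial ℂ) (w i))
    (h0 : ∑ i, w i * algebraMap _ 𝓛 (mahlerIter hq0 i g) = 0) : w = 0 := by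
  have hinj : Function.Injective (algebraMap (Polynomial ℂ) 𝓛) := by
    intro a b hab
    rw [← algebraMap_coe_polynomial, ← algebraMap_coe_polynomial] at hab
    exact Polynomial.coe_injective _ (IsFractionRing.injective (PowerSeries ℂ) 𝓛 hab)
  let _ : Algebra (RatFunc ℂ) 𝓛 := (IsFractionRing.lift hinj : RatFunc ℂ →+* 𝓛).toAlgebra
  have : IsScalarTower (Polynomial ℂ) (RatFunc ℂ) 𝓛 :=
    IsScalarTower.of_algebraMap_eq fun a => (IsFractionRing.lift_algebraMap hinj a).symm
  have hsmul : ∀ (c : Polynomial ℂ) (x : 𝓛), algebraMap _ (RatFunc ℂ) c • x =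
      algebraMap (PowerSeries ℂ) 𝓛 c * x := by
    intro c x
    rw [algebraMap_coe_polynomial, IsScalarTower.algebraMap_smul, Algebra.smul_def]
  set v : ℕ → 𝓛 := fun m => algebraMap _ 𝓛 (mahlerIter hq0 m g) with hv
  have hwin := mem_span_window_of_recurrence (F := RatFunc ℂ) v (n := n)
    (fun m j => algebraMap _ _ (Polynomial.expand ℂ (q ^ m) (p j)))
    (fun m => by simpa [Polynomial.expand_eq_zero (pow_pos (by lia : 0 < q) m)] using hp0)
    (fun m => by simpa [Polynomial.expand_eq_zero (pow_pos (by lia : 0 < q) m)] using hpn)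
    (fun m => by
      have := congrArg (algebraMap _ 𝓛) (mahlerIter_relation hq0 hrel m)
      simpa only [map_sum, map_mul, map_zero, hsmul, v] using this)
  have hrange : v '' Set.Ico 0 (0 + n) = Set.range fun i : Fin n => v i := by
    ext x
    constructor
    · rintro ⟨i, hi, rfl⟩
      exact ⟨⟨i, by simpa using hi⟩, rfl⟩
    · rintro ⟨i, rfl⟩
      exact ⟨i, ⟨by lia, by lia⟩, rfl⟩
  obtain ⟨L, hLfin, hLst, hL⟩ := exists_intermediateField_stable (κ := RatFunc ℂ)
    (fun i : Fin n => v i) {τ | ∃ (k : ℕ) (ζ : ℂˣ), ζ ^ q ^ k = 1 ∧ τ = laurentRescale 𝓛 ζ}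
    (by
      rintro _ ⟨k, ζ, -, rfl⟩
      exact ⟨ratRescale ζ, laurentRescale_algebraMap_ratFunc ζ⟩)
    (by
      rintro _ ⟨k, ζ, hζ, rfl⟩ i
      rw [← hrange]
      have hi := hwin k i
      change laurentRescale 𝓛 ζ (v i) ∈ _
      generalize v i = x at hi ⊢
      induction hi using Submodule.span_induction with
      | mem x hx =>
        obtain ⟨m, hm, rfl⟩ := hx
        simp only [hv]
        rw [laurentRescale_algebraMap, psRescale_mahlerIter hq0 hm.1 hζ]
        exact hwin 0 m
      | zero => rw [map_zero]; exact zero_mem _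
      | add x y _ _ hx hy => rw [map_add]; exact add_mem hx hy
      | smul a x _ hx =>
        rw [Algebra.smul_def, map_mul, laurentRescale_algebraMap_ratFunc, ← Algebra.smul_def]
        exact Submodule.smul_mem _ _ hx)
  refine hL (intermediateField_eq_bot_of_laurentRescale_stable hq L
    fun k ζ hζ => hLst _ ⟨k, ζ, hζ, rfl⟩) ?_ w
    (fun i => (IsFractionRing.isAlgebraic_iff (Polynomial ℂ) (RatFunc ℂ) 𝓛).1 (hw i)) h0
  rw [← LinearIndependent.iff_fractionRing (Polynomial ℂ) (RatFunc ℂ),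
    Fintype.linearIndependent_iff]
  intro c hc i
  refine congrFun (hind c ?_) i
  apply IsFractionRing.injective (PowerSeries ℂ) 𝓛
  rw [map_zero, ← hc, map_sum]
  refine Finset.sum_congr rfl fun i _ => ?_
  rw [map_mul, Algebra.smul_def, algebraMap_coe_polynomial]

section NumberFieldSize

theorem isIntegral_natCast_mul {K : Type*} [Field K] {b : ℕ} {x : K} (h : IsIntegral ℤ x) :
    IsIntegral ℤ ((b : K) * x) :=
  (map_natCast (algebraMap ℤ K) b ▸ isIntegral_algebraMap : IsIntegral ℤ (b : K)).mul h

variable {K : Type*} [Field K] [NumberField K]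

/-- The Liouville inequality: a nonzero element of a number field whose denominator and conjugates
are bounded is not too small. -/
theorem one_le_pow_mul_norm_of_isIntegral (φ : K →+* ℂ) {b : ℕ} {H : ℝ} (hH : 1 ≤ H) {x : K}
    (hx : x ≠ 0) (hint : IsIntegral ℤ ((b : K) * x)) (hb : b ≠ 0)
    (hconj : ∀ ψ : K →+* ℂ, ‖ψ x‖ ≤ H) :
    1 ≤ (b * H) ^ Module.finrank ℚ K * ‖φ x‖ := by
  classical
  set y : K := (b : K) * x with hy
  have hy0 : y ≠ 0 := mul_ne_zero (by exact_mod_cast hb) hx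
  have hnorm : IsIntegral ℤ (Algebra.norm ℚ y) := Algebra.isIntegral_norm ℚ hint
  obtain ⟨m, hm⟩ := IsIntegrallyClosed.isIntegral_iff.1 hnorm
  have hm0 : m ≠ 0 := by
    rintro rfl
    rw [map_zero, eq_comm, Algebra.norm_eq_zero_iff] at hm
    exact hy0 hm
  have h1 : (1 : ℝ) ≤ ‖algebraMap ℚ ℂ (Algebra.norm ℚ y)‖ := by
    rw [← hm]
    simpa using (by exact_mod_cast Int.one_le_abs hm0 : (1 : ℝ) ≤ |(m : ℝ)|)
  rw [Algebra.norm_eq_prod_embeddings ℚ ℂ y, norm_prod] at h1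
  let φ' : K →ₐ[ℚ] ℂ := φ.toRatAlgHom
  rw [← Finset.mul_prod_erase _ _ (Finset.mem_univ φ')] at h1
  have hbH : (1 : ℝ) ≤ b * H := by
    have : (1 : ℝ) ≤ b := by exact_mod_cast Nat.one_le_iff_ne_zero.2 hb
    nlinarith
  have h2 : ∏ ψ ∈ Finset.univ.erase φ', ‖ψ y‖ ≤ (b * H) ^ (Module.finrank ℚ K - 1) := by
    calc _ ≤ ∏ ψ ∈ Finset.univ.erase φ', (b * H : ℝ) := by
          refine Finset.prod_le_prod (fun _ _ => norm_nonneg _) fun ψ _ => ?_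
          rw [hy, map_mul, norm_mul, map_natCast, Complex.norm_natCast]
          exact mul_le_mul_of_nonneg_left (hconj (ψ : K →+* ℂ)) (Nat.cast_nonneg _)
      _ = _ := by
          rw [Finset.prod_const, Finset.card_erase_of_mem (Finset.mem_univ _), Finset.card_univ,
            AlgHom.card]
  have h3 : ‖φ' y‖ = b * ‖φ x‖ := by
    rw [hy, map_mul, norm_mul, map_natCast, Complex.norm_natCast]
    rfl
  rw [h3] at h1
  have hD : Module.finrank ℚ K - 1 + 1 = Module.finrank ℚ K :=
    Nat.sub_add_cancel Module.finrank_pos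
  calc (1 : ℝ) ≤ b * ‖φ x‖ * (b * H) ^ (Module.finrank ℚ K - 1) :=
        h1.trans (mul_le_mul_of_nonneg_left h2 (by positivity))
    _ ≤ (b * H) * ‖φ x‖ * (b * H) ^ (Module.finrank ℚ K - 1) := by
        gcongr
        exact le_mul_of_one_le_right (Nat.cast_nonneg _) hH
    _ = _ := by
        conv_rhs => rw [← hD, pow_succ]
        ring

theorem exists_nat_isIntegral_mul (x : K) : ∃ c : ℕ, 0 < c ∧ IsIntegral ℤ ((c : K) * x) := by
  obtain ⟨y, hy, h⟩ := ((IsFractionRing.isAlgebraic_iff ℤ ℚ K).2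
    (Algebra.IsAlgebraic.isAlgebraic (R := ℚ) x)).exists_integral_multiple
  refine ⟨y.natAbs, Int.natAbs_pos.2 hy, ?_⟩
  rw [zsmul_eq_mul] at h
  rcases Int.natAbs_eq y with h' | h'
  · rwa [h', Int.cast_natCast] at h
  · rw [h', Int.cast_neg, Int.cast_natCast, neg_mul] at h
    exact (IsIntegral.neg_iff).1 h

theorem exists_nat_size_bound (x : K) :
    ∃ c : ℕ, 0 < c ∧ IsIntegral ℤ ((c : K) * x) ∧ ∀ ψ : K →+* ℂ, ‖ψ x‖ ≤ c := by
  obtain ⟨c, hc, h⟩ := exists_nat_isIntegral_mul x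
  obtain ⟨e, he⟩ := exists_nat_ge (∑ ψ : K →+* ℂ, ‖ψ x‖)
  refine ⟨(e + 1) * c, by positivity, ?_, fun ψ => ?_⟩
  · rw [Nat.cast_mul, mul_assoc]
    exact isIntegral_natCast_mul h
  · calc ‖ψ x‖ ≤ ∑ ψ : K →+* ℂ, ‖ψ x‖ :=
          Finset.single_le_sum (f := fun ψ : K →+* ℂ => ‖ψ x‖) (fun _ _ => norm_nonneg _)
            (Finset.mem_univ ψ)
      _ ≤ e := he
      _ ≤ ((e + 1) * c : ℕ) := by
          exact_mod_cast (Nat.le_succ e).trans (Nat.le_mul_of_pos_right _ hc)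

theorem exists_nat_size_bound_family {ι : Type*} [Finite ι] (x : ι → K) :
    ∃ c : ℕ, 0 < c ∧ ∀ i, IsIntegral ℤ ((c : K) * x i) ∧ ∀ ψ : K →+* ℂ, ‖ψ (x i)‖ ≤ c := by
  classical
  have := Fintype.ofFinite ι
  choose c hc h1 h2 using fun i => exists_nat_size_bound (x i)
  refine ⟨∏ i, c i, Finset.prod_pos fun i _ => hc i, fun i => ⟨?_, fun ψ => (h2 i ψ).trans ?_⟩⟩
  · rw [← Finset.mul_prod_erase _ _ (Finset.mem_univ i), mul_comm (c i), Nat.cast_mul, mul_assoc]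
    exact isIntegral_natCast_mul (h1 i)
  · exact_mod_cast Finset.single_le_prod' (f := c) (fun j _ => hc j) (Finset.mem_univ i)

/-- Denominators and conjugates of the values at `β ^ r` of finitely many polynomials. -/
theorem exists_size_bound_eval {ι : Type*} [Finite ι] (P : ι → Polynomial K) {δ : ℕ}
    (hδ : ∀ i, (P i).natDegree ≤ δ) {β : K} {a : ℕ} (ha0 : 0 < a)
    (ha : IsIntegral ℤ ((a : K) * β)) (hA : ∀ ψ : K →+* ℂ, ‖ψ β‖ ≤ a) :
    ∃ c : ℕ, 0 < c ∧ ∀ (i : ι) (r : ℕ),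
      IsIntegral ℤ (((c * a ^ (δ * r) : ℕ) : K) * (P i).eval (β ^ r)) ∧
      ∀ ψ : K →+* ℂ, ‖ψ ((P i).eval (β ^ r))‖ ≤ (c * a ^ (δ * r) : ℕ) := by
  obtain ⟨c, hc, h⟩ := exists_nat_size_bound_family
    (fun p : ι × Fin (δ + 1) => (P p.1).coeff p.2)
  have heval : ∀ (i : ι) (r : ℕ), (P i).eval (β ^ r) =
      ∑ j : Fin (δ + 1), (P i).coeff j * β ^ (r * (j : ℕ)) := by
    intro i r
    rw [Polynomial.eval_eq_sum_range' (Nat.lt_succ_of_le (hδ i)), Finset.sum_range]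
    simp [pow_mul]
  refine ⟨(δ + 1) * c, by positivity, fun i r => ⟨?_, fun ψ => ?_⟩⟩
  · rw [heval, Finset.mul_sum]
    refine IsIntegral.sum _ fun j _ => ?_
    have hle : r * (j : ℕ) ≤ δ * r := by
      rw [mul_comm δ]; exact Nat.mul_le_mul_left _ (by lia)
    have : (((δ + 1) * c * a ^ (δ * r) : ℕ) : K) * ((P i).coeff j * β ^ (r * (j : ℕ))) =
        (((δ + 1) * a ^ (δ * r - r * (j : ℕ)) : ℕ) : K) *
          (((c : K) * (P i).coeff j) * ((a : K) * β) ^ (r * (j : ℕ))) := by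
      push_cast
      rw [mul_pow, ← Nat.sub_add_cancel hle, pow_add]
      simp only [Nat.add_sub_cancel]
      ring
    rw [this]
    exact isIntegral_natCast_mul ((h (i, j)).1.mul (ha.pow _))
  · rw [heval, map_sum]
    have ha1 : (1 : ℝ) ≤ a := by exact_mod_cast ha0
    calc _ ≤ ∑ j : Fin (δ + 1), ‖ψ ((P i).coeff j * β ^ (r * (j : ℕ)))‖ := norm_sum_le _ _
      _ ≤ ∑ j : Fin (δ + 1), (c * a ^ (δ * r) : ℝ) := by
          refine Finset.sum_le_sum fun j _ => ?_
          rw [map_mul, norm_mul, map_pow, norm_pow]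
          have hle : r * (j : ℕ) ≤ δ * r := by
            rw [mul_comm δ]; exact Nat.mul_le_mul_left _ (by lia)
          gcongr
          · exact (h (i, j)).2 ψ
          · exact (pow_le_pow_left₀ (norm_nonneg _) (hA ψ) _).trans
              (pow_le_pow_right₀ ha1 hle)
      _ = _ := by
          simp
          ring

end NumberFieldSize

section ConvergentSeries

variable {K : Type*} [Field K]

/-- The value at `z` of a power series over `K`, for an embedding `φ` of `K` into `ℂ`. -/
def psValue (φ : K →+* ℂ) (u : PowerSeries K) (z : ℂ) : ℂ :=
  ∑' n, φ (PowerSeries.coeff n u) * z ^ n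

/-- The ring of power series which converge absolutely on the closed disk of radius `ρ`. -/
def convergentSubring (φ : K →+* ℂ) (ρ : ℝ) : Subring (PowerSeries K) where
  carrier := {u | Summable fun n => ‖φ (PowerSeries.coeff n u) * (ρ : ℂ) ^ n‖}
  zero_mem' := by simp
  one_mem' := by
    refine summable_of_ne_finset_zero (s := {0}) fun n hn => ?_
    rw [PowerSeries.coeff_one, if_neg (by simpa using hn)]
    simp
  add_mem' {u v} hu hv := by
    refine Summable.of_nonneg_of_le (fun _ => norm_nonneg _) (fun n => ?_) (hu.add hv)
    rw [map_add, map_add, add_mul]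
    exact norm_add_le _ _
  neg_mem' {u} hu := by simpa using hu
  mul_mem' {u v} hu hv := by
    refine (summable_norm_sum_mul_antidiagonal_of_summable_norm hu hv).congr fun n => ?_
    congr 1
    rw [PowerSeries.coeff_mul, map_sum, Finset.sum_mul]
    refine Finset.sum_congr rfl fun p hp => ?_
    rw [← Finset.HasAntidiagonal.mem_antidiagonal.1 hp, map_mul, pow_add]
    ring

theorem mem_convergentSubring {φ : K →+* ℂ} {ρ : ℝ} {u : PowerSeries K} :
    u ∈ convergentSubring φ ρ ↔ Summable fun n => ‖φ (PowerSeries.coeff n u) * (ρ : ℂ) ^ n‖ :=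
  Iff.rfl

variable {φ : K →+* ℂ} {ρ : ℝ} {u v : PowerSeries K} {z : ℂ}

theorem summable_norm_of_mem_convergentSubring (hu : u ∈ convergentSubring φ ρ) (hz : ‖z‖ ≤ ρ) :
    Summable fun n => ‖φ (PowerSeries.coeff n u) * z ^ n‖ := by
  refine Summable.of_nonneg_of_le (fun _ => norm_nonneg _) (fun n => ?_)
    (mem_convergentSubring.1 hu)
  rw [norm_mul, norm_mul, norm_pow, norm_pow, Complex.norm_real]
  have := hz.trans (le_abs_self ρ)
  gcongr
  exact this

theorem psValue_add (hu : u ∈ convergentSubring φ ρ) (hv : v ∈ convergentSubring φ ρ)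
    (hz : ‖z‖ ≤ ρ) : psValue φ (u + v) z = psValue φ u z + psValue φ v z := by
  rw [psValue, psValue, psValue, ← Summable.tsum_add
    (summable_norm_of_mem_convergentSubring hu hz).of_norm
    (summable_norm_of_mem_convergentSubring hv hz).of_norm]
  simp [add_mul]

theorem psValue_mul (hu : u ∈ convergentSubring φ ρ) (hv : v ∈ convergentSubring φ ρ)
    (hz : ‖z‖ ≤ ρ) : psValue φ (u * v) z = psValue φ u z * psValue φ v z := by
  rw [psValue, psValue, psValue, tsum_mul_tsum_eq_tsum_sum_antidiagonal_of_summable_norm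
    (summable_norm_of_mem_convergentSubring hu hz)
    (summable_norm_of_mem_convergentSubring hv hz)]
  refine tsum_congr fun n => ?_
  rw [PowerSeries.coeff_mul, map_sum, Finset.sum_mul]
  refine Finset.sum_congr rfl fun p hp => ?_
  rw [← Finset.HasAntidiagonal.mem_antidiagonal.1 hp, map_mul, pow_add]
  ring

theorem coe_mem_convergentSubring (p : Polynomial K) :
    (p : PowerSeries K) ∈ convergentSubring φ ρ := by
  refine summable_of_ne_finset_zero (s := Finset.range (p.natDegree + 1)) fun n hn => ?_
  rw [Polynomial.coeff_coe, Polynomial.coeff_eq_zero_of_natDegree_lt (by simpa using hn)]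
  simp

theorem psValue_coe (p : Polynomial K) : psValue φ p z = p.eval₂ φ z := by
  rw [psValue, tsum_eq_sum (s := Finset.range (p.natDegree + 1)) fun n hn => ?_,
    Polynomial.eval₂_eq_sum_range]
  · simp
  · rw [Polynomial.coeff_coe, Polynomial.coeff_eq_zero_of_natDegree_lt (by simpa using hn)]
    simp

theorem psValue_coe_map (p : Polynomial K) (x : K) : psValue φ p (φ x) = φ (p.eval x) := by
  rw [psValue_coe, Polynomial.eval₂_at_apply]

/-- Evaluation of convergent power series as a ring homomorphism. -/
def convEval (φ : K →+* ℂ) {ρ : ℝ} {z : ℂ} (hz : ‖z‖ ≤ ρ) : convergentSubring φ ρ →+* ℂ where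
  toFun u := psValue φ u z
  map_zero' := by simp [psValue]
  map_one' := by simpa using psValue_coe (φ := φ) (z := z) 1
  map_add' u v := psValue_add u.2 v.2 hz
  map_mul' u v := psValue_mul u.2 v.2 hz

theorem convEval_apply (hz : ‖z‖ ≤ ρ) (u : convergentSubring φ ρ) :
    convEval φ hz u = psValue φ u z := rfl

variable {q : ℕ}

theorem summable_norm_mahlerIter (hq0 : q ≠ 0) (j : ℕ)
    (hu : Summable fun n => ‖φ (PowerSeries.coeff n u) * (z ^ q ^ j) ^ n‖) :
    Summable fun n => ‖φ (PowerSeries.coeff n (mahlerIter hq0 j u)) * z ^ n‖ := by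
  have hinj : Function.Injective fun n : ℕ => q ^ j * n :=
    fun a b h => Nat.eq_of_mul_eq_mul_left (by positivity) h
  rw [← hinj.summable_iff]
  · refine hu.congr fun n => ?_
    simp [coeff_mahlerIter, pow_mul, Nat.mul_div_cancel_left _ (show 0 < q ^ j by positivity)]
  · intro n hn
    rw [coeff_mahlerIter, if_neg]
    · simp
    · rintro ⟨c, rfl⟩
      exact hn ⟨c, rfl⟩

theorem psValue_mahlerIter (hq0 : q ≠ 0) (j : ℕ) (u : PowerSeries K) (z : ℂ) :
    psValue φ (mahlerIter hq0 j u) z = psValue φ u (z ^ q ^ j) := by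
  have hinj : Function.Injective fun n : ℕ => q ^ j * n :=
    fun a b h => Nat.eq_of_mul_eq_mul_left (by positivity) h
  rw [psValue, psValue, ← hinj.tsum_eq]
  · refine tsum_congr fun n => ?_
    simp [coeff_mahlerIter, pow_mul, Nat.mul_div_cancel_left _ (show 0 < q ^ j by positivity)]
  · intro n hn
    by_contra hne
    refine hn ?_
    simp only
    rw [coeff_mahlerIter, if_neg]
    · simp
    · rintro ⟨c, rfl⟩
      exact hne ⟨c, rfl⟩

theorem mahlerIter_mem_convergentSubring (hq0 : q ≠ 0) (hρ0 : 0 ≤ ρ) (hρ1 : ρ ≤ 1) (j : ℕ)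
    (hu : u ∈ convergentSubring φ ρ) : mahlerIter hq0 j u ∈ convergentSubring φ ρ := by
  refine summable_norm_mahlerIter hq0 j (summable_norm_of_mem_convergentSubring hu ?_)
  rw [norm_pow, Complex.norm_real, Real.norm_of_nonneg hρ0]
  exact pow_le_of_le_one hρ0 hρ1 (by positivity)

/-- A convergent power series divisible by `X ^ p` is `O(z ^ p)`. -/
theorem exists_psValue_le (hρ : 0 < ρ) (hu : u ∈ convergentSubring φ ρ) {p : ℕ}
    (hp : (PowerSeries.X : PowerSeries K) ^ p ∣ u) :
    ∃ C : ℝ, 0 ≤ C ∧ ∀ z : ℂ, ‖z‖ ≤ ρ → ‖psValue φ u z‖ ≤ C * ‖z‖ ^ p := by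
  have hs := mem_convergentSubring.1 hu
  refine ⟨(∑' n, ‖φ (PowerSeries.coeff n u) * (ρ : ℂ) ^ n‖) / ρ ^ p,
    div_nonneg (tsum_nonneg fun _ => norm_nonneg _) (by positivity), fun z hz => ?_⟩
  rw [div_mul_eq_mul_div, mul_div_assoc, ← div_pow, psValue, ← tsum_mul_right]
  refine tsum_of_norm_bounded (hs.mul_right _).hasSum fun n => ?_
  rcases lt_or_ge n p with h | h
  · rw [PowerSeries.X_pow_dvd_iff.1 hp n h]
    simp
  · rw [norm_mul, norm_mul, norm_pow, norm_pow, Complex.norm_real, Real.norm_of_nonneg hρ.le,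
      mul_assoc]
    refine mul_le_mul_of_nonneg_left ?_ (norm_nonneg _)
    have h1 : (‖z‖ / ρ) ^ n ≤ (‖z‖ / ρ) ^ p :=
      pow_le_pow_of_le_one (by positivity) (by rwa [div_le_one hρ]) h
    calc ‖z‖ ^ n = ρ ^ n * (‖z‖ / ρ) ^ n := by
          rw [← mul_pow, mul_div_cancel₀ _ hρ.ne']
      _ ≤ _ := by gcongr

/-- A nonzero convergent power series is bounded below by a power of `z` near the origin. -/
theorem exists_le_psValue (hρ : 0 < ρ) (hu : u ∈ convergentSubring φ ρ) (hu0 : u ≠ 0) :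
    ∃ (c : ℝ) (s : ℕ) (ε : ℝ), 0 < c ∧ 0 < ε ∧
      ∀ z : ℂ, ‖z‖ ≤ ρ → ‖z‖ < ε → c * ‖z‖ ^ s ≤ ‖psValue φ u z‖ := by
  obtain ⟨s, hs, hlt⟩ : ∃ s, PowerSeries.coeff s u ≠ 0 ∧ ∀ n < s, PowerSeries.coeff n u = 0 := by
    classical
    have h : ∃ s, PowerSeries.coeff s u ≠ 0 := by
      by_contra! h
      exact hu0 (PowerSeries.ext (by simpa using h))
    exact ⟨Nat.find h, Nat.find_spec h, fun n hn => not_not.1 (Nat.find_min h hn)⟩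
  set a := PowerSeries.coeff s u with ha
  set m : PowerSeries K := ((Polynomial.monomial s a : Polynomial K) : PowerSeries K) with hm
  have hmm : m ∈ convergentSubring φ ρ := coe_mem_convergentSubring _
  have hdvd : (PowerSeries.X : PowerSeries K) ^ (s + 1) ∣ u - m := by
    refine PowerSeries.X_pow_dvd_iff.2 fun n hn => ?_
    rw [map_sub, hm, Polynomial.coeff_coe, Polynomial.coeff_monomial]
    split_ifs with h
    · rw [← h, sub_self]
    · rw [hlt n (by lia), sub_zero]
  obtain ⟨C, hC0, hC⟩ := exists_psValue_le hρ (sub_mem hu hmm) hdvd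
  have ha0 : 0 < ‖φ a‖ := by simpa using hs
  refine ⟨‖φ a‖ / 2, s, ‖φ a‖ / (2 * (C + 1)), by positivity, by positivity, fun z hz hzε => ?_⟩
  have h1 : psValue φ u z = psValue φ (u - m) z + φ a * z ^ s := by
    conv_lhs => rw [← sub_add_cancel u m]
    rw [psValue_add (sub_mem hu hmm) hmm hz, hm, psValue_coe, Polynomial.eval₂_monomial]
  have h2 : ‖φ a‖ * ‖z‖ ^ s ≤ ‖psValue φ u z‖ + C * ‖z‖ ^ (s + 1) := by
    rw [← norm_pow, ← norm_mul, show φ a * z ^ s = psValue φ u z - psValue φ (u - m) z by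
      rw [h1]; ring]
    exact (norm_sub_le _ _).trans (by gcongr; exact hC z hz)
  have h3 : C * ‖z‖ ≤ ‖φ a‖ / 2 := by
    rw [lt_div_iff₀ (by positivity)] at hzε
    nlinarith [norm_nonneg z]
  have h4 : C * ‖z‖ ^ (s + 1) ≤ ‖φ a‖ / 2 * ‖z‖ ^ s := by
    rw [pow_succ]
    nlinarith [pow_nonneg (norm_nonneg z) s]
  linarith

end ConvergentSeries

section AuxiliaryPolynomials

theorem exists_polynomials_X_pow_dvd {K ι ι' : Type*} [Field K] [Fintype ι] [Fintype ι']
    (u : ι → ι' → PowerSeries K) {δ N : ℕ}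
    (h : N * Fintype.card ι' < (δ + 1) * Fintype.card ι) :
    ∃ P : ι → Polynomial K, P ≠ 0 ∧ (∀ m, (P m).natDegree ≤ δ) ∧
      ∀ j, (PowerSeries.X : PowerSeries K) ^ N ∣ ∑ m, (P m : PowerSeries K) * u m j := by
  classical
  let L : (ι → Polynomial.degreeLT K (δ + 1)) →ₗ[K] (ι' → Fin N → K) :=
    { toFun := fun P j i => PowerSeries.coeff (i : ℕ)
        (∑ m, ((P m : Polynomial K) : PowerSeries K) * u m j)
      map_add' := fun P P' => by
        ext j i
        simp [add_mul, Finset.sum_add_distrib]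
      map_smul' := fun a P => by
        ext j i
        simp [Finset.mul_sum] }
  have hfin : Module.finrank K (Polynomial.degreeLT K (δ + 1)) = δ + 1 := by
    rw [(Polynomial.degreeLTEquiv K (δ + 1)).finrank_eq, Module.finrank_fin_fun]
  have : FiniteDimensional K (Polynomial.degreeLT K (δ + 1)) :=
    (Polynomial.degreeLTEquiv K (δ + 1)).symm.finiteDimensional
  have hker : LinearMap.ker L ≠ ⊥ := by
    refine LinearMap.ker_ne_bot_of_finrank_lt ?_
    have h1 : Module.finrank K (ι → Polynomial.degreeLT K (δ + 1)) =
        Fintype.card ι * (δ + 1) := by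
      rw [Module.finrank_pi_fintype, Finset.sum_congr rfl fun _ _ => hfin, Finset.sum_const,
        Finset.card_univ, smul_eq_mul]
    have h2 : Module.finrank K (ι' → Fin N → K) = Fintype.card ι' * N := by
      rw [Module.finrank_pi_fintype, Finset.sum_congr rfl fun _ _ => Module.finrank_fin_fun K,
        Finset.sum_const, Finset.card_univ, smul_eq_mul]
    rw [h1, h2]
    lia
  obtain ⟨P, hP, hP0⟩ := Submodule.exists_mem_ne_zero_of_ne_bot hker
  refine ⟨fun m => P m, fun h0 => hP0 ?_, fun m => ?_, fun j => ?_⟩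
  · ext1 m
    exact Subtype.ext (congrFun h0 m)
  · refine Polynomial.natDegree_le_iff_coeff_eq_zero.2 fun n hn => ?_
    exact Polynomial.coeff_eq_zero_of_degree_lt
      ((Polynomial.mem_degreeLT.1 (P m).2).trans_le (by exact_mod_cast hn))
  · exact PowerSeries.X_pow_dvd_iff.2 fun i hi => congrFun (congrFun hP j) ⟨i, hi⟩

/-- If the sequences `e m` depend linearly, with analytic coefficients, on few sequences `e' j`,
then they satisfy a linear relation with polynomial coefficients. -/
theorem exists_polynomial_relation_of_analytic {K ι ι' : Type*} [Field K] [NumberField K]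
    [Fintype ι] [Fintype ι'] {φ : K →+* ℂ} {q : ℕ} (hq : 2 ≤ q) {ρ : ℝ} (hρ0 : 0 < ρ) (hρ1 : ρ < 1)
    {β : K} (hβ0 : β ≠ 0) (hβρ : ‖φ β‖ ≤ ρ) {l : Filter ℕ} (hl : l ≤ Filter.atTop)
    {e : ι → ℕ → K} {e' : ι' → ℕ → K} {u₀ : PowerSeries K} (hu₀ : u₀ ∈ convergentSubring φ ρ)
    (hu₀0 : u₀ ≠ 0) {u : ι → ι' → PowerSeries K} (hu : ∀ m j, u m j ∈ convergentSubring φ ρ)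
    (hrel : ∀ m, ∀ᶠ k in l, psValue φ u₀ (φ β ^ q ^ k) * φ (e m k) =
      ∑ j, psValue φ (u m j) (φ β ^ q ^ k) * φ (e' j k))
    {B : ℕ} (hB : 0 < B) (he : ∀ m k, IsIntegral ℤ (((B ^ q ^ k : ℕ) : K) * e m k))
    (heψ : ∀ m k (ψ : K →+* ℂ), ‖ψ (e m k)‖ ≤ (B : ℝ) ^ q ^ k)
    (he' : ∀ j k, ‖φ (e' j k)‖ ≤ (B : ℝ) ^ q ^ k)
    {a : ℕ} (ha0 : 0 < a) (ha : IsIntegral ℤ ((a : K) * β)) (haψ : ∀ ψ : K →+* ℂ, ‖ψ β‖ ≤ a)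
    {N₀ : ℕ} (hN₀ : ((a : ℝ) * a) ^ Module.finrank ℚ K * ‖φ β‖ ^ N₀ ≤ 1 / 2)
    (hcard : N₀ * Fintype.card ι' < Fintype.card ι) :
    ∃ P : ι → Polynomial K, P ≠ 0 ∧ ∀ᶠ k in l, ∑ m, (P m).eval (β ^ q ^ k) * e m k = 0 := by
  classical
  set x := ‖φ β‖ with hx
  set D := Module.finrank ℚ K with hD
  have hx0 : 0 < x := by simpa [hx] using hβ0
  have hx1 : x < 1 := hβρ.trans_lt hρ1
  have hxk : ∀ k, ‖φ β ^ q ^ k‖ = x ^ q ^ k := fun k => norm_pow _ _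
  have hxρ : ∀ k, ‖φ β ^ q ^ k‖ ≤ ρ := fun k => by
    rw [hxk]
    exact (pow_le_of_le_one hx0.le hx1.le (by positivity)).trans hβρ
  obtain ⟨c₀, s₀, ε, hc₀, hε, hlow⟩ := exists_le_psValue hρ0 hu₀ hu₀0
  have hB1 : (1 : ℝ) ≤ B := by exact_mod_cast hB
  have ha1 : (1 : ℝ) ≤ a := by exact_mod_cast ha0
  obtain ⟨δ, hδ⟩ : ∃ δ : ℕ, (1 / 2 : ℝ) ^ δ * (B : ℝ) ^ (2 * D + 1) ≤ x ^ s₀ / 2 := by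
    obtain ⟨δ, hδ⟩ := exists_pow_lt_of_lt_one
      (show 0 < x ^ s₀ / 2 / (B : ℝ) ^ (2 * D + 1) by positivity) (show (1 / 2 : ℝ) < 1 by norm_num)
    exact ⟨δ, (le_div_iff₀ (by positivity)).1 hδ.le⟩
  have hcardι : 0 < Fintype.card ι := by lia
  obtain ⟨P, hP0, hPdeg, hPdvd⟩ := exists_polynomials_X_pow_dvd u (δ := δ) (N := N₀ * (δ + 1)) (by
    calc N₀ * (δ + 1) * Fintype.card ι' = (δ + 1) * (N₀ * Fintype.card ι') := by ring
      _ < _ := Nat.mul_lt_mul_of_pos_left hcard (Nat.succ_pos δ))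
  refine ⟨P, hP0, ?_⟩
  set S : ι' → PowerSeries K := fun j => ∑ m, (P m : PowerSeries K) * u m j with hS
  have hSmem : ∀ j, S j ∈ convergentSubring φ ρ := fun j =>
    sum_mem fun m _ => mul_mem (coe_mem_convergentSubring _) (hu m j)
  choose C hC0 hC using fun j => exists_psValue_le hρ0 (hSmem j) (hPdvd j)
  obtain ⟨c, hc, hcP⟩ := exists_size_bound_eval P hPdeg ha0 ha haψ
  set A : ℝ := (Fintype.card ι * (c : ℝ) ^ 2) ^ D * ∑ j, C j with hA
  have htend : Filter.Tendsto (fun k : ℕ => A * (1 / 2 : ℝ) ^ q ^ k) Filter.atTop (nhds 0) := by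
    rw [← mul_zero A]
    exact ((tendsto_pow_atTop_nhds_zero_of_lt_one (by norm_num) (by norm_num)).comp
      (tendsto_pow_atTop_atTop_of_one_lt hq)).const_mul A
  have htendx : Filter.Tendsto (fun k : ℕ => x ^ q ^ k) Filter.atTop (nhds 0) :=
    (tendsto_pow_atTop_nhds_zero_of_lt_one hx0.le hx1).comp
      (tendsto_pow_atTop_atTop_of_one_lt hq)
  filter_upwards [Filter.eventually_all.2 hrel, hl (htend.eventually_lt_const hc₀),
    hl (htendx.eventually_lt_const hε)] with k hk hkA hkε
  by_contra hξ
  set Q := q ^ k with hQ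
  set ξ := ∑ m, (P m).eval (β ^ Q) * e m k with hξdef
  have hint : IsIntegral ℤ (((c * a ^ (δ * Q) * B ^ Q : ℕ) : K) * ξ) := by
    rw [hξdef, Finset.mul_sum]
    refine IsIntegral.sum _ fun m _ => ?_
    convert (hcP m Q).1.mul (he m k) using 1
    push_cast
    ring
  have hconj : ∀ ψ : K →+* ℂ,
      ‖ψ ξ‖ ≤ Fintype.card ι * ((c * a ^ (δ * Q) : ℕ) * (B : ℝ) ^ Q) := by
    intro ψ
    rw [hξdef, map_sum]
    refine (norm_sum_le _ _).trans ((Finset.sum_le_card_nsmul _ _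
      ((c * a ^ (δ * Q) : ℕ) * (B : ℝ) ^ Q) fun m _ => ?_).trans (by simp))
    rw [map_mul, norm_mul]
    exact mul_le_mul ((hcP m Q).2 ψ) (heψ m k ψ) (norm_nonneg _) (by positivity)
  have hcard1 : (1 : ℝ) ≤ Fintype.card ι := by exact_mod_cast hcardι
  have hca : (1 : ℝ) ≤ (c * a ^ (δ * Q) : ℕ) := by
    exact_mod_cast Nat.one_le_iff_ne_zero.2 (by positivity)
  have hBQ : (1 : ℝ) ≤ (B : ℝ) ^ Q := one_le_pow₀ hB1
  have hliou := one_le_pow_mul_norm_of_isIntegral φ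
    (one_le_mul_of_one_le_of_one_le hcard1 (one_le_mul_of_one_le_of_one_le hca hBQ))
    hξ hint (by positivity) hconj
  have hev : psValue φ u₀ (φ β ^ Q) * φ ξ = ∑ j, psValue φ (S j) (φ β ^ Q) * φ (e' j k) := by
    have h1 : ∀ j, psValue φ (S j) (φ β ^ Q) =
        ∑ m, φ ((P m).eval (β ^ Q)) * psValue φ (u m j) (φ β ^ Q) := by
      intro j
      have := map_sum (convEval φ (hxρ k))
        (fun m => (⟨_, mul_mem (coe_mem_convergentSubring (P m)) (hu m j)⟩ :
          convergentSubring φ ρ)) Finset.univ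
      simp only [convEval_apply, AddSubmonoidClass.coe_finsetSum] at this
      rw [hS, this]
      refine Finset.sum_congr rfl fun m _ => ?_
      rw [psValue_mul (coe_mem_convergentSubring _) (hu m j) (hxρ k), ← map_pow, psValue_coe_map]
    simp_rw [h1, hξdef, map_sum, map_mul, Finset.mul_sum, Finset.sum_mul]
    rw [Finset.sum_comm]
    refine Finset.sum_congr rfl fun m _ => ?_
    rw [mul_left_comm, hk m, Finset.mul_sum]
    exact Finset.sum_congr rfl fun j _ => by ring
  have hup : c₀ * (x ^ Q) ^ s₀ * ‖φ ξ‖ ≤ (∑ j, C j) * (x ^ Q) ^ (N₀ * (δ + 1)) * (B : ℝ) ^ Q := by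
    calc c₀ * (x ^ Q) ^ s₀ * ‖φ ξ‖ ≤ ‖psValue φ u₀ (φ β ^ Q)‖ * ‖φ ξ‖ := by
          gcongr
          rw [← hxk k]
          exact hlow _ (hxρ k) (by rwa [hxk])
      _ = ‖∑ j, psValue φ (S j) (φ β ^ Q) * φ (e' j k)‖ := by rw [← norm_mul, hev]
      _ ≤ ∑ j, C j * (x ^ Q) ^ (N₀ * (δ + 1)) * (B : ℝ) ^ Q := by
          refine (norm_sum_le _ _).trans (Finset.sum_le_sum fun j _ => ?_)
          rw [norm_mul, ← hxk k]
          exact mul_le_mul (hC j _ (hxρ k)) (he' j k) (norm_nonneg _)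
            (mul_nonneg (hC0 j) (by positivity))
      _ = _ := by rw [Finset.sum_mul, Finset.sum_mul]
  have hsumC : 0 ≤ ∑ j, C j := Finset.sum_nonneg fun j _ => hC0 j
  have hkey : c₀ * (x ^ s₀) ^ Q ≤
      A * ((((a : ℝ) * a) ^ D * x ^ N₀) ^ δ * x ^ N₀ * (B : ℝ) ^ (2 * D + 1)) ^ Q := by
    calc c₀ * (x ^ s₀) ^ Q = c₀ * (x ^ Q) ^ s₀ * 1 := by
          rw [mul_one, ← pow_mul, ← pow_mul, mul_comm s₀]
      _ ≤ c₀ * (x ^ Q) ^ s₀ * _ := mul_le_mul_of_nonneg_left hliou (by positivity)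
      _ = (((c * a ^ (δ * Q) * B ^ Q : ℕ) : ℝ) *
            (Fintype.card ι * ((c * a ^ (δ * Q) : ℕ) * (B : ℝ) ^ Q))) ^ D *
            (c₀ * (x ^ Q) ^ s₀ * ‖φ ξ‖) := by ring
      _ ≤ _ * ((∑ j, C j) * (x ^ Q) ^ (N₀ * (δ + 1)) * (B : ℝ) ^ Q) :=
          mul_le_mul_of_nonneg_left hup (by positivity)
      _ = _ := by
          rw [hA]
          push_cast
          ring
  have hS1 : (((a : ℝ) * a) ^ D * x ^ N₀) ^ δ * x ^ N₀ * (B : ℝ) ^ (2 * D + 1) ≤ x ^ s₀ / 2 := by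
    refine le_trans ?_ hδ
    have h1 : (((a : ℝ) * a) ^ D * x ^ N₀) ^ δ * x ^ N₀ ≤ (1 / 2) ^ δ := by
      refine (mul_le_of_le_one_right (by positivity) (pow_le_one₀ hx0.le hx1.le)).trans ?_
      gcongr
    gcongr
  have hA0 : 0 ≤ A := by positivity
  have hfin : c₀ * (x ^ s₀) ^ Q ≤ A * (1 / 2) ^ Q * (x ^ s₀) ^ Q := by
    refine hkey.trans ((mul_le_mul_of_nonneg_left
      (pow_le_pow_left₀ (by positivity) hS1 Q) hA0).trans_eq ?_)
    rw [div_pow, one_div, inv_pow]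
    ring
  have := le_of_mul_le_mul_right hfin (by positivity)
  linarith

end AuxiliaryPolynomials

section GermField

/-- The field of germs at infinity, along a nonprincipal ultrafilter, of complex sequences. -/
abbrev SeqGerm : Type := Filter.Germ (Filter.hyperfilter ℕ : Filter ℕ) ℂ

variable {K : Type*} [Field K]

/-- Evaluation of convergent power series along a sequence of points. -/
def convGerm (φ : K →+* ℂ) {ρ : ℝ} {z : ℕ → ℂ} (hz : ∀ k, ‖z k‖ ≤ ρ) :
    convergentSubring φ ρ →+* SeqGerm :=
  (Filter.Germ.coeRingHom _).comp (RingHom.pi fun k => convEval φ (hz k))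

theorem convGerm_apply {φ : K →+* ℂ} {ρ : ℝ} {z : ℕ → ℂ} (hz : ∀ k, ‖z k‖ ≤ ρ)
    (u : convergentSubring φ ρ) :
    convGerm φ hz u = ((fun k => psValue φ u (z k) : ℕ → ℂ) : SeqGerm) := rfl

theorem convGerm_injective {φ : K →+* ℂ} {ρ : ℝ} (hρ : 0 < ρ) {z : ℕ → ℂ} (hz : ∀ k, ‖z k‖ ≤ ρ)
    (hz0 : ∀ k, z k ≠ 0) (hlim : Filter.Tendsto z Filter.atTop (nhds 0)) :
    Function.Injective (convGerm φ hz) := by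
  refine (injective_iff_map_eq_zero _).2 fun u hu => ?_
  by_contra hne
  obtain ⟨c, s, ε, hc, hε, h⟩ := exists_le_psValue hρ u.2 fun h0 => hne (Subtype.ext h0)
  have h1 : ∀ᶠ k in (Filter.hyperfilter ℕ : Filter ℕ), psValue φ u (z k) = 0 :=
    Filter.Germ.coe_eq.1 hu
  have h2 : ∀ᶠ k in (Filter.hyperfilter ℕ : Filter ℕ), ‖z k‖ < ε :=
    Nat.hyperfilter_le_atTop ((tendsto_zero_iff_norm_tendsto_zero.1 hlim).eventually_lt_const hε)
  obtain ⟨k, hk1, hk2⟩ := (h1.and h2).exists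
  have := h (z k) (hz k) hk2
  rw [hk1, norm_zero] at this
  exact absurd this (not_le.2 (mul_pos hc (pow_pos (norm_pos_iff.2 (hz0 k)) s)))

theorem sum_germ_coe {ι α : Type*} {l : Filter α} (s : Finset ι) (f : ι → α → ℂ) :
    ∑ i ∈ s, ((f i : α → ℂ) : l.Germ ℂ) = ((fun k => ∑ i ∈ s, f i k : α → ℂ) : l.Germ ℂ) := by
  have := map_sum (Filter.Germ.coeRingHom (R := ℂ) l) f s
  rw [show (fun k => ∑ i ∈ s, f i k) = ∑ i ∈ s, f i by ext; simp]
  exact this.symm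

theorem prod_germ_coe {ι α : Type*} {l : Filter α} (s : Finset ι) (f : ι → α → ℂ) :
    ∏ i ∈ s, ((f i : α → ℂ) : l.Germ ℂ) = ((fun k => ∏ i ∈ s, f i k : α → ℂ) : l.Germ ℂ) := by
  have := map_prod (Filter.Germ.coeRingHom (R := ℂ) l) f s
  rw [show (fun k => ∏ i ∈ s, f i k) = ∏ i ∈ s, f i by ext; simp]
  exact this.symm

/-- Comparison of the ranks over rational functions and over analytic functions of the monomials of
degree `d` in sequences of algebraic numbers of moderate growth. -/
theorem finrank_span_pow_le_of_growth [NumberField K] {φ : K →+* ℂ} {q : ℕ} (hq : 2 ≤ q)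
    {ρ : ℝ} (hρ0 : 0 < ρ) (hρ1 : ρ < 1) {β : K} (hβ0 : β ≠ 0) (hβρ : ‖φ β‖ ≤ ρ)
    (hz : ∀ k, ‖φ β ^ q ^ k‖ ≤ ρ) {n : ℕ} {lam : ℕ → Fin n → K}
    {B : ℕ} (hB : 0 < B) (hint : ∀ k i, IsIntegral ℤ (((B ^ q ^ k : ℕ) : K) * lam k i))
    (hψ : ∀ k i (ψ : K →+* ℂ), ‖ψ (lam k i)‖ ≤ (B : ℝ) ^ q ^ k)
    {a : ℕ} (ha0 : 0 < a) (ha : IsIntegral ℤ ((a : K) * β)) (haψ : ∀ ψ : K →+* ℂ, ‖ψ β‖ ≤ a)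
    {N₀ : ℕ} (hN₀ : ((a : ℝ) * a) ^ Module.finrank ℚ K * ‖φ β‖ ^ N₀ ≤ 1 / 2)
    {k C : Type*} [Field k] [Algebra (Polynomial K) k] [IsFractionRing (Polynomial K) k]
    [Field C] [Algebra (convergentSubring φ ρ) C] [IsFractionRing (convergentSubring φ ρ) C]
    [Algebra C SeqGerm] [Algebra k SeqGerm]
    (hC : ∀ u, algebraMap C SeqGerm (algebraMap (convergentSubring φ ρ) C u) = convGerm φ hz u)
    (hk : ∀ p : Polynomial K, algebraMap k SeqGerm (algebraMap (Polynomial K) k p) =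
      convGerm φ hz ⟨p, coe_mem_convergentSubring p⟩)
    {y : Fin n → SeqGerm} (hy : ∀ i, y i = ((fun m => φ (lam m i) : ℕ → ℂ) : SeqGerm)) (d : ℕ) :
    Module.finrank k ↥(Submodule.span k (Set.range y ^ d)) ≤
      N₀ * Module.finrank C ↥(Submodule.span C (Set.range y ^ d)) := by
  classical
  have hfinite : (Set.range y ^ d).Finite := finite_set_pow (Set.finite_range y) d
  obtain ⟨b, hbM, hbspan, hbind⟩ := exists_linearIndependent k (Set.range y ^ d)
  obtain ⟨b', hbM', hbspan', hbind'⟩ := exists_linearIndependent C (Set.range y ^ d)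
  have : Fintype b := (hfinite.subset hbM).fintype
  have : Fintype b' := (hfinite.subset hbM').fintype
  rw [← hbspan, ← hbspan', finrank_span_set_eq_card hbind, finrank_span_set_eq_card hbind',
    Set.toFinset_card, Set.toFinset_card]
  by_contra! hcard
  have hmon : ∀ m ∈ Set.range y ^ d, ∃ ex : Fin n → ℕ, ∑ i, ex i = d ∧
      m = ((fun t => φ (∏ i, lam t i ^ ex i) : ℕ → ℂ) : SeqGerm) := by
    intro m hm
    obtain ⟨ex, hex, rfl⟩ := exists_exponents_of_mem_range_pow y d hm
    refine ⟨ex, hex, ?_⟩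
    simp only [hy, map_prod, map_pow]
    rw [← prod_germ_coe]
    rfl
  have hexint : ∀ (ex : Fin n → ℕ), ∑ i, ex i = d → ∀ t,
      IsIntegral ℤ ((((B ^ d) ^ q ^ t : ℕ) : K) * ∏ i, lam t i ^ ex i) := by
    intro ex hex t
    rw [show (((B ^ d) ^ q ^ t : ℕ) : K) * ∏ i, lam t i ^ ex i =
      ∏ i, (((B ^ q ^ t : ℕ) : K) * lam t i) ^ ex i by
        simp_rw [mul_pow, Finset.prod_mul_distrib, Finset.prod_pow_eq_pow_sum, hex]
        push_cast
        ring]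
    exact IsIntegral.prod _ fun i _ => (hint t i).pow _
  have hexψ : ∀ (ex : Fin n → ℕ), ∑ i, ex i = d → ∀ t (ψ : K →+* ℂ),
      ‖ψ (∏ i, lam t i ^ ex i)‖ ≤ ((B ^ d : ℕ) : ℝ) ^ q ^ t := by
    intro ex hex t ψ
    rw [map_prod, norm_prod]
    calc ∏ i, ‖ψ (lam t i ^ ex i)‖ ≤ ∏ i, ((B : ℝ) ^ q ^ t) ^ ex i := by
          refine Finset.prod_le_prod (fun _ _ => norm_nonneg _) fun i _ => ?_
          rw [map_pow, norm_pow]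
          exact pow_le_pow_left₀ (norm_nonneg _) (hψ t i ψ) _
      _ = _ := by
          rw [Finset.prod_pow_eq_pow_sum, hex]
          push_cast
          ring
  choose ex hex hexm using fun m : b => hmon m (hbM m.2)
  choose ex' hex' hexm' using fun m : b' => hmon m (hbM' m.2)
  have hcoef : ∀ m : b, ∃ c : b' → C, ∑ j, c j • (j : SeqGerm) = m := fun m =>
    (Submodule.mem_span_range_iff_exists_fun C).1 (by
      rw [Subtype.range_coe, hbspan']
      exact Submodule.subset_span (hbM m.2))
  choose c hc using hcoef
  obtain ⟨⟨u₀, hu₀⟩, hu⟩ := IsLocalization.exist_integer_multiples_of_finite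
    (nonZeroDivisors (convergentSubring φ ρ)) (fun p : b × b' => c p.1 p.2)
  choose u hu using hu
  have hrel : ∀ m : b, ∀ᶠ t in (Filter.hyperfilter ℕ : Filter ℕ),
      psValue φ u₀ (φ β ^ q ^ t) * φ (∏ i, lam t i ^ ex m i) =
      ∑ j, psValue φ (u (m, j)) (φ β ^ q ^ t) * φ (∏ i, lam t i ^ ex' j i) := by
    intro m
    refine Filter.Germ.coe_eq.1 ?_
    rw [← sum_germ_coe]
    have h1 : convGerm φ hz u₀ * (m : SeqGerm) =
        ∑ j, convGerm φ hz (u (m, j)) * (j : SeqGerm) := by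
      rw [← hc m, Finset.mul_sum]
      refine Finset.sum_congr rfl fun j _ => ?_
      have h2 := hu (m, j)
      rw [← hC, ← hC, h2, Algebra.smul_def, Algebra.smul_def, map_mul, mul_assoc]
    rw [hexm m] at h1
    refine Eq.trans h1 (Finset.sum_congr rfl fun j _ => ?_)
    rw [hexm' j]
    rfl
  obtain ⟨P, hP0, hP⟩ := exists_polynomial_relation_of_analytic hq hρ0 hρ1 hβ0 hβρ
    Nat.hyperfilter_le_atTop u₀.2
    (fun h0 => nonZeroDivisors.ne_zero hu₀ (Subtype.ext h0)) (fun m j => (u (m, j)).2) hrel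
    (pow_pos hB d) (fun m t => hexint _ (hex m) t) (fun m t ψ => hexψ _ (hex m) t ψ)
    (fun j t => hexψ _ (hex' j) t φ) ha0 ha haψ hN₀ hcard
  refine hP0 (funext fun m => IsFractionRing.injective (Polynomial K) k ?_)
  rw [Pi.zero_apply, map_zero]
  refine Fintype.linearIndependent_iff.1 hbind (fun m => algebraMap (Polynomial K) k (P m)) ?_ m
  have h0 : ((fun t => φ (∑ m, (P m).eval (β ^ q ^ t) * ∏ i, lam t i ^ ex m i) : ℕ → ℂ) :
      SeqGerm) = 0 := Filter.Germ.coe_eq.2 (by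
    filter_upwards [hP] with t ht
    rw [ht, map_zero])
  rw [← h0]
  simp_rw [map_sum]
  rw [← sum_germ_coe]
  refine Finset.sum_congr rfl fun m _ => ?_
  rw [Algebra.smul_def, hk, hexm m, convGerm_apply]
  refine (Filter.Germ.coe_mul _ _).symm.trans (congrArg _ ?_)
  ext t
  simp [← psValue_coe_map (φ := φ)]

end GermField

section IteratedRelations

variable {K : Type*} [Field K]

/-- `SizeLE x c` : the natural number `c` is a denominator of `x` and bounds its conjugates. -/
def SizeLE (x : K) (c : ℕ) : Prop :=
  IsIntegral ℤ ((c : K) * x) ∧ ∀ ψ : K →+* ℂ, ‖ψ x‖ ≤ c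

theorem SizeLE.mul {x y : K} {c c' : ℕ} (hx : SizeLE x c) (hy : SizeLE y c') :
    SizeLE (x * y) (c * c') := by
  refine ⟨?_, fun ψ => ?_⟩
  · rw [Nat.cast_mul, mul_mul_mul_comm]
    exact hx.1.mul hy.1
  · rw [map_mul, norm_mul, Nat.cast_mul]
    exact mul_le_mul (hx.2 ψ) (hy.2 ψ) (norm_nonneg _) (Nat.cast_nonneg _)

theorem SizeLE.sub {x y : K} {c : ℕ} (hx : SizeLE x c) (hy : SizeLE y c) :
    SizeLE (x - y) (2 * c) := by
  refine ⟨?_, fun ψ => ?_⟩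
  · rw [Nat.cast_mul, mul_assoc]
    refine isIntegral_natCast_mul ?_
    rw [mul_sub]
    exact hx.1.sub hy.1
  · rw [map_sub, Nat.cast_mul, Nat.cast_two, two_mul]
    exact (norm_sub_le _ _).trans (add_le_add (hx.2 ψ) (hy.2 ψ))

theorem SizeLE.of_dvd {x : K} {c c' : ℕ} (hx : SizeLE x c) (h : c ∣ c') (hc' : c' ≠ 0) :
    SizeLE x c' := by
  refine ⟨?_, fun ψ => (hx.2 ψ).trans (by exact_mod_cast Nat.le_of_dvd (Nat.pos_of_ne_zero hc') h)⟩
  obtain ⟨e, rfl⟩ := h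
  rw [mul_comm c, Nat.cast_mul, mul_assoc]
  exact isIntegral_natCast_mul hx.1

/-- The coefficients of the linear relations obtained by eliminating the first value from a linear
relation with the help of a functional equation with coefficients `P k`. -/
def iterRelation (n : ℕ) (P : ℕ → ℕ → K) (lam : ℕ → K) : ℕ → ℕ → K
  | 0 => lam
  | k + 1 => fun j => if j < n then P k 0 * iterRelation n P lam k (j + 1) -
      iterRelation n P lam k 0 * P k (j + 1) else 0

variable {n : ℕ} {P : ℕ → ℕ → K} {lam : ℕ → K}

theorem iterRelation_succ (k j : ℕ) : iterRelation n P lam (k + 1) j =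
    if j < n then P k 0 * iterRelation n P lam k (j + 1) -
      iterRelation n P lam k 0 * P k (j + 1) else 0 := rfl

theorem iterRelation_eq_zero (hlam : ∀ j, n ≤ j → lam j = 0) (k : ℕ) {j : ℕ} (hj : n ≤ j) :
    iterRelation n P lam k j = 0 := by
  cases k with
  | zero => exact hlam j hj
  | succ k => rw [iterRelation_succ, if_neg (by lia)]

theorem iterRelation_ne_zero (hn : 0 < n) (hlam : ∀ j, n ≤ j → lam j = 0)
    (hP0 : ∀ k, P k 0 ≠ 0) (hPn : ∀ k, P k n ≠ 0) (h0 : ∃ j < n, lam j ≠ 0) (k : ℕ) :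
    ∃ j < n, iterRelation n P lam k j ≠ 0 := by
  induction k with
  | zero => exact h0
  | succ k ih =>
    by_contra! h
    have hstep : ∀ j < n, P k 0 * iterRelation n P lam k (j + 1) -
        iterRelation n P lam k 0 * P k (j + 1) = 0 := fun j hj => by
      have := h j hj
      rwa [iterRelation_succ, if_pos hj] at this
    have hz : iterRelation n P lam k 0 = 0 := by
      have := hstep (n - 1) (by lia)
      rw [Nat.sub_add_cancel hn, iterRelation_eq_zero hlam k le_rfl, mul_zero, zero_sub,
        neg_eq_zero] at this
      exact (mul_eq_zero.1 this).resolve_right (hPn k)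
    obtain ⟨j, hj, hne⟩ := ih
    cases j with
    | zero => exact hne hz
    | succ j =>
      have := hstep j (by lia)
      rw [hz, zero_mul, sub_zero] at this
      exact hne ((mul_eq_zero.1 this).resolve_left (hP0 k))

theorem sum_iterRelation_eq_zero (φ : K →+* ℂ) (hlam : ∀ j, n ≤ j → lam j = 0) {v : ℕ → ℂ}
    (hv : ∀ k, ∑ j ∈ Finset.range (n + 1), φ (P k j) * v (k + j) = 0)
    (h0 : ∑ j ∈ Finset.range n, φ (lam j) * v j = 0) (k : ℕ) :
    ∑ j ∈ Finset.range n, φ (iterRelation n P lam k j) * v (k + j) = 0 := by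
  induction k with
  | zero => simpa [iterRelation] using h0
  | succ k ih =>
    have h1 : ∑ j ∈ Finset.range (n + 1), φ (iterRelation n P lam k j) * v (k + j) = 0 := by
      rw [Finset.sum_range_succ, ih, iterRelation_eq_zero hlam k le_rfl]
      simp
    rw [Finset.sum_range_succ'] at h1
    have h2 := hv k
    rw [Finset.sum_range_succ'] at h2
    calc _ = φ (P k 0) * ∑ j ∈ Finset.range n,
            φ (iterRelation n P lam k (j + 1)) * v (k + (j + 1)) -
          φ (iterRelation n P lam k 0) * ∑ j ∈ Finset.range n,
            φ (P k (j + 1)) * v (k + (j + 1)) := by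
          rw [Finset.mul_sum, Finset.mul_sum, ← Finset.sum_sub_distrib]
          refine Finset.sum_congr rfl fun j hj => ?_
          rw [iterRelation_succ, if_pos (Finset.mem_range.1 hj), map_sub, map_mul, map_mul,
            show k + 1 + j = k + (j + 1) by ring]
          ring
      _ = 0 := by
          rw [eq_neg_of_add_eq_zero_left h1, eq_neg_of_add_eq_zero_left h2]
          ring

theorem sizeLE_iterRelation {q : ℕ} (hq : 2 ≤ q) {M : ℕ} (hM : 0 < M)
    (hlam : ∀ j, SizeLE (lam j) M) (hP : ∀ k, ∀ j ≤ n, SizeLE (P k j) (M ^ q ^ k)) (k j : ℕ) :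
    SizeLE (iterRelation n P lam k j) ((2 * M) ^ q ^ k) := by
  induction k generalizing j with
  | zero => exact (hlam j).of_dvd (by simp) (by positivity)
  | succ k ih =>
    rw [iterRelation_succ]
    split_ifs with hj
    · have h1 := (((hP k 0 (by lia)).mul (ih (j + 1))).sub
        (by simpa [mul_comm] using (hP k (j + 1) (by lia)).mul (ih 0)))
      refine h1.of_dvd ?_ (by positivity)
      have hq1 : q ^ k ≠ 0 := by positivity
      calc 2 * (M ^ q ^ k * (2 * M) ^ q ^ k) ∣ 2 ^ q ^ k * (M ^ q ^ k * (2 * M) ^ q ^ k) :=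
            Nat.mul_dvd_mul (dvd_pow_self 2 hq1) dvd_rfl
        _ = (2 * M) ^ (2 * q ^ k) := by ring
        _ ∣ (2 * M) ^ q ^ (k + 1) := pow_dvd_pow _ (by
            rw [pow_succ, mul_comm]; exact Nat.mul_le_mul_left _ hq)
    · exact ⟨by simpa using isIntegral_zero, fun ψ => by simp⟩

end IteratedRelations

section LinearIndependenceOfValues

variable {K : Type*} [Field K] [NumberField K]

/-- Linear relations among the values of convergent power series along `β ^ q ^ k`, whose
coefficients have moderate growth, come from a relation with algebraic coefficients. -/
theorem exists_isAlgebraic_relation_of_growth {φ : K →+* ℂ} {q : ℕ} (hq : 2 ≤ q)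
    {ρ : ℝ} (hρ0 : 0 < ρ) (hρ1 : ρ < 1) {β : K} (hβ0 : β ≠ 0) (hβρ : ‖φ β‖ ≤ ρ)
    {n : ℕ} {f : Fin n → PowerSeries K} (hf : ∀ i, f i ∈ convergentSubring φ ρ)
    {lam : ℕ → Fin n → K} (hlam0 : ∀ k, lam k ≠ 0)
    (hlam : ∀ k, ∑ i, psValue φ (f i) (φ β ^ q ^ k) * φ (lam k i) = 0)
    {B : ℕ} (hB : 0 < B) (hsize : ∀ k i, SizeLE (lam k i) (B ^ q ^ k)) :
    ∃ w : Fin n → FractionRing (PowerSeries ℂ), w ≠ 0 ∧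
      (∀ i, IsAlgebraic (Polynomial ℂ) (w i)) ∧
      ∑ i, w i * algebraMap _ (FractionRing (PowerSeries ℂ)) (PowerSeries.map φ (f i)) = 0 := by
  classical
  have hx0 : 0 < ‖φ β‖ := by simpa using hβ0
  have hx1 : ‖φ β‖ < 1 := hβρ.trans_lt hρ1
  have hz : ∀ k, ‖φ β ^ q ^ k‖ ≤ ρ := fun k => by
    rw [norm_pow]
    exact (pow_le_of_le_one hx0.le hx1.le (by positivity)).trans hβρ
  obtain ⟨a, ha0, ha, haψ⟩ := exists_nat_size_bound β
  obtain ⟨N₀, hN₀⟩ : ∃ N₀ : ℕ, ((a : ℝ) * a) ^ Module.finrank ℚ K * ‖φ β‖ ^ N₀ ≤ 1 / 2 := by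
    have ha' : (0 : ℝ) < a := by exact_mod_cast ha0
    obtain ⟨N, hN⟩ := exists_pow_lt_of_lt_one
      (show 0 < 1 / 2 / ((a : ℝ) * a) ^ Module.finrank ℚ K by positivity) hx1
    exact ⟨N, by rw [mul_comm]; exact (le_div_iff₀ (by positivity)).1 hN.le⟩
  let polyHom : Polynomial K →+* convergentSubring φ ρ :=
    (Polynomial.coeToPowerSeries.ringHom : Polynomial K →+* PowerSeries K).codRestrict
      (convergentSubring φ ρ) fun p => coe_mem_convergentSubring p
  have hpoly : Function.Injective polyHom := fun p p' h =>
    Polynomial.coe_injective K (congrArg Subtype.val h)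
  have hlim : Filter.Tendsto (fun k => φ β ^ q ^ k) Filter.atTop (nhds 0) :=
    (tendsto_pow_atTop_nhds_zero_of_norm_lt_one hx1).comp (tendsto_pow_atTop_atTop_of_one_lt hq)
  have hgerm : Function.Injective (convGerm φ hz) :=
    convGerm_injective hρ0 hz (fun k => pow_ne_zero _ (by simpa using hβ0)) hlim
  let C := FractionRing (convergentSubring φ ρ)
  let k := FractionRing (Polynomial K)
  have hpolyC : Function.Injective
      ((algebraMap (convergentSubring φ ρ) C).comp polyHom) :=
    (IsFractionRing.injective _ C).comp hpoly
  let _ : Algebra (Polynomial K) C :=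
    ((algebraMap (convergentSubring φ ρ) C).comp polyHom).toAlgebra
  let _ : Algebra k C := (IsFractionRing.lift hpolyC).toAlgebra
  let _ : Algebra C SeqGerm := (IsFractionRing.lift hgerm).toAlgebra
  let _ : Algebra k SeqGerm := ((algebraMap C SeqGerm).comp (algebraMap k C)).toAlgebra
  have : IsScalarTower k C SeqGerm := IsScalarTower.of_algebraMap_eq' rfl
  have : IsScalarTower (Polynomial K) k C := IsScalarTower.of_algebraMap_eq fun p =>
    (IsFractionRing.lift_algebraMap hpolyC p).symm
  have : CharZero C := charZero_of_injective_ringHom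
    (((algebraMap (convergentSubring φ ρ) C).comp polyHom).comp Polynomial.C).injective
  have hC : ∀ u, algebraMap C SeqGerm (algebraMap (convergentSubring φ ρ) C u) =
      convGerm φ hz u := fun u => IsFractionRing.lift_algebraMap hgerm u
  have hk : ∀ p : Polynomial K, algebraMap k SeqGerm (algebraMap (Polynomial K) k p) =
      convGerm φ hz ⟨p, coe_mem_convergentSubring p⟩ := fun p => by
    have h1 : algebraMap k C (algebraMap (Polynomial K) k p) =
        algebraMap (convergentSubring φ ρ) C (polyHom p) := IsFractionRing.lift_algebraMap hpolyC p
    rw [IsScalarTower.algebraMap_apply k C SeqGerm, h1, hC]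
    rfl
  let y : Fin n → SeqGerm := fun i => ((fun m => φ (lam m i) : ℕ → ℂ) : SeqGerm)
  have hy0 : y ≠ 0 := fun h0 => by
    have h1 : ∀ᶠ m in (Filter.hyperfilter ℕ : Filter ℕ), ∀ i, φ (lam m i) = 0 :=
      Filter.eventually_all.2 fun i => Filter.Germ.coe_eq.1 (congrFun h0 i)
    obtain ⟨m, hm⟩ := h1.exists
    exact hlam0 m (funext fun i => by simpa using hm i)
  have hrel : ∑ i, algebraMap (convergentSubring φ ρ) C ⟨f i, hf i⟩ • y i = 0 := by
    simp_rw [Algebra.smul_def, hC, convGerm_apply]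
    have h1 : ((fun m => ∑ i, psValue φ (f i) (φ β ^ q ^ m) * φ (lam m i) : ℕ → ℂ) : SeqGerm) = 0 :=
      Filter.Germ.coe_eq.2 (Filter.Eventually.of_forall hlam)
    rw [← h1, ← sum_germ_coe]
    rfl
  obtain ⟨w, hw0, hwalg, hw⟩ := exists_algebraic_relation_of_finrank_le (k := k) (C := C) y hy0 N₀
    (finrank_span_pow_le_of_growth hq hρ0 hρ1 hβ0 hβρ hz hB (fun k i => (hsize k i).1)
      (fun k i ψ => by simpa using (hsize k i).2 ψ) ha0 ha haψ hN₀ hC hk (fun i => rfl)) _ hrel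
  let toL : convergentSubring φ ρ →+* FractionRing (PowerSeries ℂ) :=
    ((algebraMap (PowerSeries ℂ) (FractionRing (PowerSeries ℂ))).comp (PowerSeries.map φ)).comp
      (convergentSubring φ ρ).subtype
  have htoL : Function.Injective toL := by
    refine ((IsFractionRing.injective (PowerSeries ℂ) (FractionRing (PowerSeries ℂ))).comp
      (?_ : Function.Injective (PowerSeries.map φ))).comp Subtype.val_injective
    intro u v h
    ext m
    refine φ.injective ?_
    simpa using congrArg (PowerSeries.coeff m) h
  let j : C →+* FractionRing (PowerSeries ℂ) := IsFractionRing.lift htoL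
  have hj : ∀ u, j (algebraMap (convergentSubring φ ρ) C u) = toL u := fun u =>
    IsFractionRing.lift_algebraMap htoL u
  refine ⟨fun i => j (w i), fun h0 => hw0 (funext fun i => ?_), fun i => ?_, ?_⟩
  · exact (map_eq_zero j).1 (congrFun h0 i)
  · have halg : IsAlgebraic (Polynomial K) (w i) :=
      (IsFractionRing.isAlgebraic_iff (Polynomial K) k C).2 (hwalg i)
    refine halg.ringHom_of_comp_eq (Polynomial.mapRingHom φ) j
      (Polynomial.map_injective φ φ.injective) ?_
    refine RingHom.ext fun p => ?_
    have h1 : j (algebraMap (Polynomial K) C p) = toL (polyHom p) := hj _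
    refine Eq.trans ?_ h1.symm
    rw [RingHom.comp_apply, ← algebraMap_coe_polynomial]
    change _ = algebraMap _ _ (PowerSeries.map φ (p : PowerSeries K))
    congr 1
    ext m
    simp
  · have h1 := congrArg j hw
    rw [map_sum, map_zero] at h1
    rw [← h1]
    refine Finset.sum_congr rfl fun i _ => ?_
    rw [map_mul, hj, mul_comm]
    rfl

/-- The values of a Mahler function and of its iterates at a regular algebraic point are linearly
independent when the functions are. -/
theorem eq_zero_of_sum_mahler_values_eq_zero {φ : K →+* ℂ} {q n : ℕ} (hq : 2 ≤ q) (hq0 : q ≠ 0)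
    {ρ : ℝ} (hρ0 : 0 < ρ) (hρ1 : ρ < 1) {β : K} (hβ0 : β ≠ 0) (hβρ : ‖φ β‖ ≤ ρ)
    {g : PowerSeries K} (hg : g ∈ convergentSubring φ ρ) {p : ℕ → Polynomial K} (hn : 0 < n)
    (hrel : ∑ j ∈ Finset.range (n + 1), (p j : PowerSeries K) * mahlerIter hq0 j g = 0)
    (hp0 : ∀ k, (p 0).eval (β ^ q ^ k) ≠ 0) (hpn : ∀ k, (p n).eval (β ^ q ^ k) ≠ 0)
    (hind : ∀ c : Fin n → Polynomial ℂ,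
      ∑ i, (c i : PowerSeries ℂ) * mahlerIter hq0 i (PowerSeries.map φ g) = 0 → c = 0)
    {lam : ℕ → K} (hlam : ∑ i ∈ Finset.range n, φ (lam i) * psValue φ g (φ β ^ q ^ i) = 0)
    {i : ℕ} (hi : i < n) : lam i = 0 := by
  classical
  by_contra hne
  wlog hsupp : ∀ j, n ≤ j → lam j = 0 generalizing lam
  · refine this (lam := fun j => if j < n then lam j else 0) ?_ (by simpa [hi] using hne)
      fun j hj => if_neg (not_lt.2 hj)
    rw [← hlam]
    refine Finset.sum_congr rfl fun j hj => ?_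
    rw [if_pos (Finset.mem_range.1 hj)]
  have hx1 : ‖φ β‖ < 1 := hβρ.trans_lt hρ1
  have hz : ∀ k, ‖φ β ^ q ^ k‖ ≤ ρ := fun k => by
    rw [norm_pow]
    exact (pow_le_of_le_one (norm_nonneg _) hx1.le (by positivity)).trans hβρ
  have hmem : ∀ j, mahlerIter hq0 j g ∈ convergentSubring φ ρ := fun j =>
    mahlerIter_mem_convergentSubring hq0 hρ0.le hρ1.le j hg
  have hvalue : ∀ k j, psValue φ (mahlerIter hq0 j g) (φ β ^ q ^ k) =
      psValue φ g (φ β ^ q ^ (k + j)) := fun k j => by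
    rw [psValue_mahlerIter, ← pow_mul, pow_add]
  set P : ℕ → ℕ → K := fun k j => (p j).eval (β ^ q ^ k) with hP
  have hv : ∀ k, ∑ j ∈ Finset.range (n + 1), φ (P k j) * psValue φ g (φ β ^ q ^ (k + j)) = 0 := by
    intro k
    have h1 := map_sum (convEval φ (hz k))
      (fun j => (⟨_, mul_mem (coe_mem_convergentSubring (p j)) (hmem j)⟩ :
        convergentSubring φ ρ)) (Finset.range (n + 1))
    simp only [convEval_apply, AddSubmonoidClass.coe_finsetSum, hrel] at h1
    rw [show psValue φ (0 : PowerSeries K) (φ β ^ q ^ k) = 0 by simp [psValue]] at h1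
    rw [h1]
    refine Finset.sum_congr rfl fun j _ => ?_
    rw [psValue_mul (coe_mem_convergentSubring _) (hmem j) (hz k), hvalue,
      ← map_pow φ β (q ^ k), psValue_coe_map]
  obtain ⟨a, ha0, ha, haψ⟩ := exists_nat_size_bound β
  obtain ⟨δ, hδ⟩ : ∃ δ, ∀ j : Fin (n + 1), (p j).natDegree ≤ δ :=
    ⟨Finset.univ.sup fun j : Fin (n + 1) => (p j).natDegree, fun j =>
      Finset.le_sup (f := fun j : Fin (n + 1) => (p j).natDegree) (Finset.mem_univ j)⟩
  obtain ⟨c, hc, hcp⟩ := exists_size_bound_eval (fun j : Fin (n + 1) => p j) hδ ha0 ha haψ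
  obtain ⟨M₀, hM₀, hM₀lam⟩ := exists_nat_size_bound_family (fun j : Fin n => lam j)
  have hMpos : 0 < M₀ * (c * a ^ δ) := by positivity
  have hsize := sizeLE_iterRelation (n := n) (P := P) (lam := lam) hq hMpos (fun j => by
      rcases lt_or_ge j n with h | h
      · exact SizeLE.of_dvd (hM₀lam ⟨j, h⟩) (Dvd.intro _ rfl) hMpos.ne'
      · rw [hsupp j h]
        exact ⟨by simpa using isIntegral_zero, fun ψ => by simp; positivity⟩) (fun k j hj => by
      refine SizeLE.of_dvd (hcp ⟨j, by lia⟩ (q ^ k)) ?_ (by positivity)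
      rw [mul_pow, mul_pow, ← pow_mul]
      exact Dvd.dvd.mul_left (Nat.mul_dvd_mul (dvd_pow_self c (by positivity)) dvd_rfl) _)
  obtain ⟨w, hw0, hwalg, hw⟩ := exists_isAlgebraic_relation_of_growth hq hρ0 hρ1 hβ0 hβρ
    (f := fun i : Fin n => mahlerIter hq0 i g) (fun i => hmem i)
    (lam := fun k i => iterRelation n P lam k i) (fun k h0 => by
      obtain ⟨j, hj, hjne⟩ := iterRelation_ne_zero (P := P) hn hsupp hp0 hpn ⟨i, hi, hne⟩ k
      exact hjne (congrFun h0 ⟨j, hj⟩)) (fun k => by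
      have h1 := sum_iterRelation_eq_zero φ hsupp hv hlam k
      rw [Finset.sum_range] at h1
      rw [← h1]
      refine Finset.sum_congr rfl fun j _ => ?_
      rw [hvalue, mul_comm]) (mul_pos two_pos hMpos) (fun k i => hsize k i)
  refine hw0 (eq_zero_of_isAlgebraic_mahler_relation hq hq0 (g := PowerSeries.map φ g)
    (p := fun j => (p j).map φ) (n := n) ?_ ?_ ?_ hind w hwalg ?_)
  · rw [Polynomial.map_ne_zero_iff φ.injective]
    rintro h
    exact hp0 0 (by rw [h, Polynomial.eval_zero])
  · rw [Polynomial.map_ne_zero_iff φ.injective]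
    rintro h
    exact hpn 0 (by rw [h, Polynomial.eval_zero])
  · have h1 := congrArg (PowerSeries.map φ) hrel
    rw [map_sum, map_zero] at h1
    rw [← h1]
    refine Finset.sum_congr rfl fun j _ => ?_
    rw [map_mul, map_mahlerIter]
    congr 1
    ext m
    simp
  · rw [← hw]
    simp_rw [map_mahlerIter]

end LinearIndependenceOfValues

section LaurentRelations

open scoped RatFunc

variable {K : Type*} [Field K]

theorem ratFunc_smul_laurent (c : Polynomial K) (u : PowerSeries K) :
    algebraMap (Polynomial K) (RatFunc K) c • algebraMap (PowerSeries K) (LaurentSeries K) u =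
      algebraMap (PowerSeries K) (LaurentSeries K) (c * u) := by
  rw [map_mul, IsScalarTower.algebraMap_smul, Algebra.smul_def]
  simp

/-- Linear dependence over rational functions is witnessed by polynomial coefficients. -/
theorem linearIndependent_laurent_iff {ι : Type*} [Fintype ι] (v : ι → PowerSeries K) :
    LinearIndependent (RatFunc K) (fun i => algebraMap (PowerSeries K) (LaurentSeries K) (v i)) ↔
      ∀ c : ι → Polynomial K, ∑ i, (c i : PowerSeries K) * v i = 0 → c = 0 := by
  rw [← LinearIndependent.iff_fractionRing (Polynomial K) (RatFunc K),
    Fintype.linearIndependent_iff]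
  have key (c : ι → Polynomial K) :
      ∑ i, c i • algebraMap (PowerSeries K) (LaurentSeries K) (v i) = 0 ↔
        ∑ i, (c i : PowerSeries K) * v i = 0 := by
    rw [← map_eq_zero_iff _ (IsFractionRing.injective (PowerSeries K) (LaurentSeries K)), map_sum]
    simp only [← ratFunc_smul_laurent, IsScalarTower.algebraMap_smul]
  simp only [key, funext_iff, Pi.zero_apply]

/-- A Mahler function of order `n` is linked to any window of `n` consecutive conjugates. -/
theorem exists_mahler_relation_window {q n : ℕ} (hq0 : q ≠ 0) {g : PowerSeries K}
    {p : ℕ → Polynomial K} (hp0 : p 0 ≠ 0) (hpn : p n ≠ 0)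
    (hrel : ∑ j ∈ Finset.range (n + 1), (p j : PowerSeries K) * mahlerIter hq0 j g = 0) (k : ℕ) :
    ∃ c : Fin (n + 1) → Polynomial K, c ≠ 0 ∧ (c 0 : PowerSeries K) * g +
      ∑ i : Fin n, (c i.succ : PowerSeries K) * mahlerIter hq0 (k + i) g = 0 := by
  set v : ℕ → LaurentSeries K := fun m => algebraMap _ _ (mahlerIter hq0 m g) with hv
  have hwin := mem_span_window_of_recurrence (F := RatFunc K) v (n := n)
    (fun m j => algebraMap _ _ (Polynomial.expand K (q ^ m) (p j)))
    (fun m => by simpa [Polynomial.expand_eq_zero (pow_pos (by lia : 0 < q) m)] using hp0)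
    (fun m => by simpa [Polynomial.expand_eq_zero (pow_pos (by lia : 0 < q) m)] using hpn)
    (fun m => by
      have := congrArg (algebraMap _ (LaurentSeries K)) (mahlerIter_relation hq0 hrel m)
      simpa only [map_sum, map_zero, ratFunc_smul_laurent, v] using this) k 0
  have hdep := (linearIndependent_laurent_iff
    (Fin.cons g fun i : Fin n => mahlerIter hq0 (k + i) g)).not.1 (by
      have : (fun i => algebraMap (PowerSeries K) (LaurentSeries K)
          ((Fin.cons g fun i : Fin n => mahlerIter hq0 (k + i) g :
            Fin (n + 1) → PowerSeries K) i)) = Fin.cons (v 0) fun i : Fin n => v (k + i) := by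
        ext i
        refine Fin.cases ?_ (fun i => ?_) i
        · simp [hv, mahlerIter_zero]
        · simp [hv]
      rw [this, linearIndependent_finCons]
      rintro ⟨-, h⟩
      refine h (Submodule.span_mono ?_ hwin)
      rintro _ ⟨j, hj, rfl⟩
      exact ⟨⟨j - k, by have := hj.1; have := hj.2; lia⟩, by
        simp only
        rw [Nat.add_sub_cancel' hj.1]⟩)
  push Not at hdep
  obtain ⟨c, hc, hc0⟩ := hdep
  refine ⟨c, hc0, ?_⟩
  rw [Fin.sum_univ_succ] at hc
  simpa using hc

/-- If a power series satisfies a nontrivial Mahler relation, its conjugates span a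
finite-dimensional space over the rational functions. -/
theorem exists_fg_mahlerIter_mem {q : ℕ} (hq0 : q ≠ 0) {f : PowerSeries K} {m : ℕ}
    {p : ℕ → Polynomial K} (hp : ∃ i ≤ m, p i ≠ 0)
    (hrel : ∑ j ∈ Finset.range (m + 1), (p j : PowerSeries K) * mahlerIter hq0 j f = 0) :
    ∃ U : Submodule (RatFunc K) (LaurentSeries K), U.FG ∧
      ∀ j, algebraMap (PowerSeries K) (LaurentSeries K) (mahlerIter hq0 j f) ∈ U := by
  obtain ⟨t, -, htp, ht⟩ : ∃ t, t ≤ m ∧ p t ≠ 0 ∧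
      ∑ j ∈ Finset.range (t + 1), (p j : PowerSeries K) * mahlerIter hq0 j f = 0 := by
    induction m with
    | zero =>
      obtain ⟨i, hi, hpi⟩ := hp
      obtain rfl : i = 0 := by lia
      exact ⟨0, le_rfl, hpi, hrel⟩
    | succ m ih =>
      by_cases h : p (m + 1) = 0
      · obtain ⟨i, hi, hpi⟩ := hp
        have : i ≠ m + 1 := by rintro rfl; exact hpi h
        obtain ⟨t, h1, h2⟩ := ih ⟨i, by lia, hpi⟩ (by
          rw [Finset.sum_range_succ, h] at hrel
          simpa using hrel)
        exact ⟨t, by lia, h2⟩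
      · exact ⟨m + 1, le_rfl, h, hrel⟩
  set v : ℕ → LaurentSeries K := fun m => algebraMap _ _ (mahlerIter hq0 m f) with hv
  refine ⟨Submodule.span (RatFunc K) (v '' Set.Iio t),
    Submodule.fg_span ((Set.finite_Iio t).image v), fun j => ?_⟩
  change v j ∈ _
  induction j using Nat.strong_induction_on with
  | _ j ih =>
    rcases lt_or_ge j t with hj | hj
    · exact Submodule.subset_span ⟨j, hj, rfl⟩
    obtain ⟨s, rfl⟩ := Nat.exists_eq_add_of_le' hj
    have h := congrArg (algebraMap _ (LaurentSeries K)) (mahlerIter_relation hq0 ht s)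
    simp only [map_sum, map_zero, ← ratFunc_smul_laurent] at h
    rw [Finset.sum_range_succ, add_eq_zero_iff_neg_eq] at h
    have h0 : algebraMap (Polynomial K) (RatFunc K) (Polynomial.expand K (q ^ s) (p t)) ≠ 0 := by
      simpa [Polynomial.expand_eq_zero (pow_pos (by lia : 0 < q) s)] using htp
    rw [← Submodule.smul_mem_iff _ h0]
    simp only [hv]
    rw [← h]
    exact neg_mem (sum_mem fun i hi => Submodule.smul_mem _ _
      (ih _ (by rw [Finset.mem_range] at hi; lia)))

theorem eval₂_mem_pow_of_isHomogeneous {R F A σ : Type*} [CommSemiring R] [Field F] [CommRing A]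
    [Algebra F A] (ψ : R →+* F) {U : Submodule F A} {x : σ → A} (hx : ∀ i, x i ∈ U)
    {P : MvPolynomial σ R} {d : ℕ} (hP : P.IsHomogeneous d) :
    MvPolynomial.eval₂ ((algebraMap F A).comp ψ) x P ∈ U ^ d := by
  rw [MvPolynomial.eval₂_eq]
  refine sum_mem fun w hw => ?_
  have hd : ∑ i ∈ w.support, w i = d := by
    have := hP (MvPolynomial.mem_support_iff.1 hw)
    rwa [Finsupp.weight_apply, Finsupp.sum, Finset.sum_congr rfl fun i _ => by
      rw [Pi.one_apply, smul_eq_mul, mul_one]] at this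
  rw [RingHom.comp_apply, ← Algebra.smul_def, ← hd]
  refine Submodule.smul_mem _ _ ?_
  clear hd hw
  induction w.support using Finset.cons_induction with
  | empty => simpa using ⟨1, map_one _⟩
  | cons i s hi ih =>
    rw [Finset.prod_cons, Finset.sum_cons, pow_add]
    exact Submodule.mul_mem_mul (Submodule.pow_mem_pow _ (hx i) _) ih

/-- A homogeneous polynomial in Mahler functions is a Mahler function. -/
theorem exists_mahler_relation_aeval {q r : ℕ} (hq0 : q ≠ 0) {f : Fin r → PowerSeries K}
    (hf : ∀ i, ∃ (m : ℕ) (p : ℕ → Polynomial K), (∃ i ≤ m, p i ≠ 0) ∧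
      ∑ j ∈ Finset.range (m + 1), (p j : PowerSeries K) * mahlerIter hq0 j (f i) = 0)
    {P : MvPolynomial (Fin r) K} {d : ℕ} (hP : P.IsHomogeneous d) :
    ∃ (N : ℕ) (c : Fin N → Polynomial K), c ≠ 0 ∧
      ∑ i, (c i : PowerSeries K) * mahlerIter hq0 i (MvPolynomial.aeval f P) = 0 := by
  choose m p hp hrel using hf
  choose U hU hmem using fun i => exists_fg_mahlerIter_mem hq0 (hp i) (hrel i)
  have hFG : ((⨆ i, U i) ^ d).FG := (Submodule.fg_iSup U hU).pow d
  set v : ℕ → LaurentSeries K :=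
    fun j => algebraMap _ _ (mahlerIter hq0 j (MvPolynomial.aeval f P)) with hv
  have hvmem (j : ℕ) : v j ∈ (⨆ i, U i) ^ d := by
    have := eval₂_mem_pow_of_isHomogeneous
      (algebraMap (Polynomial K) (RatFunc K) |>.comp Polynomial.C)
      (fun i => (le_iSup U i) (hmem i j)) hP
    convert this using 1
    simp only [hv]
    rw [MvPolynomial.aeval_def, ← AlgHom.coe_toRingHom, ← RingHom.comp_apply,
      MvPolynomial.hom_eval₂]
    congr 1
    refine RingHom.ext fun a => ?_
    simp only [RingHom.comp_apply, AlgHom.coe_toRingHom, AlgHom.commutes]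
    rw [← IsScalarTower.algebraMap_apply (Polynomial K) (RatFunc K)]
    simp
  have : Module.Finite (RatFunc K) ↥((⨆ i, U i) ^ d) := Module.Finite.iff_fg.2 hFG
  set N := Module.finrank (RatFunc K) ↥((⨆ i, U i) ^ d)
  by_contra! hno
  have hli : LinearIndependent (RatFunc K) fun i : Fin (N + 1) => v i :=
    (linearIndependent_laurent_iff _).2 fun c hc => by
      by_contra h
      exact hno (N + 1) c h hc
  have hli' : LinearIndependent (RatFunc K)
      fun j : Fin (N + 1) => (⟨v j, hvmem j⟩ : ↥((⨆ i, U i) ^ d)) :=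
    LinearIndependent.of_comp (Submodule.subtype _) hli
  have := hli'.fintype_card_le_finrank
  simp [N] at this

end LaurentRelations

theorem exists_polynomial_coeff_eq {R : Type*} [CommSemiring R] {a : ℕ → R} {N : ℕ}
    (h : ∀ k, N ≤ k → a k = 0) : ∃ p : Polynomial R, ∀ k, p.coeff k = a k := by
  refine ⟨PowerSeries.trunc N (PowerSeries.mk a), fun k => ?_⟩
  rw [PowerSeries.coeff_trunc, PowerSeries.coeff_mk]
  split_ifs with hk
  · rfl
  · exact (h k (by lia)).symm

/-- The coefficients in a fixed residue class modulo `q` of `p(z) u(z ^ q)`. -/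
theorem coeff_mul_mahlerIter_section {R : Type*} [CommRing R] {q i : ℕ} (hq0 : q ≠ 0) (hi : i < q)
    {p s : Polynomial R} (hs : ∀ k, s.coeff k = p.coeff (q * k + i)) (u : PowerSeries R) (m : ℕ) :
    PowerSeries.coeff (q * m + i) ((p : PowerSeries R) * mahlerIter hq0 1 u) =
      PowerSeries.coeff m ((s : PowerSeries R) * u) := by
  rw [PowerSeries.coeff_mul, PowerSeries.coeff_mul]
  symm
  refine Finset.sum_of_injOn (fun x => (q * x.1 + i, q * x.2)) ?_ ?_ ?_ ?_
  · rintro ⟨a, b⟩ - ⟨a', b'⟩ - h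
    simp only [Prod.mk.injEq, Nat.add_right_cancel_iff, mul_eq_mul_left_iff, hq0, or_false] at h
    rw [h.1, h.2]
  · rintro ⟨a, b⟩ h
    simp only [Finset.mem_coe, Finset.HasAntidiagonal.mem_antidiagonal] at h ⊢
    rw [← h]
    ring
  · rintro ⟨a, b⟩ h hno
    rw [coeff_mahlerIter]
    split_ifs with hb
    · exfalso
      rw [pow_one] at hb
      obtain ⟨b, rfl⟩ := hb
      rw [Finset.HasAntidiagonal.mem_antidiagonal] at h
      simp only at h
      have hbm : b ≤ m := by
        by_contra! hlt
        have := Nat.mul_le_mul_left q (Nat.succ_le_of_lt hlt)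
        rw [Nat.mul_succ] at this
        lia
      refine hno ⟨(m - b, b), ?_, ?_⟩
      · simp only [Finset.mem_coe, Finset.HasAntidiagonal.mem_antidiagonal]
        lia
      · obtain ⟨e, rfl⟩ := Nat.exists_eq_add_of_le hbm
        have : a = q * e + i := by
          rw [mul_add] at h
          lia
        simp [this]
    · simp
  · rintro ⟨a, b⟩ -
    simp only [Polynomial.coeff_coe, hs, coeff_mahlerIter, pow_one, dvd_mul_right, if_true]
    rw [Nat.mul_div_cancel_left _ (by lia)]

/-- The lowest coefficient of a Mahler relation of minimal order does not vanish. -/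
theorem coeff_zero_ne_zero_of_mahler_relation {R : Type*} [CommRing R] {q n : ℕ} (hq0 : q ≠ 0)
    {g : PowerSeries R} {p : ℕ → Polynomial R} (hpn : p n ≠ 0)
    (hrel : ∑ j ∈ Finset.range (n + 1), (p j : PowerSeries R) * mahlerIter hq0 j g = 0)
    (hind : ∀ c : Fin n → Polynomial R,
      ∑ i, (c i : PowerSeries R) * mahlerIter hq0 i g = 0 → c = 0) : p 0 ≠ 0 := by
  intro h0
  have hn : n ≠ 0 := by
    rintro rfl
    exact hpn h0
  obtain ⟨n, rfl⟩ := Nat.exists_eq_succ_of_ne_zero hn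
  have hsec (i : ℕ) (j : ℕ) : ∃ s : Polynomial R, ∀ k, s.coeff k = (p j).coeff (q * k + i) :=
    exists_polynomial_coeff_eq (N := (p j).natDegree + 1) fun k hk =>
      Polynomial.coeff_eq_zero_of_natDegree_lt (by
        have := Nat.le_mul_of_pos_left k (show 0 < q by lia)
        lia)
  choose s hs using hsec
  refine hpn (Polynomial.ext fun k => ?_)
  have hmod : k % q < q := Nat.mod_lt _ (by lia)
  have hzero : (fun j : Fin (n + 1) => s (k % q) (j + 1)) = 0 := hind _ (by
    ext m
    have := congrArg (PowerSeries.coeff (q * m + k % q)) hrel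
    rw [Finset.sum_range_succ', h0] at this
    simp only [Polynomial.coe_zero, zero_mul, add_zero, map_sum, map_zero] at this
    rw [map_sum, map_zero, ← this, Finset.sum_range]
    refine Finset.sum_congr rfl fun j _ => ?_
    rw [← coeff_mul_mahlerIter_section hq0 hmod (hs (k % q) (j + 1)), mahlerIter_mahlerIter,
      add_comm 1])
  have := hs (k % q) (n + 1) (k / q)
  rw [Nat.div_add_mod] at this
  rw [← this]
  simpa using congrArg (fun p => Polynomial.coeff p (k / q)) (congrFun hzero (Fin.last n))

/-- A nonzero power series with algebraic coefficients satisfying a Mahler relation satisfies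
one of minimal order with algebraic coefficients. -/
theorem exists_minimal_mahler_relation {q : ℕ} (hq0 : q ≠ 0) {g : PowerSeries ℂ} (hg0 : g ≠ 0)
    (halg : ∀ k, IsAlgebraic ℚ (PowerSeries.coeff k g))
    (hdep : ∃ (N : ℕ) (c : Fin N → Polynomial ℂ), c ≠ 0 ∧
      ∑ i, (c i : PowerSeries ℂ) * mahlerIter hq0 i g = 0) :
    ∃ (n : ℕ) (p : ℕ → Polynomial ℂ), 0 < n ∧ p 0 ≠ 0 ∧ p n ≠ 0 ∧
      (∀ j k, IsAlgebraic ℚ ((p j).coeff k)) ∧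
      ∑ j ∈ Finset.range (n + 1), (p j : PowerSeries ℂ) * mahlerIter hq0 j g = 0 ∧
      ∀ c : Fin n → Polynomial ℂ, ∑ i, (c i : PowerSeries ℂ) * mahlerIter hq0 i g = 0 → c = 0 := by
  classical
  obtain ⟨N, ⟨c, hc0, hc⟩, hmin⟩ : ∃ N, (∃ c : Fin N → Polynomial ℂ, c ≠ 0 ∧
      ∑ i, (c i : PowerSeries ℂ) * mahlerIter hq0 i g = 0) ∧ ∀ n < N, ∀ c : Fin n → Polynomial ℂ,
        ∑ i, (c i : PowerSeries ℂ) * mahlerIter hq0 i g = 0 → c = 0 := by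
    refine ⟨Nat.find hdep, Nat.find_spec hdep, fun n hn c hc => ?_⟩
    by_contra h
    exact Nat.find_min hdep hn ⟨c, h, hc⟩
  obtain _ | n := N
  · exact absurd (Subsingleton.elim _ _) hc0
  have hn : 0 < n := by
    rw [Nat.pos_iff_ne_zero]
    rintro rfl
    have h0 : c 0 = 0 := by simpa [mahlerIter_zero, hg0] using hc
    exact hc0 (funext fun i => by rw [Fin.fin_one_eq_zero i, h0, Pi.zero_apply])
  obtain ⟨i₀, hi₀⟩ := Function.ne_iff.1 hc0
  obtain ⟨k₀, hk₀⟩ : ∃ k, (c i₀).coeff k ≠ 0 := by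
    by_contra! h
    exact hi₀ (Polynomial.ext fun k => by simpa using h k)
  let L := algebraicClosure ℚ ℂ
  obtain ⟨l, hl⟩ : ∃ l : Module.Dual L ℂ, l ((c i₀).coeff k₀) ≠ 0 := by
    by_contra! h
    exact hk₀ ((Module.forall_dual_apply_eq_zero_iff L _).1 h)
  have hpoly (i : Fin (n + 1)) : ∃ p : Polynomial ℂ, ∀ k, p.coeff k = l ((c i).coeff k) :=
    exists_polynomial_coeff_eq (N := (c i).natDegree + 1) fun k hk => by
      rw [Polynomial.coeff_eq_zero_of_natDegree_lt (by lia)]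
      simp
  choose p hp using hpoly
  have hmul (i : Fin (n + 1)) {u : PowerSeries ℂ} (hu : ∀ k, PowerSeries.coeff k u ∈ L) (k : ℕ) :
      PowerSeries.coeff k ((p i : PowerSeries ℂ) * u) =
        l (PowerSeries.coeff k ((c i : PowerSeries ℂ) * u)) := by
    rw [PowerSeries.coeff_mul, PowerSeries.coeff_mul, map_sum, AddSubmonoidClass.coe_finsetSum]
    refine Finset.sum_congr rfl fun x _ => ?_
    rw [Polynomial.coeff_coe, Polynomial.coeff_coe, hp, mul_comm ((c i).coeff _)]
    have := congrArg Subtype.val (l.map_smul ⟨_, hu x.2⟩ ((c i).coeff x.1))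
    rw [mul_comm]
    exact this.symm
  have hgL (j k : ℕ) : PowerSeries.coeff k (mahlerIter hq0 j g) ∈ L := by
    rw [coeff_mahlerIter]
    split_ifs
    · exact mem_algebraicClosure_iff.2 (halg _)
    · exact zero_mem _
  have hprel : ∑ i, (p i : PowerSeries ℂ) * mahlerIter hq0 i g = 0 := by
    ext k
    have := congrArg (fun u => (l (PowerSeries.coeff k u) : ℂ)) hc
    simp only [map_sum, AddSubmonoidClass.coe_finsetSum, ← hmul _ (hgL _)] at this
    simpa using this
  have hpn : p (Fin.last n) ≠ 0 := by
    intro h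
    rw [Fin.sum_univ_castSucc, h] at hprel
    have h0 := hmin n (by lia) (fun i => p i.castSucc) (by simpa using hprel)
    have hall (i : Fin (n + 1)) : p i = 0 := by
      refine Fin.lastCases h (fun i => ?_) i
      exact congrFun h0 i
    refine hl (Subtype.ext ?_)
    rw [← hp, hall]
    simp
  let p' : ℕ → Polynomial ℂ := fun j => if h : j < n + 1 then p ⟨j, h⟩ else 0
  have hp' : ∑ j ∈ Finset.range (n + 1), (p' j : PowerSeries ℂ) * mahlerIter hq0 j g = 0 := by
    rw [← hprel, Finset.sum_range]
    refine Finset.sum_congr rfl fun i _ => ?_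
    simp only [p', i.2, dif_pos]
  have hp'n : p' n ≠ 0 := by
    simp only [p', Nat.lt_succ_self, dif_pos]
    exact hpn
  refine ⟨n, p', hn, coeff_zero_ne_zero_of_mahler_relation hq0 hp'n hp' (hmin n (by lia)), hp'n,
    fun j k => ?_, hp', hmin n (by lia)⟩
  by_cases h : j < n + 1
  · simp only [p', h, dif_pos, hp]
    exact mem_algebraicClosure_iff.1 (l _).2
  · simp only [p', h, dif_neg, not_false_eq_true, Polynomial.coeff_zero]
    exact isAlgebraic_zero

/-- The coefficients of a Mahler function lie in any field containing the coefficients of its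
equation and sufficiently many initial coefficients. -/
theorem coeff_mem_of_mahler_relation {F : Type*} [Field F] {q n : ℕ} (hq : 2 ≤ q) (hq0 : q ≠ 0)
    {g : PowerSeries F} {p : ℕ → Polynomial F} (hp0 : p 0 ≠ 0)
    (hrel : ∑ j ∈ Finset.range (n + 1), (p j : PowerSeries F) * mahlerIter hq0 j g = 0)
    (K : Subfield F) (hpK : ∀ j ≤ n, ∀ k, (p j).coeff k ∈ K)
    (hgK : ∀ k ≤ (p 0).natTrailingDegree, PowerSeries.coeff k g ∈ K) (m : ℕ) :
    PowerSeries.coeff m g ∈ K := by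
  set s := (p 0).natTrailingDegree with hs
  induction m using Nat.strong_induction_on with
  | _ m ih =>
    rcases le_or_gt m s with hm | hm
    · exact hgK m hm
    have h := congrArg (PowerSeries.coeff (m + s)) hrel
    rw [Finset.sum_range_succ', map_add, map_zero, mahlerIter_zero,
      PowerSeries.coeff_mul _ (p 0 : PowerSeries F),
      ← Finset.add_sum_erase (a := (s, m)) _ _
        (by rw [Finset.HasAntidiagonal.mem_antidiagonal]; exact add_comm s m)] at h
    have hlead : (p 0).coeff s ≠ 0 := by
      simpa [hs] using Polynomial.trailingCoeff_nonzero_iff_nonzero.2 hp0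
    have hA : PowerSeries.coeff (m + s) (∑ j ∈ Finset.range n,
        (p (j + 1) : PowerSeries F) * mahlerIter hq0 (j + 1) g) ∈ K := by
      rw [map_sum]
      refine sum_mem fun j hj => ?_
      rw [PowerSeries.coeff_mul]
      refine sum_mem fun x hx => mul_mem ?_ ?_
      · rw [Polynomial.coeff_coe]
        exact hpK _ (by rw [Finset.mem_range] at hj; lia) _
      · rw [coeff_mahlerIter]
        split_ifs
        · refine ih _ ?_
          rw [Finset.HasAntidiagonal.mem_antidiagonal] at hx
          rw [Nat.div_lt_iff_lt_mul (pow_pos (by lia) _)]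
          have : 2 ≤ q ^ (j + 1) := hq.trans (Nat.le_self_pow (by lia) q)
          have := Nat.mul_le_mul_left m this
          lia
        · exact zero_mem _
    have hB : ∑ x ∈ (Finset.HasAntidiagonal.antidiagonal (m + s)).erase (s, m),
        PowerSeries.coeff x.1 (p 0 : PowerSeries F) * PowerSeries.coeff x.2 g ∈ K := by
      refine sum_mem fun x hx => ?_
      rw [Finset.mem_erase, Finset.HasAntidiagonal.mem_antidiagonal, Ne, Prod.ext_iff] at hx
      rw [Polynomial.coeff_coe]
      rcases lt_or_ge x.1 s with hxs | hxs
      · rw [Polynomial.coeff_eq_zero_of_lt_natTrailingDegree hxs, zero_mul]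
        exact zero_mem _
      · exact mul_mem (hpK 0 (by lia) _) (ih _ (by lia))
    have hC : (p 0).coeff s * PowerSeries.coeff m g ∈ K := by
      rw [Polynomial.coeff_coe] at h
      convert neg_mem (add_mem hA hB) using 1
      linear_combination h
    have := mul_mem (inv_mem (hpK 0 (by lia) s)) hC
    rwa [inv_mul_cancel_left₀ hlead] at this

/-- A Mahler relation with algebraic coefficients is defined over a number field. -/
theorem exists_numberField_mahler_relation {q n : ℕ} (hq : 2 ≤ q) (hq0 : q ≠ 0)
    {g : PowerSeries ℂ} (hg : ∀ k, IsAlgebraic ℚ (PowerSeries.coeff k g))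
    {p : ℕ → Polynomial ℂ} (hp0 : p 0 ≠ 0) (hp : ∀ j k, IsAlgebraic ℚ ((p j).coeff k))
    (hrel : ∑ j ∈ Finset.range (n + 1), (p j : PowerSeries ℂ) * mahlerIter hq0 j g = 0)
    {α : ℂ} (hα : IsAlgebraic ℚ α) :
    ∃ (K : IntermediateField ℚ ℂ) (_ : NumberField K) (a : K) (g' : PowerSeries K)
      (p' : ℕ → Polynomial K), algebraMap K ℂ a = α ∧ PowerSeries.map (algebraMap K ℂ) g' = g ∧
        ∀ j ≤ n, (p' j).map (algebraMap K ℂ) = p j := by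
  let S : Set ℂ := {α} ∪ ((⋃ j ∈ Finset.range (n + 1), ((p j).coeffs : Set ℂ)) ∪
    (fun k => PowerSeries.coeff k g) '' Set.Iic (p 0).natTrailingDegree)
  have hSfin : S.Finite := by
    refine (Set.finite_singleton α).union (Set.Finite.union ?_ ((Set.finite_Iic _).image _))
    exact Set.Finite.biUnion (Finset.finite_toSet _) fun j _ => Finset.finite_toSet _
  have : Finite S := hSfin
  have hSalg : ∀ x ∈ S, IsIntegral ℚ x := by
    rintro x (rfl | hx | ⟨k, -, rfl⟩)
    · exact hα.isIntegral
    · simp only [Set.mem_iUnion] at hx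
      obtain ⟨j, -, hx⟩ := hx
      obtain ⟨k, -, rfl⟩ := Polynomial.mem_coeffs_iff.1 hx
      exact (hp j k).isIntegral
    · exact (hg k).isIntegral
  let K := IntermediateField.adjoin ℚ S
  have hfd : FiniteDimensional ℚ K := IntermediateField.finiteDimensional_adjoin hSalg
  have hnf : NumberField K := ⟨⟩
  have hSK : S ⊆ K := IntermediateField.subset_adjoin ℚ S
  have hpK : ∀ j ≤ n, ∀ k, (p j).coeff k ∈ K := by
    intro j hj k
    by_cases h : (p j).coeff k = 0
    · rw [h]
      exact zero_mem _
    · refine hSK (Or.inr (Or.inl ?_))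
      simp only [Set.mem_iUnion]
      exact ⟨j, Finset.mem_range.2 (by lia), Polynomial.coeff_mem_coeffs h⟩
  have hgK := coeff_mem_of_mahler_relation hq hq0 hp0 hrel K.toSubfield hpK
    (fun k hk => hSK (Or.inr (Or.inr ⟨k, hk, rfl⟩)))
  have hlift : ∀ j, ∃ p' : Polynomial K, j ≤ n → p'.map (algebraMap K ℂ) = p j := by
    intro j
    by_cases hj : j ≤ n
    · obtain ⟨p', hp'⟩ := (Polynomial.lifts_iff_coeff_lifts (f := algebraMap K ℂ) (p j)).2
        fun k => ⟨⟨_, hpK j hj k⟩, rfl⟩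
      exact ⟨p', fun _ => hp'⟩
    · exact ⟨0, fun h => absurd h hj⟩
  choose p' hp' using hlift
  exact ⟨K, hnf, ⟨α, hSK (Or.inl rfl)⟩, PowerSeries.mk fun k => ⟨_, hgK k⟩, p', rfl,
    by ext k; simp, hp'⟩

section AnalyticContinuation

variable {K : Type*} [Field K] {φ : K →+* ℂ}

theorem analyticAt_psValue {ρ : ℝ} {u : PowerSeries K} (hu : u ∈ convergentSubring φ ρ) {z : ℂ}
    (hz : ‖z‖ < ρ) : AnalyticAt ℂ (psValue φ u) z := by
  have hd : DifferentiableOn ℂ (fun w => ∑' n, φ (PowerSeries.coeff n u) * w ^ n)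
      (Metric.ball 0 ρ) := by
    refine Complex.differentiableOn_tsum_of_summable_norm (mem_convergentSubring.1 hu)
      (fun n => by fun_prop) Metric.isOpen_ball fun n w hw => ?_
    rw [mem_ball_zero_iff] at hw
    rw [norm_mul, norm_mul, norm_pow, norm_pow, Complex.norm_real]
    have := hw.le.trans (le_abs_self ρ)
    gcongr
    exact this
  exact hd.analyticAt (Metric.isOpen_ball.mem_nhds (by simpa using hz))

theorem analyticAt_psValue_coe (p : Polynomial K) (z : ℂ) :
    AnalyticAt ℂ (psValue φ (p : PowerSeries K)) z :=
  analyticAt_psValue (ρ := ‖z‖ + 1) (coe_mem_convergentSubring p) (lt_add_one _)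

/-- A Mahler relation persists under meromorphic continuation. -/
theorem mahler_relation_continuation {q n : ℕ} (hq0 : q ≠ 0) {ρ : ℝ} (hρ0 : 0 < ρ) (hρ1 : ρ < 1)
    {g : PowerSeries K} (hg : g ∈ convergentSubring φ ρ) {k : ℕ} {c : Fin (n + 1) → Polynomial K}
    (hrel : (c 0 : PowerSeries K) * g +
      ∑ i : Fin n, (c i.succ : PowerSeries K) * mahlerIter hq0 (k + i) g = 0)
    {G : ℂ → ℂ} (hG : MeromorphicOn G (Metric.ball 0 1))
    (hG0 : ∀ᶠ z in nhds (0 : ℂ), G z = psValue φ g z) {α : ℂ} (hα1 : ‖α‖ < 1)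
    (hαρ : ‖α‖ ^ q ^ k < ρ) (hGα : AnalyticAt ℂ G α) :
    psValue φ (c 0 : PowerSeries K) α * G α +
      ∑ i : Fin n, psValue φ (c i.succ : PowerSeries K) α * psValue φ g (α ^ q ^ (k + i)) = 0 := by
  obtain ⟨R, hαR, hR1, hRρ⟩ : ∃ R, ‖α‖ < R ∧ R < 1 ∧ R ^ q ^ k < ρ := by
    have hc : ContinuousAt (fun t : ℝ => t ^ q ^ k) ‖α‖ := by fun_prop
    have h := ((hc.eventually_lt_const hαρ).and (eventually_lt_nhds hα1)).filter_mono
      (nhdsWithin_le_nhds (s := Set.Ioi ‖α‖))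
    obtain ⟨R, ⟨h1, h2⟩, h3⟩ := (h.and self_mem_nhdsWithin).exists
    exact ⟨R, h3, h2, h1⟩
  have hR0 : 0 < R := (norm_nonneg _).trans_lt hαR
  have hpow {z : ℂ} (hz : ‖z‖ < R) (i : ℕ) : ‖z ^ q ^ (k + i)‖ < ρ := by
    rw [norm_pow]
    calc ‖z‖ ^ q ^ (k + i) ≤ ‖z‖ ^ q ^ k :=
          pow_le_pow_of_le_one (norm_nonneg _) (hz.trans hR1).le
            (Nat.pow_le_pow_right (by lia) (by lia))
      _ ≤ R ^ q ^ k := by gcongr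
      _ < ρ := hRρ
  set T : ℂ → ℂ := fun z => ∑ i : Fin n,
    psValue φ (c i.succ : PowerSeries K) z * psValue φ g (z ^ q ^ (k + i)) with hT
  have hTan {z : ℂ} (hz : ‖z‖ < R) : AnalyticAt ℂ T z := by
    refine Finset.analyticAt_fun_sum _ fun i _ => (analyticAt_psValue_coe _ _).mul ?_
    exact AnalyticAt.fun_comp (f := fun z => z ^ q ^ (k + i)) (analyticAt_psValue hg (hpow hz i))
      (by fun_prop)
  set H : ℂ → ℂ := fun z => psValue φ (c 0 : PowerSeries K) z * G z + T z with hH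
  have hHmer : MeromorphicOn H (Metric.ball 0 R) := by
    intro z hz
    rw [mem_ball_zero_iff] at hz
    exact ((analyticAt_psValue_coe _ _).meromorphicAt.mul
      (hG z (by simpa using hz.trans hR1))).add (hTan hz).meromorphicAt
  have hH0 : ∀ᶠ z in nhds (0 : ℂ), H z = 0 := by
    filter_upwards [hG0, Metric.ball_mem_nhds (0 : ℂ) hρ0] with z hz hzρ
    rw [mem_ball_zero_iff] at hzρ
    have hmem (i : Fin n) := mahlerIter_mem_convergentSubring hq0 hρ0.le hρ1.le (k + i) hg
    have := congrArg (convEval φ hzρ.le) (show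
      (⟨_, coe_mem_convergentSubring (c 0)⟩ : convergentSubring φ ρ) * ⟨g, hg⟩ +
        ∑ i : Fin n, (⟨_, coe_mem_convergentSubring (c i.succ)⟩ : convergentSubring φ ρ) *
          ⟨_, hmem i⟩ = 0 from Subtype.ext (by simpa using hrel))
    simp only [map_add, map_sum, map_mul, convEval_apply, map_zero, psValue_mahlerIter] at this
    simp only [hH, hT, hz]
    exact this
  have hHα : ∀ᶠ z in nhdsWithin α {α}ᶜ, H z = 0 := by
    rw [← meromorphicOrderAt_eq_top_iff]
    by_contra hne
    refine hHmer.meromorphicOrderAt_ne_top_of_isPreconnected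
      (convex_ball (0 : ℂ) R).isPreconnected (by simpa using hαR) (Metric.mem_ball_self hR0) hne ?_
    exact meromorphicOrderAt_eq_top_iff.2 (hH0.filter_mono nhdsWithin_le_nhds)
  have hcont : ContinuousAt H α :=
    (((analyticAt_psValue_coe _ _).mul hGα).add (hTan hαR)).continuousAt
  exact tendsto_nhds_unique (hcont.tendsto.mono_left nhdsWithin_le_nhds)
    (tendsto_const_nhds.congr' (hHα.mono fun z hz => hz.symm))

/-- A nonzero polynomial does not vanish at high powers of a number in the unit disk. -/
theorem exists_forall_eval_pow_ne_zero {q : ℕ} (hq : 2 ≤ q) {a : K} (ha0 : a ≠ 0)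
    (ha1 : ‖φ a‖ < 1) {p : Polynomial K} (hp : p ≠ 0) :
    ∃ k₀, ∀ k ≥ k₀, p.eval (a ^ q ^ k) ≠ 0 := by
  obtain ⟨c, s, ε, hc, hε, h⟩ := exists_le_psValue (φ := φ) one_pos (coe_mem_convergentSubring p)
    (by simpa using hp)
  have ht : Filter.Tendsto (fun k => ‖φ a‖ ^ q ^ k) Filter.atTop (nhds 0) :=
    (tendsto_pow_atTop_nhds_zero_of_lt_one (norm_nonneg _) ha1).comp
      (tendsto_pow_atTop_atTop_of_one_lt (by lia))
  obtain ⟨k₀, hk₀⟩ := Filter.eventually_atTop.1 (ht.eventually_lt_const hε)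
  refine ⟨k₀, fun k hk h0 => ?_⟩
  have hle := h (φ (a ^ q ^ k)) (by
    rw [map_pow, norm_pow]
    exact pow_le_one₀ (norm_nonneg _) ha1.le) (by simpa using hk₀ k hk)
  rw [psValue_coe_map, h0, map_zero, norm_zero] at hle
  have : 0 < ‖φ (a ^ q ^ k)‖ :=
    norm_pos_iff.2 ((map_ne_zero φ).2 (pow_ne_zero _ ha0))
  exact absurd hle (not_le.2 (by positivity))

end AnalyticContinuation

theorem exists_eval_ne_zero_of_relation {K ι : Type*} [Field K] [Fintype ι]
    {v : ι → PowerSeries K} {c : ι → Polynomial K} (hc0 : c ≠ 0)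
    (hc : ∑ i, (c i : PowerSeries K) * v i = 0) (a : K) :
    ∃ c' : ι → Polynomial K, (∃ i, (c' i).eval a ≠ 0) ∧
      ∑ i, (c' i : PowerSeries K) * v i = 0 := by
  classical
  let _ : NormalizedGCDMonoid (Polynomial K) :=
    UniqueFactorizationMonoid.toNormalizedGCDMonoid _
  obtain ⟨i₀, hi₀⟩ := Function.ne_iff.1 hc0
  obtain ⟨c', hcc', hgcd⟩ := Finset.extract_gcd c (s := Finset.univ) ⟨i₀, Finset.mem_univ _⟩
  have hne : Finset.univ.gcd c ≠ 0 := by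
    intro h
    rw [Finset.gcd_eq_zero_iff] at h
    exact hi₀ (h i₀ (Finset.mem_univ _))
  refine ⟨c', ?_, ?_⟩
  · by_contra! h
    refine Polynomial.not_isUnit_X_sub_C a (isUnit_of_dvd_one ?_)
    rw [← hgcd]
    exact Finset.dvd_gcd fun i _ => Polynomial.dvd_iff_isRoot.2 (h i)
  · have hmul : ((Finset.univ.gcd c : Polynomial K) : PowerSeries K) *
        ∑ i, (c' i : PowerSeries K) * v i = 0 := by
      rw [← hc, Finset.mul_sum]
      refine Finset.sum_congr rfl fun i hi => ?_
      conv_rhs => rw [hcc' i hi, Polynomial.coe_mul]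
      ring
    exact (mul_eq_zero.1 hmul).resolve_left (by simpa using hne)

/-- A Mahler function over a number field vanishing at `a` satisfies a Mahler relation whose
specialization at `a` is trivial except in order zero. -/
theorem exists_mahler_relation_eval {K : Type*} [Field K] [NumberField K] {φ : K →+* ℂ}
    {q n : ℕ} (hq : 2 ≤ q) (hq0 : q ≠ 0) {ρ : ℝ} (hρ0 : 0 < ρ) (hρ1 : ρ < 1) {a : K} (ha0 : a ≠ 0)
    (ha1 : ‖φ a‖ < 1) {g : PowerSeries K} (hg : g ∈ convergentSubring φ ρ)
    {p : ℕ → Polynomial K} (hn : 0 < n) (hp0 : p 0 ≠ 0) (hpn : p n ≠ 0)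
    (hrel : ∑ j ∈ Finset.range (n + 1), (p j : PowerSeries K) * mahlerIter hq0 j g = 0)
    (hind : ∀ c : Fin n → Polynomial ℂ,
      ∑ i, (c i : PowerSeries ℂ) * mahlerIter hq0 i (PowerSeries.map φ g) = 0 → c = 0)
    {G : ℂ → ℂ} (hG : MeromorphicOn G (Metric.ball 0 1))
    (hG0 : ∀ᶠ z in nhds (0 : ℂ), G z = psValue φ g z) (hGa : AnalyticAt ℂ G (φ a))
    (hval : G (φ a) = 0) :
    ∃ (J : ℕ) (b : ℕ → Polynomial K),
      ∑ j ∈ Finset.range (J + 1), (b j : PowerSeries K) * mahlerIter hq0 j g = 0 ∧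
      (b 0).eval a = 1 ∧ ∀ j, j ≠ 0 → (b j).eval a = 0 := by
  obtain ⟨k₁, hk₁⟩ := exists_forall_eval_pow_ne_zero hq ha0 ha1 hp0
  obtain ⟨k₂, hk₂⟩ := exists_forall_eval_pow_ne_zero hq ha0 ha1 hpn
  have ht : Filter.Tendsto (fun k => ‖φ a‖ ^ q ^ k) Filter.atTop (nhds 0) :=
    (tendsto_pow_atTop_nhds_zero_of_lt_one (norm_nonneg _) ha1).comp
      (tendsto_pow_atTop_atTop_of_one_lt (by lia))
  obtain ⟨k₃, hk₃⟩ := Filter.eventually_atTop.1 (ht.eventually_lt_const hρ0)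
  set k := k₁ + k₂ + k₃ + 1 with hk
  obtain ⟨c₀, hc₀, hc₀rel⟩ := exists_mahler_relation_window hq0 hp0 hpn hrel k
  obtain ⟨c, ⟨i₀, hi₀⟩, hc⟩ := exists_eval_ne_zero_of_relation
    (v := Fin.cons g fun i : Fin n => mahlerIter hq0 (k + i) g) hc₀
    (by simpa [Fin.sum_univ_succ] using hc₀rel) a
  have hc' : (c 0 : PowerSeries K) * g +
      ∑ i : Fin n, (c i.succ : PowerSeries K) * mahlerIter hq0 (k + i) g = 0 := by
    simpa [Fin.sum_univ_succ] using hc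
  have hkρ : ‖φ a‖ ^ q ^ k < ρ := hk₃ k (by lia)
  have hcont := mahler_relation_continuation hq0 hρ0 hρ1 hg hc' hG hG0 ha1 hkρ hGa
  rw [hval, mul_zero, zero_add] at hcont
  let lam : ℕ → K := fun i => if h : i < n then (c (Fin.succ ⟨i, h⟩)).eval a else 0
  have hpow (m : ℕ) : (a ^ q ^ k) ^ q ^ m = a ^ q ^ (k + m) := by rw [← pow_mul, ← pow_add]
  have hlam : ∀ i < n, lam i = 0 := fun i hi =>
    eq_zero_of_sum_mahler_values_eq_zero hq hq0 hρ0 hρ1 (β := a ^ q ^ k) (pow_ne_zero _ ha0)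
      (by rw [map_pow, norm_pow]; exact hkρ.le) hg hn hrel
      (fun m => by rw [hpow]; exact hk₁ _ (by lia)) (fun m => by rw [hpow]; exact hk₂ _ (by lia))
      hind (by
        rw [← hcont, Finset.sum_range]
        refine Finset.sum_congr rfl fun i _ => ?_
        rw [psValue_coe_map, ← map_pow, hpow, map_pow]
        simp only [lam, i.2, dif_pos]) hi
  have hsucc (i : Fin n) : (c i.succ).eval a = 0 := by
    simpa only [lam, i.2, dif_pos] using hlam i i.2
  have h0 : (c 0).eval a ≠ 0 := by
    induction i₀ using Fin.cases with
    | zero => exact hi₀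
    | succ i => exact absurd (hsucc i) hi₀
  let b : ℕ → Polynomial K := fun j => Polynomial.C ((c 0).eval a)⁻¹ *
    if j = 0 then c 0 else if h : k ≤ j ∧ j - k < n then c (Fin.succ ⟨j - k, h.2⟩) else 0
  have hb0 : b 0 = Polynomial.C ((c 0).eval a)⁻¹ * c 0 := rfl
  have hbk (i : Fin n) : b (k + i) = Polynomial.C ((c 0).eval a)⁻¹ * c i.succ := by
    have h : k ≤ k + i ∧ k + i - k < n := by lia
    simp only [b, show k + (i : ℕ) ≠ 0 by lia, if_false]
    rw [dif_pos h]
    simp only [Nat.add_sub_cancel_left]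
  refine ⟨k₁ + k₂ + k₃ + n, b, ?_, by simp [hb0, h0], fun j hj => ?_⟩
  · have hsmall : ∀ j ∈ Finset.range (k₁ + k₂ + k₃),
        (b (j + 1) : PowerSeries K) * mahlerIter hq0 (j + 1) g = 0 := by
      intro j hj
      rw [Finset.mem_range] at hj
      have h : ¬(k ≤ j + 1 ∧ j + 1 - k < n) := by lia
      simp [b, h]
    rw [show k₁ + k₂ + k₃ + n + 1 = k₁ + k₂ + k₃ + 1 + n by lia, Finset.sum_range_add,
      Finset.sum_range_succ', Finset.sum_eq_zero hsmall, zero_add, ← hk, Finset.sum_range]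
    simp only [hbk, hb0, Polynomial.coe_mul, mul_assoc]
    rw [← Finset.mul_sum, ← mul_add, mahlerIter_zero, hc', mul_zero]
  · simp only [b, hj, if_false]
    split_ifs with h
    · rw [Polynomial.eval_mul, hsucc, mul_zero]
    · simp

/-- From a Mahler relation for `P(f)` specializing trivially at `α` to the required degeneration. -/
theorem exists_degeneration_of_relation {q r : ℕ} (hq0 : q ≠ 0) {f : Fin r → PowerSeries ℂ} {α : ℂ}
    {P : MvPolynomial (Fin r) ℂ} (hPalg : ∀ w, IsAlgebraic ℚ (MvPolynomial.coeff w P))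
    {d : ℕ} (hPhom : P.IsHomogeneous d) {J : ℕ} {b : ℕ → Polynomial ℂ}
    (hbalg : ∀ j k, IsAlgebraic ℚ ((b j).coeff k))
    (hrel : ∑ j ∈ Finset.range (J + 1),
      (b j : PowerSeries ℂ) * mahlerIter hq0 j (MvPolynomial.aeval f P) = 0)
    (hb0 : (b 0).eval α = 1) (hb : ∀ j, j ≠ 0 → (b j).eval α = 0) :
    ∃ m : Fin r → ℕ, (∀ i, 1 ≤ m i) ∧
      ∃ Q : MvPolynomial (Fin r × ℕ) (Polynomial ℂ),
        (∀ w k, IsAlgebraic ℚ ((MvPolynomial.coeff w Q).coeff k)) ∧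
        (∀ w ∈ Q.vars, w.2 < m w.1) ∧
        (∃ e, Q.IsHomogeneous e) ∧
        MvPolynomial.eval₂ polyPS (fun w => (psSigma q)^[w.2] (f w.1)) Q = 0 ∧
        MvPolynomial.map (Polynomial.evalRingHom α) Q
          = MvPolynomial.rename (fun i => (i, 0)) P := by
  classical
  let B : ℕ → MvPolynomial (Fin r × ℕ) (Polynomial ℂ) := fun j =>
    MvPolynomial.map Polynomial.C (MvPolynomial.rename (fun i => (i, j)) P)
  refine ⟨fun _ => J + 1, fun _ => by lia,
    ∑ j ∈ Finset.range (J + 1), MvPolynomial.C (b j) * B j, fun w k => ?_, fun w hw => ?_, ⟨d, ?_⟩,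
    ?_, ?_⟩
  · rw [MvPolynomial.coeff_sum, Polynomial.finsetSum_coeff, ← mem_algebraicClosure_iff]
    refine sum_mem fun j _ => ?_
    rw [MvPolynomial.coeff_C_mul, MvPolynomial.coeff_map, Polynomial.coeff_mul_C]
    refine mul_mem (mem_algebraicClosure_iff.2 (hbalg j k)) ?_
    by_cases h : MvPolynomial.coeff w (MvPolynomial.rename (fun i => (i, j)) P) = 0
    · rw [h]
      exact zero_mem _
    · obtain ⟨u, rfl, -⟩ := MvPolynomial.coeff_rename_ne_zero _ _ _ h
      rw [MvPolynomial.coeff_rename_mapDomain _ (Prod.mk_left_injective j)]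
      exact mem_algebraicClosure_iff.2 (hPalg u)
  · have hw' := MvPolynomial.vars_sum_subset _ _ hw
    rw [Finset.mem_biUnion] at hw'
    obtain ⟨j, hj, hw'⟩ := hw'
    have h := MvPolynomial.vars_mul _ _ hw'
    rw [MvPolynomial.vars_C, Finset.empty_union] at h
    have h := MvPolynomial.vars_rename _ _ (MvPolynomial.vars_map _ _ h)
    obtain ⟨i, -, rfl⟩ := Finset.mem_image.1 h
    exact Finset.mem_range.1 hj
  · refine MvPolynomial.IsHomogeneous.sum _ _ _ fun j _ => ?_
    have := (MvPolynomial.isHomogeneous_C (Fin r × ℕ) (b j)).mul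
      ((hPhom.rename_isHomogeneous (f := fun i => (i, j))).map Polynomial.C)
    rwa [zero_add] at this
  · rw [MvPolynomial.eval₂_sum, ← hrel]
    refine Finset.sum_congr rfl fun j _ => ?_
    rw [MvPolynomial.eval₂_mul, MvPolynomial.eval₂_C, MvPolynomial.eval₂_map,
      MvPolynomial.eval₂_rename]
    congr 1
    rw [MvPolynomial.aeval_def, ← AlgHom.coe_toRingHom, MvPolynomial.hom_eval₂]
    congr 1
    · refine RingHom.ext fun x => ?_
      simpa [polyPS] using ((mahlerIter hq0 j).commutes x).symm
    · ext1 i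
      simp [psSigma_iterate hq0]
  · rw [map_sum, Finset.sum_eq_single 0 (fun j _ hj => by simp [hb j hj]) (by simp)]
    have hid : (Polynomial.evalRingHom α).comp Polynomial.C = RingHom.id ℂ :=
      RingHom.ext fun x => by simp
    simp only [B, map_mul, MvPolynomial.map_C, Polynomial.coe_evalRingHom, hb0, map_one, one_mul,
      MvPolynomial.map_map, hid, MvPolynomial.map_id]

theorem isAlgebraic_coeff_aeval {r : ℕ} {f : Fin r → PowerSeries ℂ}
    (hf : ∀ i n, IsAlgebraic ℚ (PowerSeries.coeff n (f i)))
    {P : MvPolynomial (Fin r) ℂ} (hPalg : ∀ w, IsAlgebraic ℚ (MvPolynomial.coeff w P)) (n : ℕ) :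
    IsAlgebraic ℚ (PowerSeries.coeff n (MvPolynomial.aeval f P)) := by
  let S := (PowerSeries.map (algebraMap (algebraicClosure ℚ ℂ) ℂ)).range
  have hS : ∀ u : PowerSeries ℂ, (∀ n, IsAlgebraic ℚ (PowerSeries.coeff n u)) → u ∈ S := by
    intro u hu
    exact ⟨PowerSeries.mk fun n => ⟨_, mem_algebraicClosure_iff.2 (hu n)⟩, by ext n; simp⟩
  have hmem : MvPolynomial.aeval f P ∈ S := by
    rw [MvPolynomial.aeval_def]
    refine MvPolynomial.eval₂_mem (fun w _ => ?_) fun i => hS _ (hf i)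
    refine ⟨PowerSeries.C ⟨_, mem_algebraicClosure_iff.2 (hPalg w)⟩, ?_⟩
    rw [PowerSeries.map_C]
    rfl
  obtain ⟨u, hu⟩ := hmem
  rw [← hu, PowerSeries.coeff_map]
  exact mem_algebraicClosure_iff.1 (PowerSeries.coeff n u).2

/-- Absolute convergence and values of polynomials in convergent power series. -/
theorem aeval_mem_convergentSubring {r : ℕ} {ρ : ℝ} {f : Fin r → PowerSeries ℂ}
    (hf : ∀ i, f i ∈ convergentSubring (RingHom.id ℂ) ρ) (P : MvPolynomial (Fin r) ℂ) :
    MvPolynomial.aeval f P ∈ convergentSubring (RingHom.id ℂ) ρ ∧ ∀ z : ℂ, ‖z‖ ≤ ρ →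
      psValue (RingHom.id ℂ) (MvPolynomial.aeval f P) z =
        MvPolynomial.eval (fun i => psValue (RingHom.id ℂ) (f i) z) P := by
  let S := convergentSubring (RingHom.id ℂ) ρ
  have hC (x : ℂ) : PowerSeries.C x ∈ S := by
    rw [← Polynomial.coe_C]
    exact coe_mem_convergentSubring _
  let C' : ℂ →+* S := (PowerSeries.C : ℂ →+* PowerSeries ℂ).codRestrict S hC
  let u : S := MvPolynomial.eval₂ C' (fun i => ⟨f i, hf i⟩) P
  have hu : (u : PowerSeries ℂ) = MvPolynomial.aeval f P := by
    change S.subtype u = _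
    rw [MvPolynomial.hom_eval₂, MvPolynomial.aeval_def]
    rfl
  refine ⟨hu ▸ u.2, fun z hz => ?_⟩
  rw [← hu, ← convEval_apply hz, MvPolynomial.hom_eval₂, ← MvPolynomial.eval₂_id]
  congr 1
  refine RingHom.ext fun x => ?_
  change psValue (RingHom.id ℂ) (PowerSeries.C x) z = x
  rw [← Polynomial.coe_C, psValue_coe, Polynomial.eval₂_C, RingHom.id_apply]

theorem meromorphicAt_eval_mvPolynomial {r : ℕ} {F : Fin r → ℂ → ℂ} {z : ℂ}
    (hF : ∀ i, MeromorphicAt (F i) z) (P : MvPolynomial (Fin r) ℂ) :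
    MeromorphicAt (fun w => MvPolynomial.eval (fun i => F i w) P) z := by
  induction P using MvPolynomial.induction_on with
  | C a => simp
  | add p q hp hq =>
    simp only [map_add]
    exact hp.add hq
  | mul_X p i hp =>
    simp only [map_mul, MvPolynomial.eval_X]
    exact hp.mul (hF i)

/-- Every homogeneous algebraic relation over `ℚ̄` among the values of
M_q-functions `f₁, …, f_r` at an algebraic point `α`, `0 < |α| < 1`, which is not a pole of
any of them, is the degeneration at `α` of a homogeneous `σ_q`-algebraic relation
`Q ∈ ℚ̄[z, X_{i,j}]`: `Q(z, (f_i(z^{q^j}))) = 0` identically and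
`Q(α, X) = P(X_{1,0}, …, X_{r,0})`. -/
theorem M_relations_are_degenerations
    (q : ℕ) (hq : 2 ≤ q)
    (r : ℕ) (f : Fin r → PowerSeries ℂ) (hM : ∀ i, IsM q (f i))
    (α : ℂ) (hαalg : IsAlgebraic ℚ α)
    (hα0 : 0 < ‖α‖) (hα1 : ‖α‖ < 1)
    (v : Fin r → ℂ) (hv : ∀ i, MahlerValue (f i) α (v i))
    (P : MvPolynomial (Fin r) ℂ)
    (hPalg : ∀ w, IsAlgebraic ℚ (MvPolynomial.coeff w P))
    (d : ℕ) (hPhom : P.IsHomogeneous d)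
    (hval : MvPolynomial.eval v P = 0) :
    ∃ m : Fin r → ℕ, (∀ i, 1 ≤ m i) ∧
      ∃ Q : MvPolynomial (Fin r × ℕ) (Polynomial ℂ),
        (∀ w k, IsAlgebraic ℚ ((MvPolynomial.coeff w Q).coeff k)) ∧
        (∀ w ∈ Q.vars, w.2 < m w.1) ∧
        (∃ e, Q.IsHomogeneous e) ∧
        MvPolynomial.eval₂ polyPS (fun w => (psSigma q)^[w.2] (f w.1)) Q = 0 ∧
        MvPolynomial.map (Polynomial.evalRingHom α) Q
          = MvPolynomial.rename (fun i => (i, 0)) P := by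
  have hq0 : q ≠ 0 := by lia
  set g := MvPolynomial.aeval f P with hgdef
  by_cases hg0 : g = 0
  · refine exists_degeneration_of_relation hq0 hPalg hPhom (J := 0)
      (b := fun j => if j = 0 then 1 else 0) (fun j k => ?_) ?_ (by simp) fun j hj => by simp [hj]
    · split_ifs
      · rw [Polynomial.coeff_one]
        split_ifs
        exacts [isAlgebraic_one, isAlgebraic_zero]
      · exact isAlgebraic_zero
    · rw [← hgdef, hg0]
      simp
  have hgalg : ∀ n, IsAlgebraic ℚ (PowerSeries.coeff n g) :=
    isAlgebraic_coeff_aeval (fun i => (hM i).1) hPalg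
  have hdep := exists_mahler_relation_aeval hq0 (f := f) (fun i => by
    obtain ⟨-, m, p, -, hp, hrel⟩ := hM i
    refine ⟨m, p, hp, ?_⟩
    simp only [psSigma_iterate hq0] at hrel
    exact hrel) hPhom
  obtain ⟨n, p, hn, hp0, hpn, hpalg, hrel, hind⟩ :=
    exists_minimal_mahler_relation hq0 hg0 hgalg hdep
  obtain ⟨K, hK, a, g', p', rfl, hg', hp'⟩ :=
    exists_numberField_mahler_relation hq hq0 hgalg hp0 hpalg hrel hαalg
  set φ : K →+* ℂ := algebraMap K ℂ with hφ
  have hcoe (c : Polynomial K) : PowerSeries.map φ (c : PowerSeries K) =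
      ((c.map φ : Polynomial ℂ) : PowerSeries ℂ) := by
    ext k
    simp
  have hinj : Function.Injective (PowerSeries.map φ) := PowerSeries.map_injective φ φ.injective
  have hrel' : ∑ j ∈ Finset.range (n + 1), (p' j : PowerSeries K) * mahlerIter hq0 j g' = 0 := by
    apply hinj
    rw [map_zero, ← hrel, map_sum]
    refine Finset.sum_congr rfl fun j hj => ?_
    rw [map_mul, map_mahlerIter, hg', hcoe, hp' j (by rw [Finset.mem_range] at hj; lia)]
  have hp'0 : p' 0 ≠ 0 := fun h => hp0 (by rw [← hp' 0 (by lia), h, Polynomial.map_zero])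
  have hp'n : p' n ≠ 0 := fun h => hpn (by rw [← hp' n le_rfl, h, Polynomial.map_zero])
  choose F hFmer hFsum hFan hFval using hv
  obtain ⟨ε, hε, hεsum⟩ := Metric.eventually_nhds_iff.1 (Filter.eventually_all.2 hFsum)
  set ρ := min (ε / 2) (1 / 2) with hρ
  have hρ0 : 0 < ρ := by positivity
  have hρε : ρ < ε := (min_le_left _ _).trans_lt (by linarith)
  have hρ1 : ρ < 1 := (min_le_right _ _).trans_lt (by norm_num)
  have hFv {z : ℂ} (hz : ‖z‖ ≤ ρ) (i : Fin r) : HasSum (fun n => PowerSeries.coeff n (f i) * z ^ n)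
      (F i z) := hεsum (by simpa using hz.trans_lt hρε) i
  have hfmem (i : Fin r) : f i ∈ convergentSubring (RingHom.id ℂ) ρ := by
    rw [mem_convergentSubring]
    exact (hFv (z := (ρ : ℂ)) (by simp [abs_of_pos hρ0]) i).summable.norm
  obtain ⟨hgmem, hgval⟩ := aeval_mem_convergentSubring hfmem P
  rw [← hgdef] at hgmem hgval
  have hpsV (z : ℂ) : psValue φ g' z = psValue (RingHom.id ℂ) g z := by
    simp [psValue, ← hg']
  have hg'mem : g' ∈ convergentSubring φ ρ := by
    rw [mem_convergentSubring] at hgmem ⊢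
    simpa [← hg'] using hgmem
  have hG0 : ∀ᶠ z in nhds (0 : ℂ), MvPolynomial.eval (fun i => F i z) P = psValue φ g' z := by
    filter_upwards [Metric.ball_mem_nhds (0 : ℂ) hρ0] with z hz
    rw [mem_ball_zero_iff] at hz
    rw [hpsV, hgval z hz.le]
    congr 2
    ext1 i
    exact (hFv hz.le i).tsum_eq.symm
  obtain ⟨J, b, hbrel, hb0, hb⟩ := exists_mahler_relation_eval hq hq0 hρ0 hρ1
    (norm_pos_iff.1 hα0 |> (map_ne_zero φ).1) hα1 hg'mem hn hp'0 hp'n hrel' (by rwa [hg'])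
    (fun z hz => meromorphicAt_eval_mvPolynomial (fun i => hFmer i z hz) P) hG0
    (by simpa [MvPolynomial.coe_aeval_eq_eval] using
      AnalyticAt.aeval_mvPolynomial (f := fun z i => F i z) hFan P)
    (by rw [← hval]; congr 2; ext1 i; exact hFval i)
  refine exists_degeneration_of_relation hq0 hPalg hPhom (J := J) (b := fun j => (b j).map φ)
    (fun j k => ?_) ?_ ?_ fun j hj => ?_
  · rw [Polynomial.coeff_map]
    exact (Algebra.IsAlgebraic.isAlgebraic (R := ℚ) ((b j).coeff k)).algebraMap
  · rw [← hgdef, ← map_zero (PowerSeries.map φ), ← hbrel, map_sum]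
    exact Finset.sum_congr rfl fun j _ => by rw [map_mul, map_mahlerIter, hg', hcoe]
  · rw [Polynomial.eval_map, Polynomial.eval₂_at_apply, hb0, map_one]
  · rw [Polynomial.eval_map, Polynomial.eval₂_at_apply, hb j hj, map_zero]
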